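/- (Dixmier–Lazard; confirmed by the paper's computation.) The minimal number of generators of the invariant algebra of the binary septimic is 30: the ℂ-subalgebra I_7 = { f ∈ ℂ[t, x_1, …, x_7] : D1(f) = 0 and D2(f) = 0 } can be generated as a ℂ-algebra by some set of 30 elements, but cannot be generated by any set of fewer than 30 elements. -/

import Mathlib

open MvPolynomial Finset

/-- The derivation `D1 = t·∂/∂x₁ + 2x₁·∂/∂x₂ + ⋯ + 7x₆·∂/∂x₇` on `ℂ[t, x₁, …, x₇]`,
where the variable of index `0` is `t` and the variable of index `j ≥ 1` is `x_j`. -/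
noncomputable def D1 : Derivation ℂ (MvPolynomial (Fin 8) ℂ) (MvPolynomial (Fin 8) ℂ) :=
  MvPolynomial.mkDerivation ℂ
    ![0, MvPolynomial.X 0, 2 * MvPolynomial.X 1, 3 * MvPolynomial.X 2, 4 * MvPolynomial.X 3,
      5 * MvPolynomial.X 4, 6 * MvPolynomial.X 5, 7 * MvPolynomial.X 6]

/-- The derivation `D2 = 7x₁·∂/∂t + 6x₂·∂/∂x₁ + ⋯ + x₇·∂/∂x₆` on `ℂ[t, x₁, …, x₇]`. -/
noncomputable def D2 : Derivation ℂ (MvPolynomial (Fin 8) ℂ) (MvPolynomial (Fin 8) ℂ) :=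
  MvPolynomial.mkDerivation ℂ
    ![7 * MvPolynomial.X 1, 6 * MvPolynomial.X 2, 5 * MvPolynomial.X 3, 4 * MvPolynomial.X 4,
      3 * MvPolynomial.X 5, 2 * MvPolynomial.X 6, MvPolynomial.X 7, 0]




set_option linter.unusedSimpArgs false

namespace Sept

abbrev R8 := MvPolynomial (Fin 8) ℂ

theorem Dsmul (D : Derivation ℂ R8 R8) (c : ℂ) (u : R8) : D (c • u) = c • D u := D.map_smul c u

/-- diagonal derivation -/
noncomputable def Dg (c : Fin 8 → ℂ) : Derivation ℂ R8 R8 :=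
  MvPolynomial.mkDerivation ℂ (fun i => c i • (MvPolynomial.X i : R8))

theorem Dg_monomial (c : Fin 8 → ℂ) (m : Fin 8 →₀ ℕ) (r : ℂ) :
    Dg c (monomial m r) = (∑ i, (m i : ℂ) * c i) • (monomial m r : R8) := by
  induction m using Finsupp.induction_linear generalizing r with
  | zero =>
    have h : (monomial 0 r : R8) = C r := rfl
    rw [h, derivation_C]; simp
  | add f g hf hg =>
    have h : (monomial (f + g) r : R8) = monomial f r * monomial g 1 := by
      rw [monomial_mul, mul_one]
    rw [h, Derivation.leibniz, hf, hg]
    simp only [smul_eq_mul, mul_smul_comm, Finsupp.add_apply, Nat.cast_add, add_mul,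
      Finset.sum_add_distrib, add_smul]
    rw [add_comm, mul_comm (monomial g 1 : R8)]
  | single i n =>
    have h : (monomial (Finsupp.single i n) r : R8) = C r * X i ^ n := by
      rw [C_mul_X_pow_eq_monomial]
    rw [h, ← MvPolynomial.smul_eq_C_mul, Dsmul, Derivation.leibniz_pow, Dg, mkDerivation_X]
    have h2 : (∑ j, ((Finsupp.single i n) j : ℂ) * c j) = n * c i := by
      rw [Finset.sum_eq_single i]
      · simp
      · intro b _ hb; simp [Finsupp.single_apply, hb.symm]
      · simp
    rw [h2]
    cases n with
    | zero => simp
    | succ k =>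
      simp only [Nat.add_sub_cancel, smul_eq_mul, MvPolynomial.smul_eq_C_mul, nsmul_eq_mul, map_mul,
        map_natCast]
      ring

theorem coeff_Dg (c : Fin 8 → ℂ) (u : R8) (m : Fin 8 →₀ ℕ) :
    coeff m (Dg c u) = (∑ i, (m i : ℂ) * c i) * coeff m u := by
  induction u using MvPolynomial.induction_on' with
  | monomial n r =>
    rw [Dg_monomial, coeff_smul, coeff_monomial, smul_eq_mul]
    split_ifs with h
    · rw [h]
    · simp
  | add p q hp hq => rw [map_add, coeff_add, coeff_add, hp, hq]; ring

def wt (m : Fin 8 →₀ ℕ) : ℤ := ∑ i, (m i : ℤ) * (7 - 2 * (i.val : ℤ))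

noncomputable def mons (d : ℕ) (w : ℤ) : Finset (Fin 8 →₀ ℕ) :=
  ((Finset.univ : Finset (Fin 8)).finsuppAntidiag d).filter (fun m => wt m = w)

theorem mem_mons {d : ℕ} {w : ℤ} {m : Fin 8 →₀ ℕ} :
    m ∈ mons d w ↔ (∑ i, m i = d) ∧ wt m = w := by
  simp [mons, Finset.mem_finsuppAntidiag]

noncomputable def NN : Derivation ℂ R8 R8 := Dg (fun _ => 1)
noncomputable def HH : Derivation ℂ R8 R8 := Dg (fun i => 7 - 2 * (i.val : ℂ))

/-- weight space -/
noncomputable def V (d : ℕ) (w : ℤ) : Submodule ℂ R8 :=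
  restrictSupport ℂ (mons d w : Set (Fin 8 →₀ ℕ))

theorem wt_cast (m : Fin 8 →₀ ℕ) : (∑ i, (m i : ℂ) * (7 - 2 * (i.val : ℂ))) = (wt m : ℂ) := by
  simp [wt]

theorem mem_V {d : ℕ} {w : ℤ} {u : R8} : u ∈ V d w ↔ NN u = (d : ℂ) • u ∧ HH u = (w : ℂ) • u := by
  rw [V, mem_restrictSupport_iff]
  constructor
  · intro h
    constructor
    · ext m
      rw [NN, coeff_Dg, coeff_smul, smul_eq_mul]
      by_cases hm : coeff m u = 0
      · simp [hm]
      · have := mem_mons.1 (h (mem_support_iff.2 hm))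
        congr 1
        rw [← this.1]; simp
    · ext m
      rw [HH, coeff_Dg, coeff_smul, smul_eq_mul, wt_cast]
      by_cases hm : coeff m u = 0
      · simp [hm]
      · have := mem_mons.1 (h (mem_support_iff.2 hm))
        rw [this.2]
  · rintro ⟨h1, h2⟩ m hm
    have hm' : coeff m u ≠ 0 := mem_support_iff.1 hm
    have e1 := congrArg (coeff m) h1
    have e2 := congrArg (coeff m) h2
    rw [NN, coeff_Dg, coeff_smul, smul_eq_mul] at e1
    rw [HH, coeff_Dg, coeff_smul, smul_eq_mul, wt_cast] at e2
    have e1 := mul_right_cancel₀ hm' e1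
    have e2 := mul_right_cancel₀ hm' e2
    refine mem_mons.2 ⟨?_, by exact_mod_cast e2⟩
    simp only [mul_one] at e1
    exact_mod_cast e1

theorem D1X0 : D1 (X 0 : R8) = 0 := by simp [D1, mkDerivation_X]
theorem D1X1 : D1 (X 1 : R8) = (1 : ℂ) • X 0 := by simp [D1, mkDerivation_X, MvPolynomial.smul_eq_C_mul, map_ofNat (C : ℂ →+* R8)]
theorem D1X2 : D1 (X 2 : R8) = (2 : ℂ) • X 1 := by simp [D1, mkDerivation_X, MvPolynomial.smul_eq_C_mul, map_ofNat (C : ℂ →+* R8)]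
theorem D1X3 : D1 (X 3 : R8) = (3 : ℂ) • X 2 := by simp [D1, mkDerivation_X, MvPolynomial.smul_eq_C_mul, map_ofNat (C : ℂ →+* R8)]
theorem D1X4 : D1 (X 4 : R8) = (4 : ℂ) • X 3 := by simp [D1, mkDerivation_X, MvPolynomial.smul_eq_C_mul, map_ofNat (C : ℂ →+* R8)]
theorem D1X5 : D1 (X 5 : R8) = (5 : ℂ) • X 4 := by simp [D1, mkDerivation_X, MvPolynomial.smul_eq_C_mul, map_ofNat (C : ℂ →+* R8)]
theorem D1X6 : D1 (X 6 : R8) = (6 : ℂ) • X 5 := by simp [D1, mkDerivation_X, MvPolynomial.smul_eq_C_mul, map_ofNat (C : ℂ →+* R8)]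
theorem D1X7 : D1 (X 7 : R8) = (7 : ℂ) • X 6 := by simp [D1, mkDerivation_X, MvPolynomial.smul_eq_C_mul, map_ofNat (C : ℂ →+* R8)]
theorem D2X0 : D2 (X 0 : R8) = (7 : ℂ) • X 1 := by simp [D2, mkDerivation_X, MvPolynomial.smul_eq_C_mul, map_ofNat (C : ℂ →+* R8)]
theorem D2X1 : D2 (X 1 : R8) = (6 : ℂ) • X 2 := by simp [D2, mkDerivation_X, MvPolynomial.smul_eq_C_mul, map_ofNat (C : ℂ →+* R8)]
theorem D2X2 : D2 (X 2 : R8) = (5 : ℂ) • X 3 := by simp [D2, mkDerivation_X, MvPolynomial.smul_eq_C_mul, map_ofNat (C : ℂ →+* R8)]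
theorem D2X3 : D2 (X 3 : R8) = (4 : ℂ) • X 4 := by simp [D2, mkDerivation_X, MvPolynomial.smul_eq_C_mul, map_ofNat (C : ℂ →+* R8)]
theorem D2X4 : D2 (X 4 : R8) = (3 : ℂ) • X 5 := by simp [D2, mkDerivation_X, MvPolynomial.smul_eq_C_mul, map_ofNat (C : ℂ →+* R8)]
theorem D2X5 : D2 (X 5 : R8) = (2 : ℂ) • X 6 := by simp [D2, mkDerivation_X, MvPolynomial.smul_eq_C_mul, map_ofNat (C : ℂ →+* R8)]
theorem D2X6 : D2 (X 6 : R8) = (1 : ℂ) • X 7 := by simp [D2, mkDerivation_X, MvPolynomial.smul_eq_C_mul, map_ofNat (C : ℂ →+* R8)]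
theorem D2X7 : D2 (X 7 : R8) = 0 := by simp [D2, mkDerivation_X]
theorem DgX (c : Fin 8 → ℂ) (i : Fin 8) : Dg c (X i : R8) = c i • X i := by rw [Dg, mkDerivation_X]
theorem HHX0 : HH (X 0 : R8) = (7 : ℂ) • X 0 := by rw [HH, DgX]; congr 1; norm_num
theorem HHX1 : HH (X 1 : R8) = (5 : ℂ) • X 1 := by rw [HH, DgX]; congr 1; norm_num
theorem HHX2 : HH (X 2 : R8) = (3 : ℂ) • X 2 := by rw [HH, DgX]; congr 1; norm_num
theorem HHX3 : HH (X 3 : R8) = (1 : ℂ) • X 3 := by rw [HH, DgX]; congr 1; norm_num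
theorem HHX4 : HH (X 4 : R8) = (-1 : ℂ) • X 4 := by rw [HH, DgX]; congr 1; norm_num
theorem HHX5 : HH (X 5 : R8) = (-3 : ℂ) • X 5 := by rw [HH, DgX]; congr 1; norm_num
theorem HHX6 : HH (X 6 : R8) = (-5 : ℂ) • X 6 := by rw [HH, DgX]; congr 1; norm_num
theorem HHX7 : HH (X 7 : R8) = (-7 : ℂ) • X 7 := by rw [HH, DgX]; congr 1; norm_num
theorem NNX (i : Fin 8) : NN (X i : R8) = X i := by rw [NN, DgX, one_smul]

theorem comm_EF (u : R8) : D1 (D2 u) = D2 (D1 u) + HH u := by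
  have : ⁅D1, D2⁆ = HH := by
    apply derivation_ext
    intro i
    rw [Derivation.commutator_apply]
    match i with
    | 0 => simp only [D1X0, D1X1, D1X2, D1X3, D1X4, D1X5, D1X6, D1X7, D2X0, D2X1, D2X2, D2X3, D2X4, D2X5, D2X6, D2X7, HHX0, HHX1, HHX2, HHX3, HHX4, HHX5, HHX6, HHX7, NNX, Dsmul, Derivation.smul_apply, Derivation.zero_apply, map_zero]; try module
    | 1 => simp only [D1X0, D1X1, D1X2, D1X3, D1X4, D1X5, D1X6, D1X7, D2X0, D2X1, D2X2, D2X3, D2X4, D2X5, D2X6, D2X7, HHX0, HHX1, HHX2, HHX3, HHX4, HHX5, HHX6, HHX7, NNX, Dsmul, Derivation.smul_apply, Derivation.zero_apply, map_zero]; try module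
    | 2 => simp only [D1X0, D1X1, D1X2, D1X3, D1X4, D1X5, D1X6, D1X7, D2X0, D2X1, D2X2, D2X3, D2X4, D2X5, D2X6, D2X7, HHX0, HHX1, HHX2, HHX3, HHX4, HHX5, HHX6, HHX7, NNX, Dsmul, Derivation.smul_apply, Derivation.zero_apply, map_zero]; try module
    | 3 => simp only [D1X0, D1X1, D1X2, D1X3, D1X4, D1X5, D1X6, D1X7, D2X0, D2X1, D2X2, D2X3, D2X4, D2X5, D2X6, D2X7, HHX0, HHX1, HHX2, HHX3, HHX4, HHX5, HHX6, HHX7, NNX, Dsmul, Derivation.smul_apply, Derivation.zero_apply, map_zero]; try module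
    | 4 => simp only [D1X0, D1X1, D1X2, D1X3, D1X4, D1X5, D1X6, D1X7, D2X0, D2X1, D2X2, D2X3, D2X4, D2X5, D2X6, D2X7, HHX0, HHX1, HHX2, HHX3, HHX4, HHX5, HHX6, HHX7, NNX, Dsmul, Derivation.smul_apply, Derivation.zero_apply, map_zero]; try module
    | 5 => simp only [D1X0, D1X1, D1X2, D1X3, D1X4, D1X5, D1X6, D1X7, D2X0, D2X1, D2X2, D2X3, D2X4, D2X5, D2X6, D2X7, HHX0, HHX1, HHX2, HHX3, HHX4, HHX5, HHX6, HHX7, NNX, Dsmul, Derivation.smul_apply, Derivation.zero_apply, map_zero]; try module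
    | 6 => simp only [D1X0, D1X1, D1X2, D1X3, D1X4, D1X5, D1X6, D1X7, D2X0, D2X1, D2X2, D2X3, D2X4, D2X5, D2X6, D2X7, HHX0, HHX1, HHX2, HHX3, HHX4, HHX5, HHX6, HHX7, NNX, Dsmul, Derivation.smul_apply, Derivation.zero_apply, map_zero]; try module
    | 7 => simp only [D1X0, D1X1, D1X2, D1X3, D1X4, D1X5, D1X6, D1X7, D2X0, D2X1, D2X2, D2X3, D2X4, D2X5, D2X6, D2X7, HHX0, HHX1, HHX2, HHX3, HHX4, HHX5, HHX6, HHX7, NNX, Dsmul, Derivation.smul_apply, Derivation.zero_apply, map_zero]; try module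
  have h := congrArg (fun D => D u) this
  simp only [Derivation.commutator_apply] at h
  rw [← h]; ring

theorem comm_NE (u : R8) : NN (D1 u) = D1 (NN u) := by
  have : ⁅NN, D1⁆ = 0 := by
    apply derivation_ext
    intro i
    rw [Derivation.commutator_apply]
    match i with
    | 0 => simp only [D1X0, D1X1, D1X2, D1X3, D1X4, D1X5, D1X6, D1X7, D2X0, D2X1, D2X2, D2X3, D2X4, D2X5, D2X6, D2X7, HHX0, HHX1, HHX2, HHX3, HHX4, HHX5, HHX6, HHX7, NNX, Dsmul, Derivation.smul_apply, Derivation.zero_apply, map_zero]; try module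
    | 1 => simp only [D1X0, D1X1, D1X2, D1X3, D1X4, D1X5, D1X6, D1X7, D2X0, D2X1, D2X2, D2X3, D2X4, D2X5, D2X6, D2X7, HHX0, HHX1, HHX2, HHX3, HHX4, HHX5, HHX6, HHX7, NNX, Dsmul, Derivation.smul_apply, Derivation.zero_apply, map_zero]; try module
    | 2 => simp only [D1X0, D1X1, D1X2, D1X3, D1X4, D1X5, D1X6, D1X7, D2X0, D2X1, D2X2, D2X3, D2X4, D2X5, D2X6, D2X7, HHX0, HHX1, HHX2, HHX3, HHX4, HHX5, HHX6, HHX7, NNX, Dsmul, Derivation.smul_apply, Derivation.zero_apply, map_zero]; try module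
    | 3 => simp only [D1X0, D1X1, D1X2, D1X3, D1X4, D1X5, D1X6, D1X7, D2X0, D2X1, D2X2, D2X3, D2X4, D2X5, D2X6, D2X7, HHX0, HHX1, HHX2, HHX3, HHX4, HHX5, HHX6, HHX7, NNX, Dsmul, Derivation.smul_apply, Derivation.zero_apply, map_zero]; try module
    | 4 => simp only [D1X0, D1X1, D1X2, D1X3, D1X4, D1X5, D1X6, D1X7, D2X0, D2X1, D2X2, D2X3, D2X4, D2X5, D2X6, D2X7, HHX0, HHX1, HHX2, HHX3, HHX4, HHX5, HHX6, HHX7, NNX, Dsmul, Derivation.smul_apply, Derivation.zero_apply, map_zero]; try module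
    | 5 => simp only [D1X0, D1X1, D1X2, D1X3, D1X4, D1X5, D1X6, D1X7, D2X0, D2X1, D2X2, D2X3, D2X4, D2X5, D2X6, D2X7, HHX0, HHX1, HHX2, HHX3, HHX4, HHX5, HHX6, HHX7, NNX, Dsmul, Derivation.smul_apply, Derivation.zero_apply, map_zero]; try module
    | 6 => simp only [D1X0, D1X1, D1X2, D1X3, D1X4, D1X5, D1X6, D1X7, D2X0, D2X1, D2X2, D2X3, D2X4, D2X5, D2X6, D2X7, HHX0, HHX1, HHX2, HHX3, HHX4, HHX5, HHX6, HHX7, NNX, Dsmul, Derivation.smul_apply, Derivation.zero_apply, map_zero]; try module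
    | 7 => simp only [D1X0, D1X1, D1X2, D1X3, D1X4, D1X5, D1X6, D1X7, D2X0, D2X1, D2X2, D2X3, D2X4, D2X5, D2X6, D2X7, HHX0, HHX1, HHX2, HHX3, HHX4, HHX5, HHX6, HHX7, NNX, Dsmul, Derivation.smul_apply, Derivation.zero_apply, map_zero]; try module
  have h := congrArg (fun D => D u) this
  simp only [Derivation.commutator_apply] at h
  exact sub_eq_zero.1 (by simpa using h)

theorem comm_HE (u : R8) : HH (D1 u) = D1 (HH u) + 2 * D1 u := by
  have : ⁅HH, D1⁆ = (2 : ℂ) • D1 := by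
    apply derivation_ext
    intro i
    rw [Derivation.commutator_apply]
    match i with
    | 0 => simp only [D1X0, D1X1, D1X2, D1X3, D1X4, D1X5, D1X6, D1X7, D2X0, D2X1, D2X2, D2X3, D2X4, D2X5, D2X6, D2X7, HHX0, HHX1, HHX2, HHX3, HHX4, HHX5, HHX6, HHX7, NNX, Dsmul, Derivation.smul_apply, Derivation.zero_apply, map_zero]; try module
    | 1 => simp only [D1X0, D1X1, D1X2, D1X3, D1X4, D1X5, D1X6, D1X7, D2X0, D2X1, D2X2, D2X3, D2X4, D2X5, D2X6, D2X7, HHX0, HHX1, HHX2, HHX3, HHX4, HHX5, HHX6, HHX7, NNX, Dsmul, Derivation.smul_apply, Derivation.zero_apply, map_zero]; try module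
    | 2 => simp only [D1X0, D1X1, D1X2, D1X3, D1X4, D1X5, D1X6, D1X7, D2X0, D2X1, D2X2, D2X3, D2X4, D2X5, D2X6, D2X7, HHX0, HHX1, HHX2, HHX3, HHX4, HHX5, HHX6, HHX7, NNX, Dsmul, Derivation.smul_apply, Derivation.zero_apply, map_zero]; try module
    | 3 => simp only [D1X0, D1X1, D1X2, D1X3, D1X4, D1X5, D1X6, D1X7, D2X0, D2X1, D2X2, D2X3, D2X4, D2X5, D2X6, D2X7, HHX0, HHX1, HHX2, HHX3, HHX4, HHX5, HHX6, HHX7, NNX, Dsmul, Derivation.smul_apply, Derivation.zero_apply, map_zero]; try module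
    | 4 => simp only [D1X0, D1X1, D1X2, D1X3, D1X4, D1X5, D1X6, D1X7, D2X0, D2X1, D2X2, D2X3, D2X4, D2X5, D2X6, D2X7, HHX0, HHX1, HHX2, HHX3, HHX4, HHX5, HHX6, HHX7, NNX, Dsmul, Derivation.smul_apply, Derivation.zero_apply, map_zero]; try module
    | 5 => simp only [D1X0, D1X1, D1X2, D1X3, D1X4, D1X5, D1X6, D1X7, D2X0, D2X1, D2X2, D2X3, D2X4, D2X5, D2X6, D2X7, HHX0, HHX1, HHX2, HHX3, HHX4, HHX5, HHX6, HHX7, NNX, Dsmul, Derivation.smul_apply, Derivation.zero_apply, map_zero]; try module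
    | 6 => simp only [D1X0, D1X1, D1X2, D1X3, D1X4, D1X5, D1X6, D1X7, D2X0, D2X1, D2X2, D2X3, D2X4, D2X5, D2X6, D2X7, HHX0, HHX1, HHX2, HHX3, HHX4, HHX5, HHX6, HHX7, NNX, Dsmul, Derivation.smul_apply, Derivation.zero_apply, map_zero]; try module
    | 7 => simp only [D1X0, D1X1, D1X2, D1X3, D1X4, D1X5, D1X6, D1X7, D2X0, D2X1, D2X2, D2X3, D2X4, D2X5, D2X6, D2X7, HHX0, HHX1, HHX2, HHX3, HHX4, HHX5, HHX6, HHX7, NNX, Dsmul, Derivation.smul_apply, Derivation.zero_apply, map_zero]; try module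
  have h := congrArg (fun D => D u) this
  simp only [Derivation.commutator_apply, Derivation.smul_apply] at h
  have h3 : (2 : ℂ) • D1 u = 2 * D1 u := by
    rw [MvPolynomial.smul_eq_C_mul, map_ofNat]
  rw [← h3, ← h]; ring

theorem comm_NF (u : R8) : NN (D2 u) = D2 (NN u) := by
  have : ⁅NN, D2⁆ = 0 := by
    apply derivation_ext
    intro i
    rw [Derivation.commutator_apply]
    match i with
    | 0 => simp only [D1X0, D1X1, D1X2, D1X3, D1X4, D1X5, D1X6, D1X7, D2X0, D2X1, D2X2, D2X3, D2X4, D2X5, D2X6, D2X7, HHX0, HHX1, HHX2, HHX3, HHX4, HHX5, HHX6, HHX7, NNX, Dsmul, Derivation.smul_apply, Derivation.zero_apply, map_zero]; try module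
    | 1 => simp only [D1X0, D1X1, D1X2, D1X3, D1X4, D1X5, D1X6, D1X7, D2X0, D2X1, D2X2, D2X3, D2X4, D2X5, D2X6, D2X7, HHX0, HHX1, HHX2, HHX3, HHX4, HHX5, HHX6, HHX7, NNX, Dsmul, Derivation.smul_apply, Derivation.zero_apply, map_zero]; try module
    | 2 => simp only [D1X0, D1X1, D1X2, D1X3, D1X4, D1X5, D1X6, D1X7, D2X0, D2X1, D2X2, D2X3, D2X4, D2X5, D2X6, D2X7, HHX0, HHX1, HHX2, HHX3, HHX4, HHX5, HHX6, HHX7, NNX, Dsmul, Derivation.smul_apply, Derivation.zero_apply, map_zero]; try module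
    | 3 => simp only [D1X0, D1X1, D1X2, D1X3, D1X4, D1X5, D1X6, D1X7, D2X0, D2X1, D2X2, D2X3, D2X4, D2X5, D2X6, D2X7, HHX0, HHX1, HHX2, HHX3, HHX4, HHX5, HHX6, HHX7, NNX, Dsmul, Derivation.smul_apply, Derivation.zero_apply, map_zero]; try module
    | 4 => simp only [D1X0, D1X1, D1X2, D1X3, D1X4, D1X5, D1X6, D1X7, D2X0, D2X1, D2X2, D2X3, D2X4, D2X5, D2X6, D2X7, HHX0, HHX1, HHX2, HHX3, HHX4, HHX5, HHX6, HHX7, NNX, Dsmul, Derivation.smul_apply, Derivation.zero_apply, map_zero]; try module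
    | 5 => simp only [D1X0, D1X1, D1X2, D1X3, D1X4, D1X5, D1X6, D1X7, D2X0, D2X1, D2X2, D2X3, D2X4, D2X5, D2X6, D2X7, HHX0, HHX1, HHX2, HHX3, HHX4, HHX5, HHX6, HHX7, NNX, Dsmul, Derivation.smul_apply, Derivation.zero_apply, map_zero]; try module
    | 6 => simp only [D1X0, D1X1, D1X2, D1X3, D1X4, D1X5, D1X6, D1X7, D2X0, D2X1, D2X2, D2X3, D2X4, D2X5, D2X6, D2X7, HHX0, HHX1, HHX2, HHX3, HHX4, HHX5, HHX6, HHX7, NNX, Dsmul, Derivation.smul_apply, Derivation.zero_apply, map_zero]; try module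
    | 7 => simp only [D1X0, D1X1, D1X2, D1X3, D1X4, D1X5, D1X6, D1X7, D2X0, D2X1, D2X2, D2X3, D2X4, D2X5, D2X6, D2X7, HHX0, HHX1, HHX2, HHX3, HHX4, HHX5, HHX6, HHX7, NNX, Dsmul, Derivation.smul_apply, Derivation.zero_apply, map_zero]; try module
  have h := congrArg (fun D => D u) this
  simp only [Derivation.commutator_apply] at h
  exact sub_eq_zero.1 (by simpa using h)

theorem comm_HF (u : R8) : HH (D2 u) = D2 (HH u) - 2 * D2 u := by
  have : ⁅HH, D2⁆ = (-2 : ℂ) • D2 := by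
    apply derivation_ext
    intro i
    rw [Derivation.commutator_apply]
    match i with
    | 0 => simp only [D1X0, D1X1, D1X2, D1X3, D1X4, D1X5, D1X6, D1X7, D2X0, D2X1, D2X2, D2X3, D2X4, D2X5, D2X6, D2X7, HHX0, HHX1, HHX2, HHX3, HHX4, HHX5, HHX6, HHX7, NNX, Dsmul, Derivation.smul_apply, Derivation.zero_apply, map_zero]; try module
    | 1 => simp only [D1X0, D1X1, D1X2, D1X3, D1X4, D1X5, D1X6, D1X7, D2X0, D2X1, D2X2, D2X3, D2X4, D2X5, D2X6, D2X7, HHX0, HHX1, HHX2, HHX3, HHX4, HHX5, HHX6, HHX7, NNX, Dsmul, Derivation.smul_apply, Derivation.zero_apply, map_zero]; try module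
    | 2 => simp only [D1X0, D1X1, D1X2, D1X3, D1X4, D1X5, D1X6, D1X7, D2X0, D2X1, D2X2, D2X3, D2X4, D2X5, D2X6, D2X7, HHX0, HHX1, HHX2, HHX3, HHX4, HHX5, HHX6, HHX7, NNX, Dsmul, Derivation.smul_apply, Derivation.zero_apply, map_zero]; try module
    | 3 => simp only [D1X0, D1X1, D1X2, D1X3, D1X4, D1X5, D1X6, D1X7, D2X0, D2X1, D2X2, D2X3, D2X4, D2X5, D2X6, D2X7, HHX0, HHX1, HHX2, HHX3, HHX4, HHX5, HHX6, HHX7, NNX, Dsmul, Derivation.smul_apply, Derivation.zero_apply, map_zero]; try module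
    | 4 => simp only [D1X0, D1X1, D1X2, D1X3, D1X4, D1X5, D1X6, D1X7, D2X0, D2X1, D2X2, D2X3, D2X4, D2X5, D2X6, D2X7, HHX0, HHX1, HHX2, HHX3, HHX4, HHX5, HHX6, HHX7, NNX, Dsmul, Derivation.smul_apply, Derivation.zero_apply, map_zero]; try module
    | 5 => simp only [D1X0, D1X1, D1X2, D1X3, D1X4, D1X5, D1X6, D1X7, D2X0, D2X1, D2X2, D2X3, D2X4, D2X5, D2X6, D2X7, HHX0, HHX1, HHX2, HHX3, HHX4, HHX5, HHX6, HHX7, NNX, Dsmul, Derivation.smul_apply, Derivation.zero_apply, map_zero]; try module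
    | 6 => simp only [D1X0, D1X1, D1X2, D1X3, D1X4, D1X5, D1X6, D1X7, D2X0, D2X1, D2X2, D2X3, D2X4, D2X5, D2X6, D2X7, HHX0, HHX1, HHX2, HHX3, HHX4, HHX5, HHX6, HHX7, NNX, Dsmul, Derivation.smul_apply, Derivation.zero_apply, map_zero]; try module
    | 7 => simp only [D1X0, D1X1, D1X2, D1X3, D1X4, D1X5, D1X6, D1X7, D2X0, D2X1, D2X2, D2X3, D2X4, D2X5, D2X6, D2X7, HHX0, HHX1, HHX2, HHX3, HHX4, HHX5, HHX6, HHX7, NNX, Dsmul, Derivation.smul_apply, Derivation.zero_apply, map_zero]; try module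
  have h := congrArg (fun D => D u) this
  simp only [Derivation.commutator_apply, Derivation.smul_apply] at h
  have h3 : (-2 : ℂ) • D2 u = - 2 * D2 u := by
    rw [MvPolynomial.smul_eq_C_mul, map_neg, map_ofNat]
  have := h.trans h3
  linear_combination this

theorem E_mem {d : ℕ} {w : ℤ} {u : R8} (h : u ∈ V d w) : D1 u ∈ V d (w + 2) := by
  rw [mem_V] at *
  refine ⟨by rw [comm_NE, h.1, Dsmul], ?_⟩
  rw [comm_HE, h.2, Dsmul]
  push_cast
  rw [add_smul]
  congr 1
  rw [MvPolynomial.smul_eq_C_mul, map_ofNat]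

theorem F_mem {d : ℕ} {w : ℤ} {u : R8} (h : u ∈ V d w) : D2 u ∈ V d (w - 2) := by
  rw [mem_V] at *
  refine ⟨by rw [comm_NF, h.1, Dsmul], ?_⟩
  rw [comm_HF, h.2, Dsmul]
  push_cast
  rw [sub_smul]
  congr 1
  rw [MvPolynomial.smul_eq_C_mul, map_ofNat]

theorem wt_ge (m : Fin 8 →₀ ℕ) : -7 * ((∑ i, m i : ℕ) : ℤ) ≤ wt m := by
  rw [wt]; push_cast; rw [Finset.mul_sum]
  apply Finset.sum_le_sum
  intro i _
  have := i.isLt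
  have h2 : (0 : ℤ) ≤ m i := by positivity
  nlinarith [show (i.val : ℤ) ≤ 7 by omega]

theorem V_bot {d : ℕ} {w : ℤ} (h : w < -7 * (d : ℤ)) {u : R8} (hu : u ∈ V d w) : u = 0 := by
  rw [V, mem_restrictSupport_iff] at hu
  rw [← MvPolynomial.support_eq_empty, Finset.eq_empty_iff_forall_notMem]
  intro m hm
  have h1 := mem_mons.1 (hu hm)
  have h2 := wt_ge m
  rw [h1.1, h1.2] at h2
  omega

theorem key_zero {d : ℕ} {u : R8} (hu : u ∈ V d (-2)) (h0 : D2 (D1 u) = 0) : u = 0 := by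
  let f : ℕ → R8 := fun k => (⇑D2)^[k] u
  have fs : ∀ k, f (k + 1) = D2 (f k) := fun k => Function.iterate_succ_apply' _ _ _
  have fm : ∀ k : ℕ, f k ∈ V d (-2 - 2 * k) := by
    intro k
    induction k with
    | zero => simpa [f] using hu
    | succ k ih =>
      rw [fs]
      have := F_mem ih
      convert this using 2
      push_cast; ring
  have fE : ∀ k : ℕ, D1 (f (k + 1)) = (-((k + 1) * (k + 2) : ℂ)) • f k := by
    intro k
    induction k with
    | zero =>
      rw [fs, comm_EF]
      change D2 (D1 u) + HH u = _
      rw [h0, ((mem_V).1 hu).2, zero_add]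
      change _ = _ • u
      congr 1; push_cast; ring
    | succ k ih =>
      rw [fs, comm_EF, ih, Dsmul, ← fs, (mem_V.1 (fm (k + 1))).2, ← add_smul]
      congr 1; push_cast; ring
  have step : ∀ k : ℕ, f (k + 1) = 0 → f k = 0 := by
    intro k hk
    have h := fE k
    rw [hk, map_zero] at h
    have h2 := smul_eq_zero.1 h.symm
    rcases h2 with h2 | h2
    · exfalso
      rw [neg_eq_zero] at h2
      have : ((k + 1) * (k + 2) : ℂ) = (((k + 1) * (k + 2) : ℕ) : ℂ) := by push_cast; ring
      rw [this, Nat.cast_eq_zero] at h2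
      simp at h2
    · exact h2
  have big : f (4 * d) = 0 := by
    apply V_bot _ (fm (4 * d))
    push_cast; omega
  have all : ∀ n, f n = 0 → f 0 = 0 := by
    intro n
    induction n with
    | zero => exact id
    | succ n ih => intro h; exact ih (step n h)
  exact all _ big

/-- invariants of degree d -/
noncomputable def Inv (d : ℕ) : Submodule ℂ R8 where
  carrier := {u | (D1 u = 0 ∧ D2 u = 0) ∧ u.IsHomogeneous d}
  add_mem' := by
    rintro a b ⟨⟨h1, h2⟩, h3⟩ ⟨⟨k1, k2⟩, k3⟩
    exact ⟨⟨by rw [map_add, h1, k1, add_zero], by rw [map_add, h2, k2, add_zero]⟩, h3.add k3⟩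
  zero_mem' := ⟨⟨map_zero _, map_zero _⟩, isHomogeneous_zero _ _ _⟩
  smul_mem' := by
    rintro c a ⟨⟨h1, h2⟩, h3⟩
    refine ⟨⟨by rw [Dsmul, h1, smul_zero], by rw [Dsmul, h2, smul_zero]⟩, ?_⟩
    rw [MvPolynomial.smul_eq_C_mul]
    simpa using (isHomogeneous_C (Fin 8) c).mul h3

theorem Inv_le (d : ℕ) : Inv d ≤ V d 0 := by
  rintro u ⟨⟨h1, h2⟩, h3⟩
  rw [mem_V]
  constructor
  · ext m
    rw [NN, coeff_Dg, coeff_smul, smul_eq_mul]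
    by_cases hm : coeff m u = 0
    · simp [hm]
    · have := h3 hm
      congr 1
      rw [Finsupp.weight_apply, Finsupp.sum_fintype _ _ (by simp)] at this
      simp only [mul_one]
      rw [← this]; simp
  · have := comm_EF u
    rw [h1, h2] at this
    simpa using this.symm

instance (d : ℕ) (w : ℤ) : Module.Finite ℂ (V d w) :=
  Module.Finite.of_basis (basisRestrictSupport ℂ (mons d w : Set (Fin 8 →₀ ℕ)))

theorem finrank_V (d : ℕ) (w : ℤ) : Module.finrank ℂ (V d w) = (mons d w).card := by
  have := Module.finrank_eq_card_basis (basisRestrictSupport ℂ (mons d w : Set (Fin 8 →₀ ℕ)))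
  rw [V, this]; simp

theorem finrank_Inv (d : ℕ) :
    Module.finrank ℂ (Inv d) + (mons d (-2)).card ≤ (mons d 0).card := by
  let W := (V d (-2)).map (D1 : R8 →ₗ[ℂ] R8)
  have hW : W ≤ V d 0 := by
    rintro _ ⟨u, hu, rfl⟩
    have h := E_mem hu
    rw [show (-2 : ℤ) + 2 = 0 by norm_num] at h
    exact h
  have inj : Function.Injective ((D1 : R8 →ₗ[ℂ] R8).domRestrict (V d (-2))) := by
    rw [← LinearMap.ker_eq_bot, LinearMap.ker_eq_bot']
    rintro ⟨u, hu⟩ h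
    have h' : D1 u = 0 := h
    exact Subtype.ext (key_zero hu (by rw [h', map_zero]))
  have fW : Module.finrank ℂ W = (mons d (-2)).card := by
    have := LinearMap.finrank_range_of_inj inj
    rw [finrank_V] at this
    rw [← this, LinearMap.range_domRestrict]
  have dis : Disjoint (Inv d) W := by
    rw [Submodule.disjoint_def]
    rintro _ ⟨⟨h1, h2⟩, h3⟩ ⟨u, hu, rfl⟩
    have : u = 0 := key_zero hu h2
    rw [this]; exact map_zero _
  have h := Submodule.finrank_add_finrank_le_of_disjoint (K := ℂ) (V := V d 0) (s := (Inv d).comap (V d 0).subtype) (t := W.comap (V d 0).subtype) (by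
    rw [Submodule.disjoint_def] at dis ⊢
    intro x h1 h2
    exact Subtype.ext (dis x h1 h2))
  rw [finrank_V] at h
  rwa [(Submodule.comapSubtypeEquivOfLe (Inv_le d)).finrank_eq, (Submodule.comapSubtypeEquivOfLe hW).finrank_eq, fW] at h

end Sept


namespace Sept

/-- degrees of the thirty generators -/
def degL : List ℕ := [4, 8, 8, 8, 12, 12, 12, 12, 12, 12, 14, 14, 14, 14, 16, 16, 18, 18, 18, 18, 18, 18, 18, 18, 18, 20, 22, 22, 26, 30]
/-- secondary generators, as products of generators -/
def secL : List (List ℕ) := [[], [2], [3], [4], [6], [7], [9], [10], [11], [12], [13], [14], [15], [2, 2], [2, 3], [3, 3], [16], [17], [18], [19], [20], [21], [22], [23], [24], [2, 4], [2, 6], [2, 7], [2, 9], [3, 4], [3, 6], [26], [27], [2, 10], [2, 11], [2, 12], [2, 13], [3, 10], [3, 12], [3, 13], [2, 14], [2, 15], [2, 2, 2], [2, 2, 3], [2, 3, 3], [3, 14], [3, 15], [3, 3, 3], [28], [2, 16], [2, 17], [2, 18], [2, 19], [2, 20], [2, 21], [2, 22], [2, 23], [2, 2, 4], [2, 2, 6],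 [2, 2, 7], [2, 2, 9], [2, 3, 4], [2, 3, 6], [29], [2, 26], [2, 27], [2, 2, 10], [2, 2, 11], [2, 2, 12], [2, 2, 13], [2, 3, 10], [2, 3, 12], [2, 2, 14], [2, 2, 15], [2, 2, 2, 2], [2, 2, 2, 3], [2, 2, 3, 3], [2, 28], [2, 2, 16], [2, 2, 17], [2, 2, 18], [2, 2, 2, 4], [2, 2, 2, 6], [2, 2, 2, 7], [2, 2, 2, 9], [2, 2, 2, 14], [2, 2, 2, 15], [2, 2, 2, 2, 14]]
def Dlist : List ℤ := [1, 0, 0, 0, -1, 0, -1, 0, -1, 0, 0, 0, 0, 0, 2, 0, 2, 0, 1, 0, 0, 0, -1, 0, -2, 0, -2, 0, 0, 0, 0, 0, 1, 0, 1, 0, 1, 0, 0, 0, -1]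
def Ulist : List (List ℤ) := [[0, 0, 0, 0, -1, 0, 0, 0, 0, 0, 1, 0, -2, 0, 1, 0, -5, 0, -2, 0, -6, 0, -2, 0, -5, 0, 1, 0, -2, 0, 1, 0, 0, 0, 0, 0, -1], [0, 0, 0, 1, 0, 0, 0, 0, 0, -1, 0, 2, 0, -1, 0, 5, 0, 2, 0, 6, 0, 2, 0, 5, 0, -1, 0, 2, 0, -1, 0, 0, 0, 0, 0, 1], [0, 0, 0, 0, 1, 0, 0, 0, 0, 0, -1, 0, 2, 0, -1, 0, 5, 0, 2, 0, 6, 0, 2, 0, 5, 0, -1, 0, 2, 0, -1, 0, 0, 0, 0, 0, 1], [0, 0, 0, 0, 0, 0, 0, 0, 0, 1, 0, 3, 0, 3, 0, 4, 0, 6, 0, 5, 0, 5, 0, 6, 0, 4, 0, 3, 0, 3, 0, 1], [0, 0, -1, 0, 0, 0, 1, 0, 0, 0, -2, 0, 0, 0, -2, 0, -3, 0, 0, 0, 1, 0, 0, 0, 2, 0, 2, 0, 0, 0, 2], [0, 0, 0, 0, 0, -1, 0, 1, 0, -1, 0, 1, 0, 0, 0, 4, 0, -1, 0, 4, 0, 1,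 0, 5, 0, 2, 0, 5, 0, 0, 0, 2], [0, 0, 0, 0, 0, 0, -1, 0, 0, 0, -4, 0, -3, 0, -5, 0, -2, 0, -5, 0, 1, 0, -4, 0, 1, 0, -2, 0, 1, 0, -1, 0, 2], [0, 0, 0, 0, 0, -1, 0, -1, 0, 1, 0, 0, 0, -2, 0, 0, 0, -2, 0, -3, 0, 1, 0, 1, 0, 1, 0, 3, 0, 2], [0, 0, -1, 0, 1, 0, -1, 0, -1, 0, -6, 0, -4, 0, -12, 0, -7, 0, -10, 0, -8, 0, -9, 0, -2, 0, -5, 0, -1], [0, 1, 0, -1, 0, 0, 0, -1, 0, 1, 0, -2, 0, 1, 0, -5, 0, -2, 0, -6, 0, -2, 0, -5, 0, 1, 0, -2], [0, 0, 1, 0, 0, 0, 0, 0, -2, 0, -3, 0, -3, 0, -4, 0, -6, 0, -4, 0, -5, 0, -7, 0, -5, 0, -4, 0, -2, 0, -1, 0, 1], [0, 0, 0, 0, 0, 0, 0, 2, 0, 3, 0, 1, 0, 1, 0, 1, 0, -3, 0, -2, 0, 0, 0, -2, 0, 0, 0, 1, 0, -1, 0, -1], [0, 0, 0, 0, 2,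 0, -1, 0, 1, 0, -2, 0, 1, 0, -4, 0, 1, 0, -5, 0, -2, 0, -5, 0, -3, 0, -4, 0, 0, 0, -1], [0, 0, 0, 0, 0, 2, 0, 0, 0, 5, 0, 2, 0, 5, 0, 1, 0, 4, 0, -1, 0, 4, 0, 0, 0, 1, 0, -1, 0, 1, 0, -1], [0, 0, 1, 0, 0, 0, 2, 0, -1, 0, 4, 0, 1, 0, 5, 0, 3, 0, 6, 0, -1, 0, 3, 0, -1, 0, 0, 0, -1, 0, 1], [0, 0, 0, 0, 0, 1, 0, 3, 0, 3, 0, 4, 0, 6, 0, 5, 0, 5, 0, 6, 0, 4, 0, 3, 0, 3, 0, 1]]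
def Vlist : List (List ℤ) := [[1, 0, 0, 0, 0, 0, -1, 0, 2, 0, -1, 0, 5, 0, 2, 0, 6, 0, 2, 0, 5, 0, -1, 0, 2, 0, -1, 0, 0, 0, 0, 0, 1], [0, -1, 0, 0, 0, 0, 0, 1, 0, -2, 0, 1, 0, -5, 0, -2, 0, -6, 0, -2, 0, -5, 0, 1, 0, -2, 0, 1, 0, 0, 0, 0, 0, -1], [-1, 0, 0, 0, 0, 0, 1, 0, -2, 0, 1, 0, -5, 0, -2, 0, -6, 0, -2, 0, -5, 0, 1, 0, -2, 0, 1, 0, 0, 0, 0, 0, -1], [0, 0, 0, 0, 0, -1, 0, -3, 0, -3, 0, -4, 0, -6, 0, -5, 0, -5, 0, -6, 0, -4, 0, -3, 0, -3, 0, -1], [0, 0, 0, 0, 0, 0, -2, 0, 0, 0, -2, 0, -2, 0, 0, 0, -1, 0, 0, 0, 3, 0, 2, 0, 0, 0, 2, 0, 0, 0, -1, 0, 0, 0, 1], [0, 0, 0, 0, 0, -2, 0, 0, 0, -5, 0, -2, 0, -5, 0, -1, 0, -4, 0, 1, 0, -4, 0, 0, 0, -1, 0, 1, 0, -1, 0,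 1], [0, 0, 0, 0, -2, 0, 1, 0, -1, 0, 2, 0, -1, 0, 4, 0, -1, 0, 5, 0, 2, 0, 5, 0, 3, 0, 4, 0, 0, 0, 1], [0, 0, 0, 0, 0, 0, 0, -2, 0, -3, 0, -1, 0, -1, 0, -1, 0, 3, 0, 2, 0, 0, 0, 2, 0, 0, 0, -1, 0, 1, 0, 1], [0, 0, 0, 0, 0, 0, 0, 0, 1, 0, 5, 0, 2, 0, 9, 0, 8, 0, 10, 0, 7, 0, 12, 0, 4, 0, 6, 0, 1, 0, 1, 0, -1, 0, 1], [0, 0, 0, 0, 0, 0, 0, 0, 0, 2, 0, -1, 0, 5, 0, 2, 0, 6, 0, 2, 0, 5, 0, -1, 0, 2, 0, -1, 0, 1, 0, 0, 0, 1, 0, -1], [0, 0, 0, 0, -1, 0, 1, 0, 2, 0, 4, 0, 5, 0, 7, 0, 5, 0, 4, 0, 6, 0, 4, 0, 3, 0, 3, 0, 2, 0, 0, 0, 0, 0, -1], [0, 0, 0, 0, 0, 1, 0, 1, 0, -1, 0, 0, 0, 2, 0, 0, 0, 2, 0, 3, 0, -1, 0, -1, 0, -1, 0, -3, 0, -2],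 [0, 0, 0, 0, 0, 0, 1, 0, 0, 0, 4, 0, 3, 0, 5, 0, 2, 0, 5, 0, -1, 0, 4, 0, -1, 0, 2, 0, -1, 0, 1, 0, -2], [0, 0, 0, 0, 0, 1, 0, -1, 0, 1, 0, -1, 0, 0, 0, -4, 0, 1, 0, -4, 0, -1, 0, -5, 0, -2, 0, -5, 0, 0, 0, -2], [0, 0, 0, 0, 0, 0, -1, 0, 1, 0, 0, 0, 1, 0, -3, 0, 1, 0, -6, 0, -3, 0, -5, 0, -1, 0, -4, 0, 1, 0, -2, 0, 0, 0, -1], [0, 0, 0, 0, 0, 0, 0, 0, 0, -1, 0, -3, 0, -3, 0, -4, 0, -6, 0, -5, 0, -5, 0, -6, 0, -4, 0, -3, 0, -3, 0, -1]]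

def edeg (j : ℕ) : ℕ := ((secL.getD j []).map (fun i => degL.getD i 0)).sum
def del : Fin 5 → ℕ := ![4, 8, 12, 12, 20]

section lists
variable {α S : Type*} [CommRing S]

def gadd (add : α → α → α) : List α → List α → List α
  | [], l => l
  | l, [] => l
  | a :: l, b :: m => add a b :: gadd add l m

def gmul (add mul : α → α → α) (zero : α) : List α → List α → List α
  | [], _ => []
  | a :: l, m => gadd add (m.map (mul a)) (zero :: gmul add mul zero l m)

def gev (e : α → S) (x : S) : List α → S
  | [] => 0
  | a :: l => e a + x * gev e x l

theorem gev_add {add : α → α → α} {e : α → S} (h : ∀ a b, e (add a b) = e a + e b) (x : S) :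
    ∀ l m, gev e x (gadd add l m) = gev e x l + gev e x m
  | [], l => by simp [gadd, gev]
  | a :: l, [] => by simp [gadd, gev]
  | a :: l, b :: m => by
    simp only [gadd, gev, h, gev_add h x l m]; ring

theorem gev_map {mul : α → α → α} {e : α → S} (h : ∀ a b, e (mul a b) = e a * e b) (x : S) (a : α) :
    ∀ l, gev e x (l.map (mul a)) = e a * gev e x l
  | [] => by simp [gev]
  | b :: l => by simp only [List.map, gev, h, gev_map h x a l]; ring

theorem gev_mul {add mul : α → α → α} {zero : α} {e : α → S} (ha : ∀ a b, e (add a b) = e a + e b)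
    (h : ∀ a b, e (mul a b) = e a * e b) (h0 : e zero = 0) (x : S) :
    ∀ l m, gev e x (gmul add mul zero l m) = gev e x l * gev e x m
  | [], l => by simp [gmul, gev]
  | a :: l, m => by
    simp only [gmul, gev, gev_add ha, gev_map h, gev_mul ha h h0 x l m, h0]; ring

theorem gev_zero {e : α → S} (x : S) : ∀ l : List α, (∀ a ∈ l, e a = 0) → gev e x l = 0
  | [], _ => rfl
  | a :: l, h => by
    rw [gev, h a (by simp), gev_zero x l (fun b hb => h b (by simp [hb]))]; simp

theorem gev_append {e : α → S} (x : S) (a : α) : ∀ l : List α,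
    gev e x (l ++ [a]) = gev e x l + x ^ l.length * e a
  | [] => by simp [gev]
  | b :: l => by simp only [List.cons_append, gev, gev_append x a l, List.length_cons]; ring

theorem gev_reverse {e : α → S} (y z : S) (h : y * z = 1) : ∀ l : List α,
    gev e z l * y ^ l.length = y * gev e y l.reverse
  | [] => by simp [gev]
  | a :: l => by
    rw [List.reverse_cons, gev_append, mul_add, ← gev_reverse y z h l, gev, List.length_reverse,
      List.length_cons]
    linear_combination (gev e z l * y ^ l.length) * h

theorem gev_map_hom {S' : Type*} [CommRing S'] (f : S →+* S') (e : α → S) (x : S) : ∀ l : List α,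
    f (gev e x l) = gev (fun a => f (e a)) (f x) l
  | [] => by simp [gev]
  | a :: l => by simp only [gev, map_add, map_mul, gev_map_hom f e x l]

def add1 : List ℤ → List ℤ → List ℤ := gadd (· + ·)
def mul1 : List ℤ → List ℤ → List ℤ := gmul (· + ·) (· * ·) 0
def add2 : List (List ℤ) → List (List ℤ) → List (List ℤ) := gadd add1
def mul2 : List (List ℤ) → List (List ℤ) → List (List ℤ) := gmul add1 mul1 []

def ev1 (t : S) : List ℤ → S := gev (fun n : ℤ => (n : S)) t
def ev2 (t z : S) : List (List ℤ) → S := gev (ev1 t) z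

theorem ev1_add (t : S) (l m) : ev1 t (add1 l m) = ev1 t l + ev1 t m :=
  gev_add (by intros; push_cast; rfl) t l m
theorem ev1_mul (t : S) (l m) : ev1 t (mul1 l m) = ev1 t l * ev1 t m :=
  gev_mul (by intros; push_cast; rfl) (by intros; push_cast; rfl) (by simp) t l m
theorem ev2_add (t z : S) (l m) : ev2 t z (add2 l m) = ev2 t z l + ev2 t z m :=
  gev_add (ev1_add t) z l m
theorem ev2_mul (t z : S) (l m) : ev2 t z (mul2 l m) = ev2 t z l * ev2 t z m :=
  gev_mul (ev1_add t) (ev1_mul t) rfl z l m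

def isZ1 (l : List ℤ) : Bool := l.all (fun a => a == 0)
def isZ2 (l : List (List ℤ)) : Bool := l.all isZ1

theorem ev1_isZ (t : S) (l) (h : isZ1 l = true) : ev1 t l = 0 := by
  apply gev_zero
  intro a ha
  have := List.all_eq_true.1 h a ha
  simp only [beq_iff_eq] at this
  simp [this]
theorem ev2_isZ (t z : S) (l) (h : isZ2 l = true) : ev2 t z l = 0 := by
  apply gev_zero
  intro a ha
  exact ev1_isZ t a (List.all_eq_true.1 h a ha)

def Al : List (List ℤ) :=
  mul2 (mul2 [[1], [0, -1]] [[1], [], [], [0, -1]])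
   (mul2 [[1], [], [], [], [], [0, -1]] [[1], [], [], [], [], [], [], [0, -1]])
def Bl : List (List ℤ) :=
  mul2 (mul2 [[0, -1], [1]] [[0, -1], [], [], [1]])
   (mul2 [[0, -1], [], [], [], [], [1]] [[0, -1], [], [], [], [], [], [], [1]])
def Tl : List (List ℤ) := mul2 [Dlist] [[],[],[],[],[],[],[],[],[],[],[],[],[],[],[],[],[-1],[],[1]]

theorem cert0 : isZ2 (add2 (add2 (mul2 Ulist Al) (mul2 Vlist Bl)) Tl) = true := by decide +kernel

theorem cert (t z : S) : ev1 t Dlist * (z ^ 16 * (1 - z ^ 2)) =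
    ev2 t z Ulist * ((1 - t * z) * (1 - t * z ^ 3) * ((1 - t * z ^ 5) * (1 - t * z ^ 7)))
    + ev2 t z Vlist * ((z - t) * (z ^ 3 - t) * ((z ^ 5 - t) * (z ^ 7 - t))) := by
  have h := ev2_isZ t z _ cert0
  rw [ev2_add, ev2_add, ev2_mul, ev2_mul, Tl, ev2_mul, Al, Bl, ev2_mul, ev2_mul, ev2_mul, ev2_mul,
    ev2_mul, ev2_mul] at h
  have e : ev2 t z [Dlist] = ev1 t Dlist := by simp [ev2, gev]
  rw [e] at h
  have a1 : ev2 t z [[1], [0, -1]] = 1 - t * z := by simp [ev2, ev1, gev]; ring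
  have a3 : ev2 t z [[1], [], [], [0, -1]] = 1 - t * z ^ 3 := by simp [ev2, ev1, gev]; ring
  have a5 : ev2 t z [[1], [], [], [], [], [0, -1]] = 1 - t * z ^ 5 := by simp [ev2, ev1, gev]; ring
  have a7 : ev2 t z [[1], [], [], [], [], [], [], [0, -1]] = 1 - t * z ^ 7 := by
    simp [ev2, ev1, gev]; ring
  have b1 : ev2 t z [[0, -1], [1]] = z - t := by simp [ev2, ev1, gev]; ring
  have b3 : ev2 t z [[0, -1], [], [], [1]] = z ^ 3 - t := by simp [ev2, ev1, gev]; ring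
  have b5 : ev2 t z [[0, -1], [], [], [], [], [1]] = z ^ 5 - t := by simp [ev2, ev1, gev]; ring
  have b7 : ev2 t z [[0, -1], [], [], [], [], [], [], [1]] = z ^ 7 - t := by
    simp [ev2, ev1, gev]; ring
  have c : ev2 t z [[],[],[],[],[],[],[],[],[],[],[],[],[],[],[],[],[-1],[],[1]]
    = - (z ^ 16 * (1 - z ^ 2)) := by simp [ev2, ev1, gev]; ring
  rw [a1, a3, a5, a7, b1, b3, b5, b7, c] at h
  linear_combination -h

def mon1 (e : ℕ) : List ℤ := List.replicate e 0 ++ [1]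
theorem ev1_mon (t : S) (e : ℕ) : ev1 t (mon1 e) = t ^ e := by
  rw [ev1, mon1, gev_append, gev_zero]
  · simp
  · intro a ha; simp [List.eq_of_mem_replicate ha]

def Nlist : List ℕ → List ℤ
  | [] => []
  | j :: l => add1 (mon1 j) (Nlist l)

theorem ev1_N (t : S) : ∀ l : List ℕ, ev1 t (Nlist l) = (l.map (fun e => t ^ e)).sum
  | [] => rfl
  | j :: l => by rw [Nlist, ev1_add, ev1_mon, ev1_N t l]; simp

def omx (e : ℕ) : List ℤ := add1 [1] (mul1 [-1] (mon1 e))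
theorem ev1_omx (t : S) (e : ℕ) : ev1 t (omx e) = 1 - t ^ e := by
  rw [omx, ev1_add, ev1_mul, ev1_mon]; simp [ev1, gev]; ring

theorem cert20 : isZ1 (add1 (mul1 Dlist (Nlist ((List.range 88).map edeg)))
   (mul1 [-1] (mul1 (Vlist.getD 0 []) (mul1 (omx 4) (mul1 (omx 8) (mul1 (omx 12) (mul1 (omx 12) (omx 20)))))))) = true := by
  decide +kernel

theorem cert2 (t : S) : ev1 t Dlist * ∑ j ∈ range 88, t ^ edeg j =
    ev1 t (Vlist.getD 0 []) * ∏ i, (1 - t ^ del i) := by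
  have h := ev1_isZ t _ cert20
  rw [ev1_add, ev1_mul, ev1_mul, ev1_N, ev1_mul, ev1_mul, ev1_mul, ev1_mul, ev1_mul, ev1_omx, ev1_omx,
    ev1_omx, ev1_omx] at h
  have e : (((List.range 88).map edeg).map (fun e => t ^ e)).sum = ∑ j ∈ range 88, t ^ edeg j := by
    rw [List.map_map]; rfl
  rw [e] at h
  have e1 : ev1 t [-1] = -1 := by simp [ev1, gev]
  rw [e1] at h
  have : ∏ i, (1 - t ^ del i) = (1 - t ^ 4) * ((1 - t ^ 8) * ((1 - t ^ 12) * ((1 - t ^ 12) * (1 - t ^ 20)))) := by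
    simp [Fin.prod_univ_succ, del]
  rw [this]
  linear_combination h
end lists

end Sept


namespace Sept

abbrev LP := LaurentPolynomial ℤ

section geo
variable {S : Type*} [CommRing S]
noncomputable def geo (c : S) : PowerSeries S := PowerSeries.mk (fun k => c ^ k)

theorem geo_mul (c : S) : (1 - PowerSeries.X * PowerSeries.C c) * geo c = 1 := by
  ext n
  rw [sub_mul, one_mul, map_sub, mul_assoc]
  cases n with
  | zero => simp [geo]
  | succ n =>
    rw [PowerSeries.coeff_succ_X_mul, PowerSeries.coeff_C_mul, PowerSeries.coeff_one]
    simp [geo, pow_succ']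

theorem map_geo {S' : Type*} [CommRing S'] (f : S →+* S') (c : S) :
    PowerSeries.map f (geo c) = geo (f c) := by
  ext n; simp [geo]

noncomputable def geoD (δ : ℕ) : PowerSeries S := PowerSeries.mk (fun k => if δ ∣ k then 1 else 0)

theorem geoD_mul {δ : ℕ} (h : 0 < δ) : (1 - PowerSeries.X ^ δ) * (geoD δ : PowerSeries S) = 1 := by
  ext n
  rw [sub_mul, one_mul, map_sub, PowerSeries.coeff_X_pow_mul', PowerSeries.coeff_one]
  simp only [geoD, PowerSeries.coeff_mk]
  by_cases hn : n = 0
  · subst hn; simp [h.ne']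
  · by_cases h2 : δ ≤ n
    · have : δ ∣ n - δ ↔ δ ∣ n := by
        constructor
        · intro h3
          have := Nat.dvd_add h3 (dvd_refl δ)
          rwa [Nat.sub_add_cancel h2] at this
        · intro h3; exact Nat.dvd_sub h3 (dvd_refl δ)
      simp only [h2, hn, this, if_true, if_false, sub_self]
    · have : ¬ δ ∣ n := fun h3 => h2 (Nat.le_of_dvd (Nat.pos_of_ne_zero hn) h3)
      simp [h2, hn, this]
end geo

/-- index set for the free basis in degree `d` -/
noncomputable def Tl1 (j d : ℕ) : Finset (Fin 5 →₀ ℕ) :=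
  if edeg j ≤ d then ((Finset.univ : Finset (Fin 5)).finsuppAntidiag (d - edeg j)).filter
    (fun l => ∀ i, del i ∣ l i) else ∅

noncomputable def Td (d : ℕ) : Finset (Σ _ : ℕ, (Fin 5 →₀ ℕ)) :=
  (range 88).sigma (fun j => Tl1 j d)

theorem del_pos (i : Fin 5) : 0 < del i := by
  revert i; decide

theorem coeff_geoD (d : ℕ) : PowerSeries.coeff d (∏ i, geoD (del i) : PowerSeries ℤ) =
    ((((Finset.univ : Finset (Fin 5)).finsuppAntidiag d).filter (fun l => ∀ i, del i ∣ l i)).card : ℤ) := by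
  rw [PowerSeries.coeff_prod, Finset.card_filter]
  push_cast
  apply Finset.sum_congr rfl
  intro l _
  simp only [geoD, PowerSeries.coeff_mk]
  rw [Finset.prod_ite_zero]
  simp

theorem coeff_Td (d : ℕ) : PowerSeries.coeff d
    ((∑ j ∈ range 88, PowerSeries.X ^ edeg j) * ∏ i, geoD (del i) : PowerSeries ℤ) = ((Td d).card : ℤ) := by
  rw [Td, Finset.card_sigma, Finset.sum_mul, map_sum]
  push_cast
  apply Finset.sum_congr rfl
  intro j _
  rw [PowerSeries.coeff_X_pow_mul', Tl1, coeff_geoD]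
  split_ifs <;> simp

noncomputable def GG : PowerSeries LP := ∏ i : Fin 8, geo (LaurentPolynomial.T (7 - 2 * (i.val : ℤ)))

theorem coeff_GG (d : ℕ) : PowerSeries.coeff d GG =
    ∑ m ∈ (Finset.univ : Finset (Fin 8)).finsuppAntidiag d, LaurentPolynomial.T (wt m) := by
  rw [GG, PowerSeries.coeff_prod]
  apply Finset.sum_congr rfl
  intro m _
  have : ∀ s : Finset (Fin 8), ∏ i ∈ s, PowerSeries.coeff (m i) (geo (LaurentPolynomial.T (7 - 2 * (i.val : ℤ)) : LP)) =
     LaurentPolynomial.T (∑ i ∈ s, (m i : ℤ) * (7 - 2 * (i.val : ℤ))) := by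
    intro s
    induction s using Finset.induction_on with
    | empty => simp
    | insert a s ha ih =>
      rw [Finset.prod_insert ha, Finset.sum_insert ha, ih, LaurentPolynomial.T_add]
      rw [geo, PowerSeries.coeff_mk, LaurentPolynomial.T_pow]
  exact this _

noncomputable def cz (w : ℤ) : LP →+ ℤ where
  toFun p := p.coeff w
  map_zero' := rfl
  map_add' _ _ := rfl

theorem cz_T (w k : ℤ) : cz w (LaurentPolynomial.T k) = if k = w then 1 else 0 := by
  change (LaurentPolynomial.T k : LP).coeff w = _
  rw [LaurentPolynomial.T, AddMonoidAlgebra.coeff_single, Finsupp.single_apply]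

theorem cz_GG (w : ℤ) (d : ℕ) : cz w (PowerSeries.coeff d GG) = ((mons d w).card : ℤ) := by
  rw [coeff_GG, map_sum, mons, Finset.card_filter]
  push_cast
  simp only [cz_T]

theorem cz_T_mul (w k : ℤ) (p : LP) : cz w (LaurentPolynomial.T k * p) = cz (w - k) p := by
  change (LaurentPolynomial.T k * p : LP).coeff w = p.coeff (w - k)
  rw [LaurentPolynomial.T, AddMonoidAlgebra.coeff_single_mul_apply]
  rw [one_mul]; congr 1; ring

noncomputable def ι1 : Polynomial ℤ →+* LP := Polynomial.toLaurent
noncomputable def ι2 : Polynomial ℤ →+* LP := (Polynomial.aeval (LaurentPolynomial.T (-1) : LP)).toRingHom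

theorem cz_C_mul (w : ℤ) (r : ℤ) (p : LP) : cz w ((r : LP) * p) = r * cz w p := by
  rw [← zsmul_eq_mul, map_zsmul, zsmul_eq_mul]; simp

theorem cz_ι1 (p : Polynomial ℤ) : cz 0 (ι1 p) = p.eval 0 := by
  induction p using Polynomial.induction_on' with
  | add p q hp hq => rw [map_add, map_add, hp, hq, Polynomial.eval_add]
  | monomial n a =>
    rw [← Polynomial.C_mul_X_pow_eq_monomial, map_mul, map_pow]
    have h1 : ι1 (Polynomial.C a) = (a : LP) := by simp
    have h2 : ι1 Polynomial.X = LaurentPolynomial.T 1 := by simp [ι1]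
    rw [h1, h2, LaurentPolynomial.T_pow, cz_C_mul, cz_T]
    cases n <;> simp; omega

theorem cz_ι2 (p : Polynomial ℤ) : cz 0 (ι2 (Polynomial.X * p)) = 0 := by
  induction p using Polynomial.induction_on' with
  | add p q hp hq => rw [mul_add, map_add, map_add, hp, hq, add_zero]
  | monomial n a =>
    rw [← Polynomial.C_mul_X_pow_eq_monomial, map_mul ι2, map_mul ι2, map_pow ι2]
    have h1 : ι2 (Polynomial.C a) = (a : LP) := by simp
    have h2 : ι2 Polynomial.X = LaurentPolynomial.T (-1) := by simp [ι2]
    rw [h1, h2, LaurentPolynomial.T_pow, mul_left_comm, ← LaurentPolynomial.T_add, cz_C_mul, cz_T]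
    rw [if_neg]
    · simp
    · omega

/-- coefficientwise constant term -/
noncomputable def c0 (F : PowerSeries LP) : PowerSeries ℤ := PowerSeries.mk (fun n => cz 0 (PowerSeries.coeff n F))

theorem c0_add (F G : PowerSeries LP) : c0 (F + G) = c0 F + c0 G := by ext n; simp [c0]
theorem c0_mul (P : PowerSeries ℤ) (F : PowerSeries LP) :
    c0 (PowerSeries.map (Int.castRingHom LP) P * F) = P * c0 F := by
  ext n
  simp only [c0, PowerSeries.coeff_mk, PowerSeries.coeff_mul, map_sum, PowerSeries.coeff_map,
    eq_intCast, cz_C_mul]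
theorem c0_ι1 (P : PowerSeries (Polynomial ℤ)) :
    c0 (PowerSeries.map ι1 P) = PowerSeries.map (Polynomial.evalRingHom 0) P := by
  ext n; simp [c0, cz_ι1]
theorem c0_ι2 (P : PowerSeries (Polynomial ℤ)) :
    c0 (PowerSeries.map ι2 (PowerSeries.C Polynomial.X * P)) = 0 := by
  ext n
  simp only [c0, PowerSeries.coeff_mk, PowerSeries.coeff_map, PowerSeries.coeff_C_mul, cz_ι2, map_zero]

theorem c0_GG : c0 ((1 - PowerSeries.C (LaurentPolynomial.T 2)) * GG) =
    PowerSeries.mk (fun d => ((mons d 0).card : ℤ) - (mons d (-2)).card) := by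
  ext d
  rw [c0, PowerSeries.coeff_mk, PowerSeries.coeff_mk, sub_mul, one_mul, map_sub, map_sub, cz_GG,
    PowerSeries.coeff_C_mul, cz_T_mul, cz_GG]
  norm_num

noncomputable def GA : PowerSeries (Polynomial ℤ) := geo (Polynomial.X ^ 7) * geo (Polynomial.X ^ 5) *
  geo (Polynomial.X ^ 3) * geo (Polynomial.X)

theorem GG_eq : GG = PowerSeries.map ι1 GA * PowerSeries.map ι2 GA := by
  have h1 : ι1 Polynomial.X = LaurentPolynomial.T 1 := by simp [ι1]
  have h2 : ι2 Polynomial.X = LaurentPolynomial.T (-1) := by simp [ι2]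
  simp only [GA, map_mul, map_geo, map_pow, h1, h2, LaurentPolynomial.T_pow]
  rw [GG]
  simp only [Fin.prod_univ_succ, Fin.val_zero, Fin.val_succ]
  norm_num
  ring

theorem map_ev1 {S S' : Type*} [CommRing S] [CommRing S'] (f : S →+* S') (t : S) (l) : f (ev1 t l) = ev1 (f t) l := by
  rw [ev1, gev_map_hom]; simp [ev1]
theorem map_ev2 {S S' : Type*} [CommRing S] [CommRing S'] (f : S →+* S') (t z : S) (l) :
    f (ev2 t z l) = ev2 (f t) (f z) l := by
  rw [ev2, gev_map_hom]; simp only [map_ev1]; rfl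

theorem hil0 : ev1 PowerSeries.X Dlist * PowerSeries.mk (fun d => ((mons d 0).card : ℤ) - (mons d (-2)).card)
    = ev1 PowerSeries.X (Vlist.getD 0 []) := by
  let t : PowerSeries LP := PowerSeries.X
  let z : PowerSeries LP := PowerSeries.C (LaurentPolynomial.T 1)
  let y : PowerSeries LP := PowerSeries.C (LaurentPolynomial.T (-1))
  have hyz : y * z = 1 := by
    simp only [y, z, ← map_mul, ← LaurentPolynomial.T_add]; simp
  let A := ((1 - t * z) * (1 - t * z ^ 3) * ((1 - t * z ^ 5) * (1 - t * z ^ 7)))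
  let B := ((1 - t * y) * (1 - t * y ^ 3) * ((1 - t * y ^ 5) * (1 - t * y ^ 7)))
  have m1 : PowerSeries.map ι1 (PowerSeries.C Polynomial.X) = z := by simp [z, ι1]
  have m2 : PowerSeries.map ι2 (PowerSeries.C Polynomial.X) = y := by simp [y, ι2]
  have hg : ∀ (f : Polynomial ℤ →+* LP) (x : PowerSeries LP), PowerSeries.map f (PowerSeries.C Polynomial.X) = x →
      ((1 - t * x) * (1 - t * x ^ 3) * ((1 - t * x ^ 5) * (1 - t * x ^ 7))) * PowerSeries.map f GA = 1 := by
    intro f x hx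
    have h0 : ∀ n, PowerSeries.map f (1 - PowerSeries.X * PowerSeries.C (Polynomial.X ^ n)) = 1 - t * x ^ n := by
      intro n; rw [map_sub, map_mul, map_pow, map_pow, hx]; simp [t]
    have h1 := h0 1
    rw [pow_one, pow_one] at h1
    rw [← h1, ← h0 3, ← h0 5, ← h0 7, ← map_mul, ← map_mul, ← map_mul, ← map_mul, ← map_one (PowerSeries.map f)]
    congr 1
    rw [GA]
    have g1 := geo_mul (Polynomial.X : Polynomial ℤ)
    have g3 := geo_mul (Polynomial.X ^ 3 : Polynomial ℤ)
    have g5 := geo_mul (Polynomial.X ^ 5 : Polynomial ℤ)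
    have g7 := geo_mul (Polynomial.X ^ 7 : Polynomial ℤ)
    have gl : ∀ a b c d a' b' c' d' : PowerSeries (Polynomial ℤ), a * a' = 1 → b * b' = 1 → c * c' = 1 →
        d * d' = 1 → a * b * (c * d) * (d' * c' * b' * a') = 1 := by
      intro a b c d a' b' c' d' h1 h2 h3 h4
      calc _ = (a * a') * (b * b') * (c * c') * (d * d') := by ring
        _ = 1 := by rw [h1, h2, h3, h4]; norm_num
    exact gl _ _ _ _ _ _ _ _ g1 g3 g5 g7
  have hA : A * PowerSeries.map ι1 GA = 1 := hg ι1 z m1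
  have hB : B * PowerSeries.map ι2 GA = 1 := hg ι2 y m2
  have hc := cert t z
  have hU := gev_reverse (e := ev1 t) y z hyz Ulist
  have hlen : Ulist.length = 16 := rfl
  rw [hlen] at hU
  change ev2 t z Ulist * y ^ 16 = y * ev2 t y Ulist.reverse at hU
  have hz : ∀ n : ℕ, y ^ n * z ^ n = 1 := fun n => by rw [← mul_pow, hyz, one_pow]
  have hBB : y ^ 16 * ((z - t) * (z ^ 3 - t) * ((z ^ 5 - t) * (z ^ 7 - t))) = B := by
    have h1 : y * (z - t) = 1 - t * y := by linear_combination hyz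
    have h3 : y ^ 3 * (z ^ 3 - t) = 1 - t * y ^ 3 := by linear_combination hz 3
    have h5 : y ^ 5 * (z ^ 5 - t) = 1 - t * y ^ 5 := by linear_combination hz 5
    have h7 : y ^ 7 * (z ^ 7 - t) = 1 - t * y ^ 7 := by linear_combination hz 7
    simp only [B]
    rw [← h1, ← h3, ← h5, ← h7]; ring
  have hfin : ev1 t Dlist * (1 - z ^ 2) = y * ev2 t y Ulist.reverse * A + ev2 t z Vlist * B := by
    rw [← hU, ← hBB]
    calc _ = (y ^ 16 * z ^ 16) * (ev1 t Dlist * (1 - z ^ 2)) := by rw [hz, one_mul]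
      _ = y ^ 16 * (ev1 t Dlist * (z ^ 16 * (1 - z ^ 2))) := by ring
      _ = _ := by rw [hc]; ring
  have hprod : ev1 t Dlist * ((1 - z ^ 2) * GG) =
      PowerSeries.map ι2 (PowerSeries.C Polynomial.X * (ev2 PowerSeries.X (PowerSeries.C Polynomial.X) Ulist.reverse * GA))
      + PowerSeries.map ι1 (ev2 PowerSeries.X (PowerSeries.C Polynomial.X) Vlist * GA) := by
    rw [map_mul, map_mul, map_mul, map_ev2, map_ev2, m1, m2, PowerSeries.map_X, PowerSeries.map_X, ← mul_assoc, hfin, GG_eq]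
    change _ = y * (ev2 t y Ulist.reverse * _) + ev2 t z Vlist * _
    linear_combination (y * ev2 t y Ulist.reverse * (PowerSeries.map ι2 GA)) * hA + (ev2 t z Vlist * (PowerSeries.map ι1 GA)) * hB
  have hD : ev1 t Dlist = PowerSeries.map (Int.castRingHom LP) (ev1 PowerSeries.X Dlist) := by
    rw [map_ev1, PowerSeries.map_X]
  have hz2 : z ^ 2 = PowerSeries.C (LaurentPolynomial.T 2) := by
    simp only [z, ← map_pow, LaurentPolynomial.T_pow]; norm_num
  have := congrArg c0 hprod
  rw [hD, c0_mul, hz2, c0_GG, c0_add, c0_ι2, c0_ι1, zero_add, map_mul, map_ev2] at this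
  rw [this]
  have e1 : PowerSeries.map (Polynomial.evalRingHom (0 : ℤ)) GA = 1 := by
    simp only [GA, map_mul, map_geo, map_pow]
    have : geo (0 : ℤ) = 1 := by
      have := geo_mul (0 : ℤ)
      simpa using this
    simp [this]
  rw [e1, mul_one]
  simp only [PowerSeries.map_X, PowerSeries.map_C]
  have : ∀ (t : PowerSeries ℤ) l, ev2 t 0 l = ev1 t (l.getD 0 []) := by
    intro t l
    cases l with
    | nil => rfl
    | cons a l => simp [ev2, gev]
  rw [← this]
  simp

theorem hilbert (d : ℕ) : (mons d 0).card = (mons d (-2)).card + (Td d).card := by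
  have h := hil0
  have h2 := cert2 (PowerSeries.X : PowerSeries ℤ)
  have h3 : (∏ i, (1 - PowerSeries.X ^ del i) : PowerSeries ℤ) * ∏ i, geoD (del i) = 1 := by
    rw [← Finset.prod_mul_distrib]
    apply Finset.prod_eq_one
    intro i _
    exact geoD_mul (del_pos i)
  have hD : (ev1 PowerSeries.X Dlist : PowerSeries ℤ) ≠ 0 := by
    intro h0
    have := congrArg (PowerSeries.constantCoeff) h0
    rw [map_ev1] at this
    simp [ev1, Dlist, gev] at this
  have h4 : PowerSeries.mk (fun d => ((mons d 0).card : ℤ) - (mons d (-2)).card) =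
      (∑ j ∈ range 88, PowerSeries.X ^ edeg j) * ∏ i, geoD (del i) := by
    apply mul_left_cancel₀ hD
    rw [h, ← mul_assoc, h2, mul_assoc, h3, mul_one]
  have h5 := congrArg (PowerSeries.coeff d) h4
  rw [coeff_Td, PowerSeries.coeff_mk] at h5
  omega

theorem finrank_Inv_le (d : ℕ) : Module.finrank ℂ (Inv d) ≤ (Td d).card := by
  have := finrank_Inv d
  have := hilbert d
  omega

end Sept


namespace Sept

/-- transvectant tables -/
def tabs : List (List (List ℤ)) := [
[[0, 0, 0, 0, 21, 105, 315, 735], [0, 0, 0, -12, -27, -15, 75, 315], [0, 0, 10, 6, -15, -35, -15, 105], [0, -12, 6, 18, 9, -15, -27, 21], [21, -27, -15, 9, 18, 6, -12, 0], [105, -15, -35, -15, 6, 10, 0, 0], [315, 75, -15, -27, -12, 0, 0, 0], [735, 315, 105, 21, 0, 0, 0, 0]],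
[[0, 0, 0, 0, 0, 0, 35, 245], [0, 0, 0, 0, 0, -10, -25, 35], [0, 0, 0, 0, 5, 5, -10, 0], [0, 0, 0, -4, -1, 5, 0, 0], [0, 0, 5, -1, -4, 0, 0, 0], [0, -10, 5, 5, 0, 0, 0, 0], [35, -25, -10, 0, 0, 0, 0, 0], [245, 35, 0, 0, 0, 0, 0, 0]],
[[0, 0, 0, 0, 0, 10, 60, 210], [0, 0, 0, 0, -5, -15, -15, 35], [0, 0, 0, 4, 6, 0, -10, 0], [0, 0, -5, -3, 3, 5, 0, 0], [0, 10, 0, -6, -4, 0, 0, 0], [-35, 15, 15, 5, 0, 0, 0, 0], [-210, -60, -10, 0, 0, 0, 0, 0]],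
[[0, 0, 0, 0, 10, 50, 150], [0, 0, 0, -5, -10, 0, 50], [0, 0, 4, 2, -6, -10, 10], [0, -5, 2, 6, 2, -5, 0], [10, -10, -6, 2, 4, 0, 0], [50, 0, -10, -5, 0, 0, 0], [150, 50, 10, 0, 0, 0, 0]],
[[0, 0, 0, 4, 16, 40, 80, 140], [0, 0, -5, -11, -14, -10, 5, 35], [0, 10, 10, 4, -4, -10, -10, 0], [-35, -5, 10, 14, 11, 5, 0, 0], [-140, -80, -40, -16, -4, 0, 0, 0]],
[[0, 0, 4, 12, 24, 40, 60], [0, -5, -6, -3, 4, 15, 30], [10, 0, -6, -8, -6, 0, 10], [30, 15, 4, -3, -6, -5, 0], [60, 40, 24, 12, 4, 0, 0]],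
[[0, 4, 8, 12], [-3, 1, 5, 9], [-6, -2, 2, 6], [-9, -5, -1, 3], [-12, -8, -4, 0]],
[[0, 0, 0, 15, 60], [0, 0, -5, 0, 30], [0, 3, -4, -6, 12], [-3, 6, 0, -6, 3], [-12, 6, 4, -3, 0], [-30, 0, 5, 0, 0], [-60, -15, 0, 0, 0]],
[[0, 0, 0, 0, 10, 50], [0, 0, 0, -4, -6, 10], [0, 0, 3, 1, -4, 0], [0, -4, 1, 3, 0, 0], [10, -6, -4, 0, 0, 0], [50, 10, 0, 0, 0, 0]],
[[0, 0, 0, 0, 4, 20, 60], [0, 0, 0, -3, -8, -10, 0], [0, 0, 4, 6, 4, 0, 0], [0, -10, -8, -3, 0, 0, 0], [60, 20, 4, 0, 0, 0, 0]],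
[[0, 2, 4, 6], [-3, -1, 1, 3], [-6, -4, -2, 0]],
[[0, 0, 0, 0, 60], [0, 0, 0, -10, 20], [0, 0, 4, -8, 4], [0, -3, 6, -3, 0], [4, -8, 4, 0, 0], [20, -10, 0, 0, 0], [60, 0, 0, 0, 0]],
[[0, 0, 2, 6, 12], [0, -3, -4, -3, 0], [12, 6, 2, 0, 0]],
[[0, 0, 3, 9], [0, -2, -1, 3], [3, -1, -2, 0], [9, 3, 0, 0]],
[[0, 1, 2], [-1, 0, 1], [-2, -1, 0]],
[[0, 0, 0, 10], [0, 0, -2, 4], [0, 1, -2, 1], [-1, 2, -1, 0], [-4, 2, 0, 0], [-10, 0, 0, 0]],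
[[0, 0, 2], [0, -1, 0], [2, 0, 0]],
[[0, 0, 0, 0, 12], [0, 0, 0, -3, 0], [0, 0, 2, 0, 0], [0, -3, 0, 0, 0], [12, 0, 0, 0, 0]],
[[0, 0, 0, 3], [0, 0, -1, 0], [0, 1, 0, 0], [-3, 0, 0, 0]],
[[0, 0, 0, 0, 0, 10], [0, 0, 0, 0, -2, 0], [0, 0, 0, 1, 0, 0], [0, 0, -1, 0, 0, 0], [0, 2, 0, 0, 0, 0], [-10, 0, 0, 0, 0, 0]]]
/-- the program: (first argument, second argument, table, level, resulting order) -/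
def ops : List (ℕ × ℕ × ℕ × ℕ × ℕ) := [(0, 0, 0, 4, 6), (1, 1, 1, 6, 2), (1, 2, 2, 5, 3), (2, 2, 3, 4, 4), (0, 4, 4, 3, 5), (1, 4, 5, 2, 6), (2, 3, 6, 1, 5), (1, 3, 7, 3, 4), (1, 1, 8, 4, 2), (1, 3, 9, 4, 2), (5, 5, 8, 4, 2), (9, 8, 10, 1, 3), (11, 8, 11, 4, 2), (11, 9, 12, 2, 2), (2, 2, 13, 2, 2), (12, 12, 13, 2, 2), (14, 2, 14, 1, 2), (15, 4, 14, 1, 2), (11, 6, 15, 3, 2), (4, 3, 14, 1, 2), (18, 18, 16, 2, 0), (17, 17, 17, 4, 0), (19, 10, 18, 3, 0), (21, 10, 16, 2, 0), (22, 13, 16, 2, 0), (12, 12, 16, 2, 0), (21, 19, 19, 5, 0), (14, 13, 16, 2, 0), (26, 13, 16, 2, 0), (15, 13, 16, 2, 0), (17, 13, 16, 2, 0), (15, 14, 16, 2, 0), (16, 14, 16, 2, 0), (31, 14, 16, 2, 0), (32, 25, 16, 2, 0), (24, 22, 16, 2, 0), (34, 26, 16, 2, 0), (26, 20, 16, 2,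 0), (27, 20, 16, 2, 0), (26, 20, 16, 2, 0), (26, 21, 16, 2, 0), (26, 24, 16, 2, 0), (27, 24, 16, 2, 0), (27, 24, 16, 2, 0), (42, 24, 16, 2, 0), (34, 34, 16, 2, 0), (37, 29, 16, 2, 0), (38, 29, 16, 2, 0), (39, 29, 16, 2, 0), (40, 39, 16, 2, 0)]

def wT (T : List (List ℤ)) (i j : ℕ) : ℤ := (T.getD i []).getD j 0
def idx (T : List (List ℤ)) (s : ℕ) : List ℕ := (List.range (s + 1)).filter (fun i => !(wT T i (s - i) == 0))

section prog
variable {α β : Type*}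

def tvS (dot : List (ℤ × α × α) → α) (z : α) (T : List (List ℤ)) (r N : ℕ) (f g : List α) : List α :=
  (List.range (N + 1)).map fun k => dot ((idx T (k + r)).map fun i =>
    (wT T i (k + r - i), f.getD i z, g.getD (k + r - i) z))

def stepS (dot : List (ℤ × α × α) → α) (z : α) (o : ℕ × ℕ × ℕ × ℕ × ℕ) (env : List (List α)) : List α :=
  tvS dot z (tabs.getD o.2.2.1 []) o.2.2.2.1 o.2.2.2.2 (env.getD o.1 []) (env.getD o.2.1 [])

def runS (dot : List (ℤ × α × α) → α) (z : α) : List (ℕ × ℕ × ℕ × ℕ × ℕ) → List (List α) → List (List α)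
  | [], env => env
  | o :: os, env => runS dot z os (stepS dot z o env :: env)

def runF (dot : List (ℤ × α × α) → α) (z : α) (frc : List α → (List α → β) → β) :
    List (ℕ × ℕ × ℕ × ℕ × ℕ) → List (List α) → (List (List α) → β) → β
  | [], env, fin => fin env
  | o :: os, env, fin => frc (stepS dot z o env) (fun l => runF dot z frc os (l :: env) fin)

theorem runF_eq (dot : List (ℤ × α × α) → α) (z : α) (frc : List α → (List α → β) → β)
    (hf : ∀ l k, frc l k = k l) : ∀ os env fin, runF dot z frc os env fin = fin (runS dot z os env)
  | [], env, fin => rfl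
  | o :: os, env, fin => by rw [runF, hf, runF_eq dot z frc hf os, runS]

variable {γ : Type*}

theorem getD_rel {Rel : α → γ → Prop} {z : α} {z' : γ} (hz : Rel z z') :
    ∀ {l : List α} {l' : List γ}, List.Forall₂ Rel l l' → ∀ i, Rel (l.getD i z) (l'.getD i z')
  | _, _, .nil, i => by simpa using hz
  | _, _, .cons h t, 0 => by simpa using h
  | _, _, .cons h t, i + 1 => by simpa using getD_rel hz t i

theorem map_rel {Rel : α → γ → Prop} {ι : Type*} (f : ι → α) (g : ι → γ) :
    ∀ l : List ι, (∀ i ∈ l, Rel (f i) (g i)) → List.Forall₂ Rel (l.map f) (l.map g)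
  | [], _ => .nil
  | a :: l, h => .cons (h a (by simp)) (map_rel f g l (fun i hi => h i (by simp [hi])))

def TRel (Rel : α → γ → Prop) (a : ℤ × α × α) (b : ℤ × γ × γ) : Prop :=
  a.1 = b.1 ∧ Rel a.2.1 b.2.1 ∧ Rel a.2.2 b.2.2

theorem step_rel {Rel : α → γ → Prop} {z : α} {z' : γ} (hz : Rel z z')
    {dot : List (ℤ × α × α) → α} {dot' : List (ℤ × γ × γ) → γ} {o : ℕ × ℕ × ℕ × ℕ × ℕ}
    (hd : ∀ l l', l.length ≤ 8 → List.Forall₂ (TRel Rel) l l' → Rel (dot l) (dot' l'))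
    (ho : ∀ k ∈ List.range (o.2.2.2.2 + 1), (idx (tabs.getD o.2.2.1 []) (k + o.2.2.2.1)).length ≤ 8)
    {env : List (List α)} {env' : List (List γ)} (he : List.Forall₂ (List.Forall₂ Rel) env env') :
    List.Forall₂ Rel (stepS dot z o env) (stepS dot' z' o env') := by
  rw [stepS, stepS, tvS, tvS]
  apply map_rel
  intro k hk
  apply hd
  · rw [List.length_map]; exact ho k hk
  · apply map_rel
    intro i _
    exact ⟨rfl, getD_rel hz (getD_rel (Rel := List.Forall₂ Rel) .nil he _) _,
      getD_rel hz (getD_rel (Rel := List.Forall₂ Rel) .nil he _) _⟩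

theorem ops_len : ∀ o ∈ ops, ∀ k ∈ List.range (o.2.2.2.2 + 1),
    (idx (tabs.getD o.2.2.1 []) (k + o.2.2.2.1)).length ≤ 8 := by decide +kernel

theorem run_rel {Rel : α → γ → Prop} {z : α} {z' : γ} (hz : Rel z z')
    {dot : List (ℤ × α × α) → α} {dot' : List (ℤ × γ × γ) → γ}
    (hd : ∀ l l', l.length ≤ 8 → List.Forall₂ (TRel Rel) l l' → Rel (dot l) (dot' l')) :
    ∀ (os : List (ℕ × ℕ × ℕ × ℕ × ℕ)), (∀ o ∈ os, ∀ k ∈ List.range (o.2.2.2.2 + 1),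
      (idx (tabs.getD o.2.2.1 []) (k + o.2.2.2.1)).length ≤ 8) →
    ∀ {env : List (List α)} {env' : List (List γ)}, List.Forall₂ (List.Forall₂ Rel) env env' →
    List.Forall₂ (List.Forall₂ Rel) (runS dot z os env) (runS dot' z' os env')
  | [], _, _, _, he => he
  | o :: os, h, _, _, he => by
    rw [runS, runS]
    exact run_rel hz hd os (fun o ho => h o (by simp [ho])) (.cons (step_rel hz hd (h o (by simp)) he) he)

def genS (dot : List (ℤ × α × α) → α) (z : α) (f : List α) (i : ℕ) : α :=
  ((runS dot z ops [f]).getD (29 - i) []).getD 0 z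

theorem gen_rel {Rel : α → γ → Prop} {z : α} {z' : γ} (hz : Rel z z')
    {dot : List (ℤ × α × α) → α} {dot' : List (ℤ × γ × γ) → γ}
    (hd : ∀ l l', l.length ≤ 8 → List.Forall₂ (TRel Rel) l l' → Rel (dot l) (dot' l'))
    {f : List α} {f' : List γ} (hf : List.Forall₂ Rel f f') (i : ℕ) :
    Rel (genS dot z f i) (genS dot' z' f' i) :=
  getD_rel hz (getD_rel (Rel := List.Forall₂ Rel) .nil (run_rel hz hd ops ops_len (.cons hf .nil)) _) _

end prog

section ring
variable {R R' : Type*} [CommRing R] [CommRing R']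

def dotR (l : List (ℤ × R × R)) : R := (l.map fun x => (x.1 : R) * x.2.1 * x.2.2).sum

/-- the generators evaluated at a form with coefficients in a ring -/
def gen (f : List R) (i : ℕ) : R := genS dotR 0 f i

theorem dot_hom (φ : R →+* R') : ∀ (l : List (ℤ × R × R)) (l' : List (ℤ × R' × R')),
    List.Forall₂ (TRel (fun a b => φ a = b)) l l' → φ (dotR l) = dotR l'
  | _, _, .nil => by simp [dotR]
  | _, _, .cons (a := a) (b := b) (l₁ := l) (l₂ := l') h t => by
    have := dot_hom φ l l' t
    simp only [dotR, List.map_cons, List.sum_cons, map_add, map_mul] at *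
    rw [this, h.2.1, h.2.2, h.1, map_intCast]

theorem gen_hom (φ : R →+* R') (f : List R) (i : ℕ) : φ (gen f i) = gen (f.map φ) i := by
  refine gen_rel (Rel := fun a b => φ a = b) (map_zero φ) (fun l l' _ h => dot_hom φ l l' h) ?_ i
  rw [List.forall₂_map_right_iff]
  exact List.forall₂_same.2 (fun _ _ => rfl)

theorem sum_filter (l : List ℕ) (w : ℕ → ℤ) (F : ℕ → R) :
    ((l.filter (fun i => !(w i == 0))).map (fun i => (w i : R) * F i)).sum = (l.map (fun i => (w i : R) * F i)).sum := by
  induction l with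
  | nil => rfl
  | cons a l ih =>
    by_cases h : w a = 0
    · simp [h, ih]
    · simp [h, ih]

theorem tv_apply (T : List (List ℤ)) (r N : ℕ) (f g : List R) (k : ℕ) (hk : k ≤ N) :
    (tvS dotR 0 T r N f g).getD k 0 = ∑ p ∈ Finset.HasAntidiagonal.antidiagonal (k + r),
      (wT T p.1 p.2 : R) * (f.getD p.1 0 * g.getD p.2 0) := by
  rw [Finset.Nat.sum_antidiagonal_eq_sum_range_succ (fun a b => (wT T a b : R) * (f.getD a 0 * g.getD b 0))]
  have : k < (List.range (N + 1)).length := by simp; omega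
  rw [tvS, List.getD_eq_getElem _ _ (by simpa using this), List.getElem_map, List.getElem_range, dotR, List.map_map, idx]
  have h := sum_filter (List.range (k + r + 1)) (fun i => wT T i (k + r - i))
    (fun i => f.getD i 0 * g.getD (k + r - i) 0)
  have e : (fun x : ℤ × R × R => (x.1 : R) * x.2.1 * x.2.2) ∘ (fun i => (wT T i (k + r - i), f.getD i 0, g.getD (k + r - i) 0))
    = fun i => (wT T i (k + r - i) : R) * (f.getD i 0 * g.getD (k + r - i) 0) := by
    funext i; simp [mul_assoc]
  rw [e, h]
  rfl

theorem tv_apply' (T : List (List ℤ)) (r N : ℕ) (f g : List R) (k : ℕ) (hk : N < k) :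
    (tvS dotR 0 T r N f g).getD k 0 = 0 := by
  rw [List.getD_eq_default]; simp [tvS]; omega
end ring

structure CovF (m : ℕ) (F : ℕ → R8) : Prop where
  big : ∀ i, m < i → F i = 0
  e0 : D1 (F 0) = 0
  e1 : ∀ i, D1 (F (i + 1)) = ((m - i : ℕ) : R8) * F i
  f1 : ∀ i, D2 (F i) = ((i + 1 : ℕ) : R8) * F (i + 1)

def ck (m n r N : ℕ) (T : List (List ℤ)) : Bool :=
  (N + 2 * r == m + n) && !(r == 0) && (List.range (m + 1)).all (fun i => (List.range (n + 1)).all (fun j =>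
    ((m - i : ℕ) * wT T (i + 1) j + (n - j : ℕ) * wT T i (j + 1) == ((N - (i + j - r) : ℕ) : ℤ) * wT T i j)
    && (i * wT T (i - 1) j + j * wT T i (j - 1) == ((i + j - r : ℕ) : ℤ) * wT T i j)
    && (wT T i j == 0 || (decide (r ≤ i + j) && decide (i + j ≤ N + r)))))

theorem D_cast_mul (D : Derivation ℂ R8 R8) (w : ℤ) (u : R8) : D ((w : R8) * u) = (w : R8) * D u := by
  rw [← zsmul_eq_mul, map_zsmul, zsmul_eq_mul]

theorem D_mul (D : Derivation ℂ R8 R8) (w : ℤ) (u v : R8) :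
    D ((w : R8) * (u * v)) = (w : R8) * (u * D v + v * D u) := by
  rw [D_cast_mul, Derivation.leibniz, smul_eq_mul, smul_eq_mul]

theorem D_ofNat (D : Derivation ℂ R8 R8) (n : ℕ) [n.AtLeastTwo] : D (OfNat.ofNat n : R8) = 0 := by
  rw [← Nat.cast_ofNat (R := R8)]; exact Derivation.map_natCast D _

theorem cov_tv {m n r N : ℕ} {T : List (List ℤ)} (h : ck m n r N T = true) {F G : ℕ → R8}
    (hF : CovF m F) (hG : CovF n G) :
    CovF N (fun k => ∑ p ∈ Finset.HasAntidiagonal.antidiagonal (k + r), (wT T p.1 p.2 : R8) * (F p.1 * G p.2)) := by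
  simp only [ck, Bool.and_eq_true, beq_iff_eq, List.all_eq_true, List.mem_range, Bool.or_eq_true,
    decide_eq_true_eq, Bool.not_eq_true', beq_eq_false_iff_ne] at h
  obtain ⟨⟨hN, hr⟩, h⟩ := h
  obtain ⟨q, rfl⟩ : ∃ q, r = q + 1 := ⟨r - 1, by omega⟩
  have key : ∀ i j, (wT T i j : R8) * (F i * G j) ≠ 0 → i ≤ m ∧ j ≤ n ∧ q + 1 ≤ i + j ∧ i + j ≤ N + (q + 1) := by
    intro i j hne
    by_cases hi : i ≤ m
    · by_cases hj : j ≤ n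
      · rcases (h i (by omega) j (by omega)).2 with h0 | h0
        · rw [h0] at hne; simp at hne
        · omega
      · rw [hG.big j (by omega)] at hne; simp at hne
    · rw [hF.big i (by omega)] at hne; simp at hne
  have E : ∀ s, D1 (∑ p ∈ Finset.HasAntidiagonal.antidiagonal (s + 1), (wT T p.1 p.2 : R8) * (F p.1 * G p.2)) =
      ∑ p ∈ Finset.HasAntidiagonal.antidiagonal s, ((N - (p.1 + p.2 - (q + 1)) : ℕ) : R8) * ((wT T p.1 p.2 : R8) * (F p.1 * G p.2)) := by
    intro s
    rw [map_sum]
    simp only [D_mul, mul_add, Finset.sum_add_distrib]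
    rw [Finset.Nat.sum_antidiagonal_succ', Finset.Nat.sum_antidiagonal_succ]
    simp only [hG.e0, hF.e0, hG.e1, hF.e1, mul_zero, zero_add]
    rw [← Finset.sum_add_distrib]
    apply Finset.sum_congr rfl
    rintro ⟨i, j⟩ _
    by_cases hi : i ≤ m
    · by_cases hj : j ≤ n
      · have h1 := congrArg (Int.cast : ℤ → R8) (h i (by omega) j (by omega)).1.1
        push_cast [-Nat.cast_sub] at h1
        simp only
        linear_combination (F i * G j) * h1
      · simp only [hG.big j (by omega), Nat.sub_eq_zero_of_le (show n ≤ j by omega)]; simp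
    · simp only [hF.big i (by omega), Nat.sub_eq_zero_of_le (show m ≤ i by omega)]; simp
  refine ⟨?_, ?_, ?_, ?_⟩
  · intro k hk
    apply Finset.sum_eq_zero
    rintro ⟨i, j⟩ hp
    rw [Finset.HasAntidiagonal.mem_antidiagonal] at hp
    by_contra hne
    have := key i j hne
    simp only at hp
    omega
  · simp only [zero_add]
    rw [E]
    apply Finset.sum_eq_zero
    rintro ⟨i, j⟩ hp
    rw [Finset.HasAntidiagonal.mem_antidiagonal] at hp
    by_contra hne
    have := key i j (right_ne_zero_of_mul hne)
    simp only at hp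
    omega
  · intro k
    rw [show k + 1 + (q + 1) = (k + (q + 1)) + 1 by ring, E, Finset.mul_sum]
    apply Finset.sum_congr rfl
    rintro ⟨i, j⟩ hp
    rw [Finset.HasAntidiagonal.mem_antidiagonal] at hp
    simp only at hp ⊢
    rw [hp, Nat.add_sub_cancel]
  · intro k
    rw [map_sum]
    simp only [D_mul, mul_add, Finset.sum_add_distrib, hF.f1, hG.f1]
    have e1 : ∑ p ∈ Finset.HasAntidiagonal.antidiagonal (k + (q + 1)), (wT T p.1 p.2 : R8) * (F p.1 * (((p.2 + 1 : ℕ) : R8) * G (p.2 + 1)))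
        = ∑ p ∈ Finset.HasAntidiagonal.antidiagonal (k + (q + 1) + 1), (wT T p.1 (p.2 - 1) : R8) * (F p.1 * ((p.2 : R8) * G p.2)) := by
      rw [Finset.Nat.sum_antidiagonal_succ']; simp
    have e2 : ∑ p ∈ Finset.HasAntidiagonal.antidiagonal (k + (q + 1)), (wT T p.1 p.2 : R8) * (G p.2 * (((p.1 + 1 : ℕ) : R8) * F (p.1 + 1)))
        = ∑ p ∈ Finset.HasAntidiagonal.antidiagonal (k + (q + 1) + 1), (wT T (p.1 - 1) p.2 : R8) * (G p.2 * ((p.1 : R8) * F p.1)) := by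
      rw [Finset.Nat.sum_antidiagonal_succ]; simp
    rw [e1, e2, ← Finset.sum_add_distrib, show k + 1 + (q + 1) = (k + (q + 1)) + 1 by ring, Finset.mul_sum]
    apply Finset.sum_congr rfl
    rintro ⟨i, j⟩ hp
    rw [Finset.HasAntidiagonal.mem_antidiagonal] at hp
    simp only at hp ⊢
    by_cases hi : i ≤ m
    · by_cases hj : j ≤ n
      · have h1 := congrArg (Int.cast : ℤ → R8) (h i (by omega) j (by omega)).1.2
        rw [show i + j - (q + 1) = k + 1 by omega] at h1
        push_cast at h1 ⊢
        linear_combination (F i * G j) * h1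
      · simp only [hG.big j (by omega)]; simp
    · simp only [hF.big i (by omega)]; simp

/-- covariant list of order `m`, degree `d` -/
def CovL (l : List R8) (md : ℕ × ℕ) : Prop :=
  CovF md.1 (fun i => l.getD i 0) ∧ ∀ i, (l.getD i 0).IsHomogeneous md.2

def metaRun : List (ℕ × ℕ × ℕ × ℕ × ℕ) → List (ℕ × ℕ) → List (ℕ × ℕ)
  | [], env => env
  | o :: os, env => metaRun os ((o.2.2.2.2, (env.getD o.1 (0, 0)).2 + (env.getD o.2.1 (0, 0)).2) :: env)

def okRun : List (ℕ × ℕ × ℕ × ℕ × ℕ) → List (ℕ × ℕ) → Bool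
  | [], _ => true
  | o :: os, env => ck (env.getD o.1 (0, 0)).1 (env.getD o.2.1 (0, 0)).1 o.2.2.2.1 o.2.2.2.2 (tabs.getD o.2.2.1 [])
     && okRun os ((o.2.2.2.2, (env.getD o.1 (0, 0)).2 + (env.getD o.2.1 (0, 0)).2) :: env)

theorem covL_nil : CovL [] (0, 0) :=
  ⟨⟨by simp, by simp, by simp, by simp⟩, by simp [isHomogeneous_zero]⟩

theorem isHom_cast (w : ℤ) : IsHomogeneous (w : R8) 0 := by
  rw [← eq_intCast (C.comp (Int.castRingHom ℂ) : ℤ →+* R8)]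
  exact isHomogeneous_C _ _

theorem covL_step {o : ℕ × ℕ × ℕ × ℕ × ℕ} {env : List (List R8)} {me : List (ℕ × ℕ)}
    (he : List.Forall₂ CovL env me)
    (hk : ck (me.getD o.1 (0, 0)).1 (me.getD o.2.1 (0, 0)).1 o.2.2.2.1 o.2.2.2.2 (tabs.getD o.2.2.1 []) = true) :
    CovL (stepS dotR 0 o env) (o.2.2.2.2, (me.getD o.1 (0, 0)).2 + (me.getD o.2.1 (0, 0)).2) := by
  have ha := getD_rel covL_nil he o.1
  have hb := getD_rel covL_nil he o.2.1
  have hc := cov_tv hk ha.1 hb.1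
  have eq : ∀ k, (stepS dotR 0 o env).getD k 0 = ∑ p ∈ Finset.HasAntidiagonal.antidiagonal (k + o.2.2.2.1),
      (wT (tabs.getD o.2.2.1 []) p.1 p.2 : R8) * ((env.getD o.1 []).getD p.1 0 * (env.getD o.2.1 []).getD p.2 0) := by
    intro k
    by_cases h : k ≤ o.2.2.2.2
    · exact tv_apply _ _ _ _ _ _ h
    · rw [stepS, tv_apply' _ _ _ _ _ _ (by omega)]
      exact (hc.big k (by omega)).symm
  refine ⟨?_, ?_⟩
  · simp only [eq]; exact hc
  · intro i
    rw [eq]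
    apply IsHomogeneous.sum
    intro p _
    have := (isHom_cast (wT (tabs.getD o.2.2.1 []) p.1 p.2)).mul ((ha.2 p.1).mul (hb.2 p.2))
    rwa [zero_add] at this

theorem covL_run : ∀ (os : List (ℕ × ℕ × ℕ × ℕ × ℕ)) {env : List (List R8)} {me : List (ℕ × ℕ)},
    List.Forall₂ CovL env me → okRun os me = true → List.Forall₂ CovL (runS dotR 0 os env) (metaRun os me)
  | [], _, _, he, _ => he
  | o :: os, _, _, he, h => by
    rw [okRun, Bool.and_eq_true] at h
    rw [runS, metaRun]
    exact covL_run os (.cons (covL_step he h.1) he) h.2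

/-- the generic form -/
noncomputable def fX (R : Type*) [CommRing R] : List (MvPolynomial (Fin 8) R) :=
  [X 0, 7 * X 1, 21 * X 2, 35 * X 3, 35 * X 4, 21 * X 5, 7 * X 6, X 7]

theorem okops : okRun ops [(7, 1)] = true := by decide +kernel
theorem metaops : ∀ i ∈ List.range 30, (metaRun ops [(7, 1)]).getD (29 - i) (0, 0) = (0, degL.getD i 0) := by
  decide +kernel

theorem ofNat_smul (n : ℕ) [n.AtLeastTwo] (u : R8) : (OfNat.ofNat n : R8) * u = (OfNat.ofNat n : ℂ) • u := by
  rw [MvPolynomial.smul_eq_C_mul, map_ofNat]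

theorem covL_fX : CovL (fX ℂ) (7, 1) := by
  refine ⟨⟨?_, ?_, ?_, ?_⟩, ?_⟩
  · intro i hi
    rw [List.getD_eq_default]; simp [fX]; omega
  · simp [fX, D1X0]
  · intro i
    rcases lt_or_ge i 7 with h | h
    · interval_cases i <;> simp [fX, D_ofNat, ofNat_smul, Dsmul, D1X1, D1X2, D1X3, D1X4, D1X5, D1X6, D1X7] <;> (try simp only [MvPolynomial.smul_eq_C_mul, map_ofNat, ← mul_assoc]) <;> (try norm_num) <;> (try exact D_ofNat _ _)
    · rw [List.getD_eq_default _ _ (by simp [fX]; omega), Nat.sub_eq_zero_of_le h]; simp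
  · intro i
    rcases lt_or_ge i 7 with h | h
    · interval_cases i <;> simp [fX, D_ofNat, ofNat_smul, Dsmul, D2X0, D2X1, D2X2, D2X3, D2X4, D2X5, D2X6, D2X7] <;> (try simp only [MvPolynomial.smul_eq_C_mul, map_ofNat, ← mul_assoc]) <;> (try norm_num) <;> (try exact D_ofNat _ _)
    · rw [List.getD_eq_default (fX ℂ) 0 (n := i + 1) (by simp [fX]; omega)]
      rcases Nat.lt_or_ge 7 i with h2 | h2
      · rw [List.getD_eq_default _ _ (by simp [fX]; omega)]; simp
      · obtain rfl : i = 7 := by omega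
        simp [fX, D2X7]
  · intro i
    have hX : ∀ (n : ℕ) (j : Fin 8), IsHomogeneous ((n : R8) * X j) 1 := by
      intro n j
      have := (isHom_cast n).mul (isHomogeneous_X ℂ j)
      simpa using this
    have key : ∀ u ∈ fX ℂ, IsHomogeneous u 1 := by
      have h1 := hX 1
      have h7 := hX 7
      have h21 := hX 21
      have h35 := hX 35
      push_cast at h1 h7 h21 h35
      simp only [one_mul] at h1
      simp only [fX, List.mem_cons, List.not_mem_nil, or_false]
      rintro u (rfl | rfl | rfl | rfl | rfl | rfl | rfl | rfl)
      exacts [h1 0, h7 1, h21 2, h35 3, h35 4, h21 5, h7 6, h1 7]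
    rcases lt_or_ge i (fX ℂ).length with h | h
    · rw [List.getD_eq_getElem _ _ h]; exact key _ (List.getElem_mem h)
    · rw [List.getD_eq_default _ _ h]; exact isHomogeneous_zero _ _ _

theorem gen_mem (i : ℕ) (hi : i < 30) : gen (fX ℂ) i ∈ Inv (degL.getD i 0) := by
  have h := getD_rel covL_nil (covL_run ops (.cons covL_fX .nil) okops) (29 - i)
  rw [metaops i (by simpa using hi)] at h
  refine ⟨⟨h.1.e0, ?_⟩, h.2 0⟩
  have := h.1.f1 0
  rw [h.1.big (0 + 1) (by norm_num), mul_zero] at this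
  exact this

end Sept


namespace Polynomial.Sept
open scoped Polynomial
/-- `n` is a packed representation (base `2^64`) of a polynomial in `Y` with value `z` -/
def Good {A : Type*} [CommRing A] (Y : A) (D S n : ℕ) (z : A) : Prop :=
  ∃ P : ℕ[X], P.eval (2 ^ 64) = n ∧ P.eval₂ (Nat.castRingHom A) Y = z ∧ P.eval 1 ≤ S ∧ P.natDegree ≤ D

section packed
theorem split_poly : ∀ (L : ℕ) (P : ℕ[X]), P.eval 1 < 2 ^ 64 → ∃ P0 P1 : ℕ[X], P = P0 + X ^ L * P1 ∧
    P0.eval (2 ^ 64) < (2 ^ 64) ^ L ∧ P0.eval 1 + P1.eval 1 = P.eval 1 ∧ P0.natDegree ≤ L - 1 ∧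
    P1.natDegree ≤ P.natDegree - L
  | 0, P, h => ⟨0, P, by simp, by simp, by simp, by simp, by simp⟩
  | L + 1, P, h => by
    have e := P.X_mul_divX_add
    have h1 : P.eval 1 = (P.divX).eval 1 + P.coeff 0 := by
      conv_lhs => rw [← e]
      simp
    obtain ⟨P0, P1, h2, h3, h4, h5, h6⟩ := split_poly L P.divX (by omega)
    refine ⟨X * P0 + C (P.coeff 0), P1, ?_, ?_, ?_, ?_, ?_⟩
    · conv_lhs => rw [← e, h2]
      ring
    · simp only [eval_add, eval_mul, eval_X, eval_C, pow_succ (2 ^ 64) L]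
      have : P.coeff 0 < 2 ^ 64 := by omega
      nlinarith
    · simp only [eval_add, eval_mul, eval_X, eval_C]; omega
    · rcases Nat.eq_zero_or_pos L with rfl | hL
      · have : P0.eval 1 = 0 := by
          have e0 : P0 = C (P0.coeff 0) := eq_C_of_natDegree_le_zero (by simpa using h5)
          rw [e0] at h3 ⊢; simpa using h3
        have e0 : P0 = 0 := by
          have e0 : P0 = C (P0.coeff 0) := eq_C_of_natDegree_le_zero (by simpa using h5)
          rw [e0] at h3; rw [e0]; simpa using h3
        simp [e0]
      · refine (natDegree_add_C).le.trans (natDegree_mul_le.trans ?_)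
        have := natDegree_X_le (R := ℕ)
        omega
    · rw [natDegree_divX_eq_natDegree_tsub_one] at h6; omega

variable {A : Type*} [CommRing A] {Y : A} {D S n : ℕ} {z : A} {D' S' n' : ℕ} {z' : A}

theorem Good.mono (h : Good Y D S n z) (hD : D ≤ D') (hS : S ≤ S') : Good Y D' S' n z := by
  obtain ⟨P, a, b, c, d⟩ := h
  exact ⟨P, a, b, c.trans hS, d.trans hD⟩

theorem good_nat (c : ℕ) : Good Y 0 c c (c : A) := ⟨(c : ℕ[X]), by simp, by simp, by simp, by simp⟩

theorem Good.add (h : Good Y D S n z) (h' : Good Y D S' n' z') : Good Y D (S + S') (n + n') (z + z') := by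
  obtain ⟨P, a, b, c, d⟩ := h
  obtain ⟨P', a', b', c', d'⟩ := h'
  exact ⟨P + P', by rw [eval_add, a, a'], by simp [b, b'], by simp only [eval_add]; omega, natDegree_add_le_of_degree_le d d'⟩

theorem Good.mul (h : Good Y D S n z) (h' : Good Y D' S' n' z') : Good Y (D + D') (S * S') (n * n') (z * z') := by
  obtain ⟨P, a, b, c, d⟩ := h
  obtain ⟨P', a', b', c', d'⟩ := h'
  exact ⟨P * P', by rw [eval_mul, a, a'], by simp [eval₂_mul, b, b'], by simp only [eval_mul]; exact Nat.mul_le_mul c c',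
    natDegree_mul_le.trans (by omega)⟩

theorem Good.nmul (c : ℕ) (h : Good Y D S n z) : Good Y D (c * S) (c * n) (c * z) := by
  simpa using (good_nat (Y := Y) c).mul h

theorem Good.hom {A' : Type*} [CommRing A'] (φ : A →+* A') (h : Good Y D S n z) : Good (φ Y) D S n (φ z) := by
  obtain ⟨P, a, b, c, d⟩ := h
  refine ⟨P, a, ?_, c, d⟩
  rw [← b, hom_eval₂]
  congr 1
  exact Subsingleton.elim _ _

theorem good_shift (L : ℕ) : Good Y L 1 ((2 ^ 64) ^ L) (Y ^ L) :=
  ⟨X ^ L, by simp, by simp, by simp, natDegree_X_pow_le _⟩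

theorem Good.split (h : Good Y D S n z) (hS : S < 2 ^ 64) (L : ℕ) : ∃ z0 z1 : A, z = z0 + Y ^ L * z1 ∧
    Good Y (L - 1) S (n % (2 ^ 64) ^ L) z0 ∧ Good Y (D - L) S (n / (2 ^ 64) ^ L) z1 := by
  obtain ⟨P, a, b, c, d⟩ := h
  obtain ⟨P0, P1, h2, h3, h4, h5, h6⟩ := split_poly L P (by omega)
  have e : n = P0.eval (2 ^ 64) + (2 ^ 64) ^ L * P1.eval (2 ^ 64) := by
    rw [← a, h2]; simp
  refine ⟨P0.eval₂ (Nat.castRingHom A) Y, P1.eval₂ (Nat.castRingHom A) Y, ?_, ⟨P0, ?_, rfl, by omega, h5⟩,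
    ⟨P1, ?_, rfl, by omega, by omega⟩⟩
  · rw [← b, h2]; simp
  · rw [e, Nat.add_mul_mod_self_left, Nat.mod_eq_of_lt h3]
  · rw [e, Nat.add_mul_div_left _ _ (by positivity), Nat.div_eq_of_lt h3, zero_add]

theorem Good.fold (h : Good Y D S n z) (hS : S < 2 ^ 64) (L : ℕ) {q Dq Sq : ℕ} (hq : Good Y Dq Sq q (Y ^ L))
    {E : ℕ} (h1 : L - 1 ≤ E) (h2 : D - L + Dq ≤ E) :
    Good Y E (S + S * Sq) (n % (2 ^ 64) ^ L + n / (2 ^ 64) ^ L * q) z := by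
  obtain ⟨z0, z1, e, g0, g1⟩ := h.split hS L
  rw [e, mul_comm (Y ^ L)]
  exact (g0.mono h1 le_rfl).add ((g1.mul hq).mono h2 le_rfl)

theorem Good.zero (h : Good Y D S 0 z) : z = 0 := by
  obtain ⟨P, a, b, c, d⟩ := h
  have : P = 0 := by
    rw [eval_eq_sum_range, Finset.sum_eq_zero_iff] at a
    ext i
    by_cases hi : i ≤ P.natDegree
    · simpa using a i (by simpa [Nat.lt_succ_iff] using hi)
    · rw [coeff_eq_zero_of_natDegree_lt (by omega)]; simp
  rw [← b, this]; simp

theorem Good.small_deg (h : Good Y 0 S n z) : z = (n : A) := by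
  obtain ⟨P, a, b, c, d⟩ := h
  rw [eq_C_of_natDegree_le_zero d] at a b
  simp only [eval_C, eval₂_C] at a b
  rw [← b, a]; simp

theorem Good.small (h : Good Y D S n z) (hS : S < 2 ^ 64) (hn : n < 2 ^ 64) : z = (n : A) := by
  obtain ⟨z0, z1, e, g0, g1⟩ := h.split hS 1
  rw [pow_one, Nat.div_eq_of_lt hn] at g1
  rw [pow_one, Nat.mod_eq_of_lt hn] at g0
  rw [e, g1.zero, g0.small_deg]; simp

/-- forcing evaluation -/
def frc1 {β : Type*} (n : ℕ) (k : ℕ → β) : β := Nat.rec (k 0) (fun m _ => k (Nat.succ m)) n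
theorem frc1_eq {β : Type*} (n : ℕ) (k : ℕ → β) : frc1 n k = k n := by cases n <;> rfl

def frcN {β : Type*} : List ℕ → (List ℕ → β) → β
  | [], k => k []
  | a :: l, k => frc1 a (fun a' => frcN l (fun l' => k (a' :: l')))
theorem frcN_eq {β : Type*} : ∀ (l : List ℕ) (k : List ℕ → β), frcN l k = k l
  | [], _ => rfl
  | a :: l, k => by rw [frcN, frc1_eq, frcN_eq]

def BB : ℕ := 18446744073709551616
theorem BB_eq : BB = 2 ^ 64 := by decide

/-- reduce digits modulo 89 -/
def rdig : ℕ → ℕ → ℕ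
  | 0, _ => 0
  | k + 1, n => frc1 (Nat.div n BB) (fun m => Nat.add (Nat.mod (Nat.mod n BB) 89) (Nat.mul BB (rdig k m)))

theorem rdig_succ (k n : ℕ) : rdig (k + 1) n = n % 2 ^ 64 % 89 + 2 ^ 64 * rdig k (n / 2 ^ 64) := by
  rw [rdig, frc1_eq, BB_eq]; rfl

theorem Good.rdig (h89 : (89 : A) = 0) : ∀ (k : ℕ) {n : ℕ} {z : A} {S : ℕ}, Good Y k S n z → S < 2 ^ 64 →
    Good Y k (88 * (k + 1)) (rdig (k + 1) n) z
  | k, n, z, S, h, hS => by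
    have hc : ∀ c : ℕ, ((c % 89 : ℕ) : A) = c := by
      intro c
      conv_rhs => rw [← Nat.mod_add_div c 89]
      push_cast; rw [h89]; simp
    obtain ⟨z0, z1, e, g0, g1⟩ := h.split hS 1
    rw [pow_one] at g0 g1
    have e0 := g0.small hS (Nat.mod_lt _ (by norm_num))
    have q0 : Good Y 0 88 (n % 2 ^ 64 % 89) z0 := by
      rw [e0, ← hc]; exact (good_nat _).mono le_rfl (by omega)
    rw [rdig_succ]
    match k with
    | 0 =>
      have hz : z = z0 := by
        have h0 := h.small_deg
        obtain ⟨P, a, b, c, d⟩ := h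
        rw [eq_C_of_natDegree_le_zero d] at a c
        simp only [eval_C] at a c
        have : n / 2 ^ 64 = 0 := Nat.div_eq_of_lt (by omega)
        rw [this] at g1
        rw [e, g1.zero]; simp
      rw [hz]
      simpa [Sept.rdig] using q0
    | k + 1 =>
      have := Good.rdig h89 k (g1.mono (by omega) le_rfl) hS
      rw [e]
      have t := (good_shift (Y := Y) 1).mul this
      rw [pow_one] at t
      exact ((q0.mono (by omega) le_rfl).add (t.mono (by omega) le_rfl)).mono le_rfl (by omega)

end packed
end Polynomial.Sept


namespace Sept
open Polynomial.Sept
/-- coefficients of the base form, digits in base 100 -/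
def fD : List ℕ := [10430229407223692653547953328863683386838041326528636519100431515271051408572104418075,
  0,
  1247643402060851627727275233411201127647275417660760143100712364558669482920616645355081,
  1,
  2444325724354782431780255065681214130149572905090002708102125259182380534350603640181541,
  257150485305474165059760419684283090520036734678160006610556516736101493603575709007061,
  1956883219000312734320030932127284236671833233521907672200184737622114383332173263258753,
  5851416057334659550140097466213472095937611764315650182076458879498008071135353418118075]
/-- tangent directions -/
def QD : List (List ℕ) := [[1513096327487401063259727972384618644084477109582958123855497746864412417515514442440362,
  0,
  3819646454880578314103141056765633651209051280228169478129131471731938562572325987273511,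
  0,
  8735378085316823716274536872725515346925685415208657617435332144361672282584606684498370,
  6378361410303463107452072442523033316232006781413812414137142266808844020161315085247572,
  5610771450217953496074287876397349086749334904442766128862071181831865232436172981494370,
  0],
  [7365222470417732255844502209473365438121506210653484036142504675648481396124038734661446,
  0,
  5303127849886441586505520157165856190602412044223388420760217320747313027181531617076132,
  0,
  6512070654694017812270861844386066472273210351147368014632852520642718387150054266748779,
  1707876522304847341923167120427702071260254132367511173243861438368080844929626221704165,
  8811568341690742236456706476675553348123104457395157750458357122436782434528803257573788,
  0],
  [4856542124712108094254021256502508754059352978143688308621704645718800387065522657174543,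
  0,
  2229055723441320731406433506057785654235438456251449045908420071053328147365707124852636,
  0,
  5161477605114339623343671983528616421281046828511258858482620113587517410672678265317503,
  2757774477376468125354540266505556837178356555533668637665785626832842707654221323351355,
  5786600027495967104836305922412683387226386462187034075025772932447019285745048877291370,
  0],
  [951727606180908008564237808050473507957806136522588193586544946167521290252177767845038,
  0,
  4505635185276377318805124710165574087340004321383885785206747106674682881474473856172088,
  0,
  2381193618887159070922848014870564203936233629864015003758523946885028797862577763004135,
  7244725878692244254668388741311532334572650660673158298212225540694327480151736314433102,
  7310184769232319304251211252510156845062016927754936573670781468888511790244036144856886,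
  0],
  [8150598772142233264533220773377666668567747013002545291559773748278280615557812854310665,
  0,
  8377826728117800503179057843056612236385535724858728395566464475327435551938046262490554,
  0,
  2186243514262266257969534372031382413559200632262568785421768614277934494067245280503776,
  2125553569596629400330247009432547874115722985071823030977512614824371327510194112680282,
  4363150457297917376962058618806620422977421007385556057074865714693460727037321034116535,
  0]]
/-- dual certificates -/
def muD : List ℕ := [172741757690163713617205108220624106803512301677528061278325382141714673948582126295528,
  25861613460643661311734950715859655670221829396122365105727916247627655179538064648410,
  72620310532478101729755883778485588538745560850084824175523973367443404053257070667477,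
  13425146732528420243187938625138882226454842678351483934370535771736537063227210161317,
  51266239355486495762298814140418715087778114131452546250707581232342150087596612280682,
  48813687503861372828696449356822252368012174127308104710145119518158414381074908468757,
  56654166173050694810284712888841744333124927653633753467856348513743134615875529427111,
  7988466105177541365737040527208622628328395338510281727982665153043875674355818160667078,
  1556711828237046747952517720126371710183224217104943037954360914107831384677698153773331,
  6073755688256901421208253588754541694215767930390959224327806058770127790570777022482164,
  3782532976315959831983276722168674303243373039106383401800545451102670857247300553493316,
  49775805725333337571038157752827188131044471240387397066297787267207128351006918880628,
  88888875201623706461125484328547644435550220124868887861853741614987792047241063322866,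
  5683411135579453226863587241515305315453974613571803419802525530025265987410805166578,
  26778576366764417137677948487155363153733586104254387554397750450874741303422987532045,
  86427887847362467651071335365850538249594510670269677920264037747755784143427055323779,
  2249671820458204740034382934422609497017233983195474885367316287357750181706384066723643,
  137841527754657876667743875476933526623501949485621821852291167856818811412694155665551,
  7434828828144454133546832239458333227159186904856174886401198122634057836746873947346521,
  5636331416746674092436067776136254107106754151325828013535112426218548745583077204084862,
  7073496403465425208613065605156758545739122021268504170178000344311552384676081029253321,
  7148308534615839111719536232573279697263412471810047713454764876257614863808336435728234,
  4471208673187357355050251400570435256415165474495836885182124574060842834676810476526973,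
  1313075187088557181765052048430417640134522666495477261051277233082686620373133875194854,
  2863493416170721648345258166553443737678254503802749156551384114603363656635066333116036,
  76308183814541622213406550637756885621338007382270828318291542100448217144186153647256,
  51684065421013197132493624670464125642418760792704450553513600163170396463634047556623,
  19496944863255081575241850387871822572442717045237191630393672566140121676342611481978,
  8026422753946797442221831573759552841281622500448503043267870634477527063152803237086,
  13804330462501363969786357071567191230187331242878410429503718458434066366235925035205,
  33418779822946594356617255060967303835792824718477413219636655761370310828791964624305,
  4616547358797904192335153473755026742856117714746217002551437412277512277178164631181071,
  1279217474187645200648200233655902454205578026570709565913257906640157603765086920278074,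
  3483024110567753276250280863006838827903157800686937887251448725001045877959537059741559,
  2648181257294310861739442318670056071131457320836269316720041617511456177557161200218148,
  3514206533353378791911444871417610726550001114346521030587784234778510023845465735312257,
  6688125643168071513863480441153183451242373604037482493667674825722179586682231034441484,
  8264354177794734053707488779622132155959750267664518197450126915660969303934060445857703,
  4151230015504129323683843713320871076274795501501088087323288468052027583678394306513527,
  2170046054558147615818057927053707570426187122531969662836108866657270651080806624424435,
  21748073157905838414647543438027268762110951577282205369637568748368504708526019371302,
  79005260415730523529535006726167220640051080518262634866267365703888225970750413728548,
  58417661235113182369780056706237416255770459876535035884433526447874138117507962874532,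
  67084669042967232200697272354917184313882168136042096635308007364525222700692273331634,
  42598387858210697428220960751316842656272440037562334907577463640914423670318649635240,
  6234639380612586677700181057128286687470732586536148161623837717729304010233310872222,
  82498386410422204355602851135376847957832379555057513022210265254171160227232671300808,
  22792272414619214004183048318472392373438082545872778506391716848320271749355925815135,
  2028842441210872413671533268830012110233486786314722740087384671377733153463271416527514,
  7286561569330627632279332564734410228819557658060805713668063358102335361402275549198722,
  4729834237774745410239364111542955716058498576124057715560225471725755780678343579005267,
  7727014347786856280639362622802571464261363418264739785869847459033256037179223174076661,
  2202561345675358111315795414053965812252051277621074188352782979591419375785615638424315,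
  6774336172454403074377546613266433292986736139293649663728707221288618326720522206418861,
  5584466610673862743162096573637518875075323425595000381775527570045213064520770316696423,
  8059421477046001712718115884022614604602102149824383171303472681312428184243456007761531,
  8146766557650026776062416814455728772331052236624141793952695159701668345527162146840326,
  10556850675154357843482678202234144232318410771506874122325719687259868282865444518639,
  69717929314575264736394655452901878149572583141841787888831310366949485704765166243974,
  76375676678149818223733626051057650929104223830908341407601839542178604763475803002763,
  33486852574045110806601909483316515365668647804051068167624577605642195779814033657312,
  87276778366812197466174849526988155326485885013435870663165842412986628400526103425369,
  48885763013845695057091928715027716876620536494031303846875738826433355336576953420258,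
  4967723724183364747119647832620775775032676723442466655885151721347368335866755478824055,
  6710466617674746701669302965791122768830034510074021737938721437205488130419145867315754,
  7019782345521967416568083023403547637985817623795453764354374980106742557868377153761185,
  6652407072525402362523181973431146841062703418521126494773078144768124055878394537458177,
  7250593873740453841931374065397258848831682204574870494710098258458479680357282049095334,
  632356672124654782301497921021301350616693228238058885570647375343431770005768755100755,
  3103602509625738055873031209106379328602530584510007720007616178491038136207237410631809,
  2967790445546631887130863320030461804910093736731454824711650156881702671781213119008306,
  7413804753010000854464755245033916494278414608513579406101523653240823792183525836096364,
  102340321948305533744868393912143532618126177108815424115037304014510920188417518401,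
  2372009385633697408343561837658115227653083777724276753424014570522315683122212463077,
  14601865762355092502885741483035583808793950782300593929834942158401867921493420505362,
  25517861120976415110394774533041436532413206442361231880250623445355316058216170241734,
  79770059311905362857391155273230876544263740495088120311404361172287424587242317853119,
  6181134321384447371879233652443145233172485433614150314954261953521440585403184366516355,
  2351340972588479087954384516682977221829422763536002238276831209432812811208093374756568,
  2455503229663355550140205203293004818587223315136973633660121987150872635535875717208150,
  3610417674095671434347410858795057380881137832070622770722080365363800538072338252332944,
  49236669311137548482222075836339076682654834403952565117762931131207272885096250113584,
  76327525807074717772220037593926860966542673231806133777386870010230053012681048127140,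
  83817319285974767315748550553838586946437325833710082256516214876422562871497767828421,
  70030374088757274485006460484874426713211878821883836528671871635052516672205970556527,
  65125574181534736776204949404664412921351077734772621583707430113472663884334208744815,
  23251335666285206688113271207942645032146809746204598629783826720704726261156741612963,
  12811227282310834654210646267310882017077916753624130032618232808227356415863562755611]

def pk : ℕ → ℕ → ℕ
  | 0, _ => 0
  | k + 1, n => n % 100 + BB * pk k (n / 100)

section
variable {A : Type*} [CommRing A]
def vl (Y : A) : ℕ → ℕ → A
  | 0, _ => 0
  | k + 1, n => ((n % 100 : ℕ) : A) + Y * vl Y k (n / 100)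

theorem good_pk (Y : A) : ∀ k n, Good Y k (99 * (k + 1)) (pk (k + 1) n) (vl Y (k + 1) n)
  | 0, n => by
    have := (good_nat (Y := Y) (n % 100)).mono (le_refl 0) (show n % 100 ≤ 99 * (0 + 1) by omega)
    simpa [pk, vl] using this
  | k + 1, n => by
    have h := good_pk Y k (n / 100)
    have h1 := (good_shift (Y := Y) 1).mul h
    rw [pow_one, pow_one, ← BB_eq] at h1
    have h0 := (good_nat (Y := Y) (n % 100)).mono (Nat.zero_le (1 + k)) (show n % 100 ≤ 99 by omega)
    have := h0.add h1
    rw [pk, vl]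
    exact this.mono (by omega) (by omega)

theorem vl_hom {A' : Type*} [CommRing A'] (φ : A →+* A') (Y : A) : ∀ k n, φ (vl Y k n) = vl (φ Y) k n
  | 0, n => by simp [vl]
  | k + 1, n => by simp [vl, vl_hom φ Y k]

def Sd : ℕ := 383328
def wm (w : ℤ) : ℕ := Int.toNat (w % 89)

theorem wm_cast (h89 : (89 : A) = 0) (w : ℤ) : (w : A) = (wm w : A) := by
  have h : ((wm w : ℕ) : ℤ) = w % 89 := Int.toNat_of_nonneg (Int.emod_nonneg _ (by norm_num))
  have : ((wm w : ℕ) : A) = ((w % 89 : ℤ) : A) := by rw [← h]; simp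
  rw [this]
  conv_lhs => rw [← Int.emod_add_mul_ediv w 89]
  push_cast; rw [h89]; simp

theorem wm_le (w : ℤ) : wm w ≤ 88 := by
  have : w % 89 < 89 := Int.emod_lt_of_pos _ (by norm_num)
  rw [wm]; omega

def dsum : List (ℤ × ℕ × ℕ) → ℕ
  | [] => 0
  | x :: l => Nat.add (Nat.mul (Nat.mul (wm x.1) x.2.1) x.2.2) (dsum l)

def fold88 (n : ℕ) : ℕ := frc1 n (fun n => Nat.add (Nat.mod n (Nat.pow BB 88))
  (Nat.mul (Nat.div n (Nat.pow BB 88)) (Nat.add (Nat.mul 6 (Nat.pow BB 44)) 80)))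
def red88 (n : ℕ) : ℕ := frc1 (fold88 (fold88 n)) (fun n => rdig 88 n)
def dotN (l : List (ℤ × ℕ × ℕ)) : ℕ := red88 (dsum l)

theorem fold88_eq (n : ℕ) : fold88 n = n % (2 ^ 64) ^ 88 + n / (2 ^ 64) ^ 88 * (6 * (2 ^ 64) ^ 44 + 80) := by
  rw [fold88, frc1_eq, BB_eq]; rfl

theorem dsum_good (h89 : (89 : A) = 0) {Y : A} : ∀ (l : List (ℤ × ℕ × ℕ)) (l' : List (ℤ × A × A)),
    List.Forall₂ (TRel (Good Y 87 Sd)) l l' → Good Y 174 (l.length * (88 * Sd * Sd)) (dsum l) (dotR l')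
  | _, _, .nil => by
    have := (good_nat (Y := Y) 0).mono (Nat.zero_le 174) (Nat.zero_le 0)
    simpa [dsum, dotR] using this
  | _, _, .cons (a := a) (b := b) (l₁ := l) (l₂ := l') h t => by
    have ih := dsum_good h89 l l' t
    have h1 := (((h.2.1.nmul (wm a.1)).mul h.2.2)).mono (le_refl 174)
      (Nat.mul_le_mul_right Sd (Nat.mul_le_mul_right Sd (wm_le a.1)))
    rw [← wm_cast h89] at h1
    have := (h1.add ih).mono le_rfl (show _ ≤ (a :: l).length * (88 * Sd * Sd) by
      rw [List.length_cons]; exact le_of_eq (by ring))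
    change Good Y 174 _ (dsum (a :: l)) ((b.1 : A) * b.2.1 * b.2.2 + dotR l')
    rw [← h.1]
    exact this

theorem dotN_good (h89 : (89 : A) = 0) {Y : A} (hY : Y ^ 88 = 6 * Y ^ 44 + 80) (l : List (ℤ × ℕ × ℕ)) (l' : List (ℤ × A × A))
    (hl : l.length ≤ 8) (h : List.Forall₂ (TRel (Good Y 87 Sd)) l l') : Good Y 87 Sd (dotN l) (dotR l') := by
  have h0 := (dsum_good h89 l l' h).mono le_rfl (Nat.mul_le_mul_right _ hl)
  have hq : Good Y 44 86 (6 * (2 ^ 64) ^ 44 + 80) (Y ^ 88) := by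
    rw [hY]
    exact_mod_cast ((good_shift (Y := Y) 44).nmul 6).add ((good_nat (Y := Y) 80).mono (Nat.zero_le _) le_rfl)
  have h1 := h0.fold (by norm_num [Sd]) 88 hq (E := 130) (by norm_num) (by norm_num)
  have h2 := h1.fold (by norm_num [Sd]) 88 hq (E := 87) (by norm_num) (by norm_num)
  rw [← fold88_eq, ← fold88_eq] at h2
  rw [dotN, red88, frc1_eq]
  exact (h2.rdig h89 87 (by norm_num [Sd])).mono le_rfl (by norm_num [Sd])

def formN (k : ℕ) : List ℕ := (List.range 8).map fun i =>
  pk 44 (fD.getD i 0) + (Nat.pow BB 44 + 86) * pk 44 ((QD.getD k []).getD i 0)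

def formA (Y e : A) (k : ℕ) : List A := (List.range 8).map fun i =>
  vl Y 44 (fD.getD i 0) + e * vl Y 44 ((QD.getD k []).getD i 0)

theorem form_good {Y e : A} (he : Y ^ 44 + 86 = e) (k : ℕ) : List.Forall₂ (Good Y 87 Sd) (formN k) (formA Y e k) := by
  apply map_rel
  intro i _
  have h1 := good_pk Y 43 (fD.getD i 0)
  have h2 := good_pk Y 43 ((QD.getD k []).getD i 0)
  have h3 := ((good_shift (Y := Y) 44).add ((good_nat (Y := Y) 86).mono (Nat.zero_le _) le_rfl)).mul h2
  rw [← BB_eq] at h3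
  have := ((h1.mono (show 43 ≤ 87 by norm_num) le_rfl).add h3).mono le_rfl (show _ ≤ Sd by norm_num [Sd])
  rw [← he]
  exact_mod_cast this

/-- generators in packed form -/
def genN (k i : ℕ) : ℕ := genS dotN 0 (formN k) i

theorem genN_good (h89 : (89 : A) = 0) {Y e : A} (hY : Y ^ 88 = 6 * Y ^ 44 + 80) (he : Y ^ 44 + 86 = e) (k i : ℕ) :
    Good Y 87 Sd (genN k i) (gen (formA Y e k) i) :=
  gen_rel ((good_nat (Y := Y) 0).mono (Nat.zero_le _) (Nat.zero_le _) |> (by simpa using ·)) (dotN_good h89 hY) (form_good he k) i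
end

def thL : List ℕ := [0, 1, 5, 8, 25]
def cL : List ℕ := [29, 3, 51, 19, 5]

def finK (k : ℕ) (env : List (List ℕ)) : Bool := (List.range 5).all fun j =>
  Nat.beq ((env.getD (29 - thL.getD j 0) []).getD 0 0)
    (if j = k then Nat.add ((cL.getD j 0 + 86) % 89) (Nat.pow BB 44) else cL.getD j 0)

def fold44 (n : ℕ) : ℕ := frc1 n (fun n => Nat.add (Nat.mod n (Nat.pow BB 44)) (Nat.mul (Nat.div n (Nat.pow BB 44)) 3))
def red44 (n : ℕ) : ℕ := frc1 (fold44 n) (fun n => rdig 44 n)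
def secN (G : List ℕ) : List ℕ := secL.map fun l => l.foldr (fun i acc => red44 (Nat.mul (red44 (G.getD i 0)) acc)) 1

def chkS (S m : List ℕ) : Bool :=
  ((List.range 88).map fun j => (j, edeg j % 4, S.getD j 0)).all fun x =>
  ((List.range 88).map fun j => (j, edeg j % 4, m.getD j 0)).all fun y =>
    (!(Nat.beq x.2.1 y.2.1)) || Nat.beq (Nat.mod (Nat.mod (Nat.div (Nat.mul x.2.2 y.2.2) (Nat.pow BB 43)) BB) 89)
      (if Nat.beq x.1 y.1 then 1 else 0)

def fin0 (env : List (List ℕ)) : Bool :=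
  frcN ((List.range 30).map fun i => (env.getD (29 - i) []).getD 0 0) fun G =>
  frcN (secN G) fun S => frcN (muD.map (pk 44)) fun m => chkS S m

def runK (k : ℕ) (fin : List (List ℕ) → Bool) : Bool :=
  frcN (formN k) fun f => runF dotN 0 frcN ops [f] fin

theorem runK_eq (k : ℕ) (fin : List (List ℕ) → Bool) : runK k fin = fin (runS dotN 0 ops [formN k]) := by
  rw [runK, frcN_eq, runF_eq _ _ _ frcN_eq]

theorem run0 : runK 0 (fun env => finK 0 env && fin0 env) = true := by decide +kernel
theorem run1 : runK 1 (finK 1) = true := by decide +kernel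
theorem run2 : runK 2 (finK 2) = true := by decide +kernel
theorem run3 : runK 3 (finK 3) = true := by decide +kernel
theorem run4 : runK 4 (finK 4) = true := by decide +kernel

end Sept


namespace Polynomial.Sept
open scoped Polynomial

theorem coeff_digit (P : ℕ[X]) (h : P.eval 1 < 2 ^ 64) (e : ℕ) (he : 0 < e) :
    P.coeff e = P.eval (2 ^ 64) / (2 ^ 64) ^ e % 2 ^ 64 := by
  obtain ⟨P0, P1, h2, h3, h4, h5, h6⟩ := split_poly e P h
  have e1 : P.eval (2 ^ 64) = P0.eval (2 ^ 64) + (2 ^ 64) ^ e * P1.eval (2 ^ 64) := by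
    conv_lhs => rw [h2]
    simp
  rw [e1, Nat.add_mul_div_left _ _ (by positivity), Nat.div_eq_of_lt h3, zero_add]
  have hx := P1.X_mul_divX_add
  have h7 : P1.eval 1 = P1.divX.eval 1 + P1.coeff 0 := by
    conv_lhs => rw [← hx]
    simp
  have h8 : P1.eval (2 ^ 64) = P1.coeff 0 + 2 ^ 64 * P1.divX.eval (2 ^ 64) := by
    conv_lhs => rw [← hx]
    simp [add_comm]
  rw [h8, Nat.add_mul_mod_self_left, Nat.mod_eq_of_lt (by omega), h2, coeff_add, coeff_X_pow_mul',
    coeff_eq_zero_of_natDegree_lt (by omega)]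
  simp

instance : Fact (Nat.Prime 89) := ⟨by norm_num⟩

noncomputable def gK : (ZMod 89)[X] := X ^ 44 - C 3
noncomputable abbrev KK := AdjoinRoot gK
noncomputable def yK : KK := AdjoinRoot.root gK

theorem gK_natDegree : gK.natDegree = 44 := natDegree_X_pow_sub_C
theorem gK_monic : gK.Monic := monic_X_pow_sub_C _ (by norm_num)

theorem yK_pow : yK ^ 44 = 3 := by
  have h : AdjoinRoot.mk gK gK = 0 := AdjoinRoot.mk_self
  rw [gK, map_sub, map_pow, AdjoinRoot.mk_X, AdjoinRoot.mk_C, map_ofNat, sub_eq_zero] at h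
  exact h

theorem h89K : (89 : KK) = 0 := by
  have : ((89 : ZMod 89)) = 0 := by decide
  have h := congrArg (AdjoinRoot.of gK) this
  rwa [map_ofNat, map_zero] at h

theorem nontriv : Nontrivial KK := by
  apply AdjoinRoot.nontrivial
  rw [degree_eq_natDegree gK_monic.ne_zero, gK_natDegree]; norm_num

theorem eval_mk (P : ℕ[X]) : P.eval₂ (Nat.castRingHom KK) yK = AdjoinRoot.mk gK (P.map (Nat.castRingHom (ZMod 89))) := by
  have : (AdjoinRoot.mk gK).comp (mapRingHom (Nat.castRingHom (ZMod 89))) = eval₂RingHom (Nat.castRingHom KK) yK := by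
    apply Polynomial.ringHom_ext
    · intro a; simp
    · simp [yK]
  exact (RingHom.congr_fun this P).symm

theorem indep {T : Finset ℕ} {n m : ℕ → ℕ} {z : ℕ → KK} {S S' : ℕ} (hz : ∀ j ∈ T, Good yK 43 S (n j) (z j))
    (hm : ∀ j ∈ T, Good yK 43 S' (m j) (0 : KK) ∨ ∃ w, Good yK 43 S' (m j) w) (hS : S * S' < 2 ^ 64)
    (hc : ∀ j ∈ T, ∀ k ∈ T, n j * m k / (2 ^ 64) ^ 43 % 2 ^ 64 % 89 = if j = k then 1 else 0)
    (b : ℕ → ZMod 89) (h0 : ∑ j ∈ T, algebraMap (ZMod 89) KK (b j) * z j = 0) : ∀ j ∈ T, b j = 0 := by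
  intro k hk
  choose! P hP1 hP2 hP3 hP4 using hz
  obtain ⟨M, hM1, hM3⟩ : ∃ M : ℕ[X], M.eval (2 ^ 64) = m k ∧ M.eval 1 ≤ S' := by
    rcases hm k hk with ⟨M, a, _, c, _⟩ | ⟨_, M, a, _, c, _⟩ <;> exact ⟨M, a, c⟩
  have hQ : ∑ j ∈ T, C (b j) * (P j).map (Nat.castRingHom (ZMod 89)) = 0 := by
    by_contra hne
    have e : AdjoinRoot.mk gK (∑ j ∈ T, C (b j) * (P j).map (Nat.castRingHom (ZMod 89))) = 0 := by
      rw [← h0, map_sum]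
      apply Finset.sum_congr rfl
      intro j hj
      rw [map_mul, ← eval_mk, hP2 j hj, AdjoinRoot.mk_C]; rfl
    rw [AdjoinRoot.mk_eq_zero] at e
    have h1 := natDegree_le_of_dvd e hne
    have h2 : (∑ j ∈ T, C (b j) * (P j).map (Nat.castRingHom (ZMod 89))).natDegree ≤ 43 := by
      apply natDegree_sum_le_of_forall_le
      intro j hj
      exact (natDegree_C_mul_le _ _).trans ((natDegree_map_le).trans (hP4 j hj))
    rw [gK_natDegree] at h1
    omega
  have hQ2 := congrArg (fun Q => (Q * M.map (Nat.castRingHom (ZMod 89))).coeff 43) hQ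
  simp only [zero_mul, coeff_zero, Finset.sum_mul, finsetSum_coeff, mul_assoc, coeff_C_mul, ← Polynomial.map_mul,
    coeff_map] at hQ2
  rw [Finset.sum_eq_single k] at hQ2
  · rw [coeff_digit _ _ _ (by norm_num), eval_mul, hP1 k hk, hM1] at hQ2
    · have := hc k hk k hk
      rw [if_pos rfl] at this
      have h1 : ((n k * m k / (2 ^ 64) ^ 43 % 2 ^ 64 : ℕ) : ZMod 89) = 1 := by
        rw [← ZMod.natCast_mod, this]; simp
      rw [eq_natCast, h1, mul_one] at hQ2
      exact hQ2
    · rw [eval_mul]; exact (Nat.mul_le_mul (hP3 k hk) hM3).trans_lt hS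
  · intro j hj hjk
    rw [coeff_digit _ _ _ (by norm_num), eval_mul, hP1 j hj, hM1]
    · have := hc j hj k hk
      rw [if_neg hjk] at this
      have h1 : ((n j * m k / (2 ^ 64) ^ 43 % 2 ^ 64 : ℕ) : ZMod 89) = 0 := by
        rw [← ZMod.natCast_mod, this]; simp
      rw [eq_natCast, h1, mul_zero]
    · rw [eval_mul]; exact (Nat.mul_le_mul (hP3 j hj) hM3).trans_lt hS
  · intro h; exact absurd hk h

end Polynomial.Sept

namespace Sept
open Polynomial.Sept
/-- secondary invariants at a form -/
def sec {R : Type*} [CommRing R] (f : List R) (j : ℕ) : R := ((secL.getD j []).map (gen f)).prod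

theorem sec_hom {R R' : Type*} [CommRing R] [CommRing R'] (φ : R →+* R') (f : List R) (j : ℕ) :
    φ (sec f j) = sec (f.map φ) j := by
  rw [sec, sec, map_list_prod, List.map_map]
  congr 1
  apply List.map_congr_left
  intro i _
  exact gen_hom φ f i

section
variable {A : Type*} [CommRing A]

theorem red44_good (h89 : (89 : A) = 0) {Y : A} (hY : Y ^ 44 = 3) {D S n : ℕ} {z : A} (h : Good Y D S n z) (hD : D ≤ 87)
    (hS : S * 4 < 2 ^ 64) : Good Y 43 3872 (red44 n) z := by
  have hq : Good Y 0 3 3 (Y ^ 44) := by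
    rw [hY]; exact_mod_cast good_nat (Y := Y) 3
  have h1 := (h.mono hD le_rfl).fold (by omega) 44 hq (E := 43) (by norm_num) (by norm_num)
  have e : fold44 n = n % (2 ^ 64) ^ 44 + n / (2 ^ 64) ^ 44 * 3 := by
    rw [fold44, frc1_eq, BB_eq]; rfl
  rw [← e] at h1
  rw [red44, frc1_eq]
  exact h1.rdig h89 43 (by omega)

theorem sec_good (h89 : (89 : A) = 0) {Y : A} (hY : Y ^ 44 = 3) {G : List ℕ} {f : List A}
    (hG : ∀ i, Good Y 87 Sd (G.getD i 0) (gen f i)) : ∀ l : List ℕ,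
    Good Y 43 3872 (l.foldr (fun i acc => red44 (Nat.mul (red44 (G.getD i 0)) acc)) 1) (l.map (gen f)).prod
  | [] => by
    have := (good_nat (Y := Y) 1).mono (Nat.zero_le 43) (show 1 ≤ 3872 by norm_num)
    simpa using this
  | i :: l => by
    have h1 := red44_good h89 hY (hG i) le_rfl (by norm_num [Sd])
    have h2 := h1.mul (sec_good h89 hY hG l)
    rw [List.foldr_cons, List.map_cons, List.prod_cons]
    exact red44_good h89 hY h2 (by norm_num) (by norm_num)
end

theorem chk0 : finK 0 (runS dotN 0 ops [formN 0]) = true := by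
  have := run0; rw [runK_eq, Bool.and_eq_true] at this; exact this.1
theorem chkfin : fin0 (runS dotN 0 ops [formN 0]) = true := by
  have := run0; rw [runK_eq, Bool.and_eq_true] at this; exact this.2
theorem chkK (k : ℕ) (hk : k < 5) : finK k (runS dotN 0 ops [formN k]) = true := by
  have h1 := run1
  have h2 := run2
  have h3 := run3
  have h4 := run4
  rw [runK_eq] at h1 h2 h3 h4
  interval_cases k
  exacts [chk0, h1, h2, h3, h4]

def GenL : List ℕ := (List.range 30).map fun i => genN 0 i

theorem chkS_GL : chkS (secN GenL) (muD.map (pk 44)) = true := by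
  have h := chkfin
  rw [fin0, frcN_eq, frcN_eq, frcN_eq] at h
  exact h

theorem secN_getD (j : ℕ) (hj : j < 88) : (secN GenL).getD j 0 =
    (secL.getD j []).foldr (fun i acc => red44 (Nat.mul (red44 (GenL.getD i 0)) acc)) 1 := by
  have hl : j < secL.length := by have : secL.length = 88 := by decide
                                  omega
  rw [secN, List.getD_eq_getElem _ _ (by simpa using hl), List.getElem_map, List.getD_eq_getElem _ _ hl]

theorem secL_lt : ∀ l ∈ secL, ∀ i ∈ l, i < 30 := by decide +kernel

theorem chk_pair (j k : ℕ) (hj : j < 88) (hk : k < 88) (h : edeg j % 4 = edeg k % 4) :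
    (secN GenL).getD j 0 * (muD.map (pk 44)).getD k 0 / (2 ^ 64) ^ 43 % 2 ^ 64 % 89 = if j = k then 1 else 0 := by
  have hc := chkS_GL
  rw [chkS, List.all_eq_true] at hc
  have h1 := hc _ (List.mem_map_of_mem (List.mem_range.2 hj))
  rw [List.all_eq_true] at h1
  have h2 := h1 _ (List.mem_map_of_mem (List.mem_range.2 hk))
  have e : Nat.beq (edeg j % 4) (edeg k % 4) = true := by rw [h]; exact Nat.beq_refl _
  simp only [e, Bool.not_true, Bool.false_or] at h2
  have h3 := Nat.eq_of_beq_eq_true h2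
  have e2 : (if Nat.beq j k = true then 1 else 0) = if j = k then 1 else 0 := by
    by_cases hh : j = k
    · subst hh; simp
    · rw [if_neg hh, if_neg]; exact fun h => hh (Nat.eq_of_beq_eq_true h)
  rw [e2, BB_eq] at h3
  exact h3

section
variable {A : Type*} [CommRing A]

theorem Y44 (h89 : (89 : A) = 0) {y e : A} (hy : y ^ 44 = 3) (he : e * e = 0) : (y * (1 + 29 * e)) ^ 44 = 3 + e := by
  have h : ∀ n : ℕ, (1 + 29 * e) ^ n = 1 + n * (29 * e) := by
    intro n
    induction n with
    | zero => simp
    | succ n ih => rw [pow_succ, ih]; push_cast; linear_combination (n * 841 : A) * he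
  rw [mul_pow, hy, h]
  push_cast
  linear_combination (43 * e) * h89

theorem th_val (h89 : (89 : A) = 0) {y e : A} (hy : y ^ 44 = 3) (he : e * e = 0) (j k : ℕ) (hj : j < 5) (hk : k < 5) : gen (formA (y * (1 + 29 * e)) e k) (thL.getD j 0) =
    ((cL.getD j 0 : ℕ) : A) + if j = k then e else 0 := by
  have e1 := Y44 h89 hy he
  have e2 : (y * (1 + 29 * e)) ^ 44 + 86 = e := by rw [e1]; linear_combination h89
  have e3 : (y * (1 + 29 * e)) ^ 88 = 6 * (y * (1 + 29 * e)) ^ 44 + 80 := by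
    rw [show 88 = 44 * 2 by norm_num, pow_mul, e1]; linear_combination he - h89
  have h := genN_good h89 e3 e2 k (thL.getD j 0)
  have hc := chkK k hk
  rw [finK, List.all_eq_true] at hc
  have h1 : genN k (thL.getD j 0) = _ := Nat.eq_of_beq_eq_true (hc j (List.mem_range.2 hj))
  rw [h1, BB_eq] at h
  have hb : ∀ j < 5, cL.getD j 0 < 89 := by decide
  have hbj := hb j hj
  by_cases hjk : j = k
  · rw [if_pos hjk] at h ⊢
    obtain ⟨z0, z1, ez, g0, g1⟩ := h.split (by norm_num [Sd]) 44
    have hm : (cL.getD j 0 + 86) % 89 < (2 ^ 64) ^ 44 := lt_of_lt_of_le (Nat.mod_lt _ (by norm_num)) (by norm_num)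
    have hm' : (cL.getD j 0 + 86) % 89 < 2 ^ 64 := lt_of_lt_of_le (Nat.mod_lt _ (by norm_num)) (by norm_num)
    have f1 : Nat.add ((cL.getD j 0 + 86) % 89) (Nat.pow (2 ^ 64) 44) = (cL.getD j 0 + 86) % 89 + (2 ^ 64) ^ 44 * 1 := by
      rw [mul_one]; rfl
    rw [f1, Nat.add_mul_mod_self_left, Nat.mod_eq_of_lt hm] at g0
    rw [f1, Nat.add_mul_div_left _ _ (by positivity), Nat.div_eq_of_lt hm] at g1
    rw [ez, g0.small (by norm_num [Sd]) hm', g1.small (by norm_num [Sd]) (by norm_num), e1]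
    have hcast : (((cL.getD j 0 + 86) % 89 : ℕ) : A) = ((cL.getD j 0 + 86 : ℕ) : A) := by
      conv_rhs => rw [← Nat.mod_add_div (cL.getD j 0 + 86) 89]
      push_cast; rw [h89]; simp
    rw [hcast]; push_cast
    linear_combination h89
  · rw [if_neg hjk] at h ⊢
    rw [h.small (by norm_num [Sd]) (by omega), add_zero]
end

/-- the base form -/
noncomputable def aK : List KK := formA yK 0 0

theorem aK_good (i : ℕ) : Good yK 87 Sd (genN 0 i) (gen aK i) := by
  have hy := yK_pow
  have e2 : yK ^ 44 + 86 = 0 := by rw [hy]; linear_combination h89K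
  exact genN_good h89K (by rw [show 88 = 44 * 2 by norm_num, pow_mul, hy]; linear_combination (-1 : KK) * h89K) e2 0 i

theorem sec_indep (T : Finset ℕ) (r : ℕ) (hT : ∀ j ∈ T, j < 88 ∧ edeg j % 4 = r) (b : ℕ → ZMod 89)
    (h0 : ∑ j ∈ T, algebraMap (ZMod 89) KK (b j) * sec aK j = 0) : ∀ j ∈ T, b j = 0 := by
  refine indep (n := fun j => (secN GenL).getD j 0) (m := fun j => (muD.map (pk 44)).getD j 0) (z := sec aK) (S := 3872) (S' := 4356)
    ?_ ?_ (by norm_num) ?_ b h0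
  · intro j hj
    simp only [secN_getD j (hT j hj).1]
    have key : ∀ l : List ℕ, (∀ i ∈ l, i < 30) → 
        Good yK 43 3872 (l.foldr (fun i acc => red44 (Nat.mul (red44 (GenL.getD i 0)) acc)) 1) (l.map (gen aK)).prod := by
      intro l
      induction l with
      | nil =>
        intro _
        have := (good_nat (Y := yK) 1).mono (Nat.zero_le 43) (show 1 ≤ 3872 by norm_num)
        simpa using this
      | cons i l ih =>
        intro hl
        have hi := hl i (by simp)
        have hg : GenL.getD i 0 = genN 0 i := by
          rw [GenL, List.getD_eq_getElem _ _ (by simpa using hi)]; simp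
        have h1 := red44_good h89K yK_pow (aK_good i) le_rfl (by norm_num [Sd])
        have h2 := h1.mul (ih (fun i hi => hl i (by simp [hi])))
        rw [List.foldr_cons, List.map_cons, List.prod_cons, hg]
        exact red44_good h89K yK_pow h2 (by norm_num) (by norm_num)
    apply key
    intro i hi
    have hl : j < secL.length := by have : secL.length = 88 := by decide
                                    have := (hT j hj).1
                                    omega
    rw [List.getD_eq_getElem _ _ hl] at hi
    exact secL_lt _ (List.getElem_mem hl) i hi
  · intro j hj
    right
    have hl : j < muD.length := by have : muD.length = 88 := by decide
                                   have := (hT j hj).1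
                                   omega
    rw [List.getD_eq_getElem _ _ (by simpa using hl), List.getElem_map]
    exact ⟨_, good_pk yK 43 _⟩
  · intro j hj k hk
    exact chk_pair j k (hT j hj).1 (hT k hk).1 ((hT j hj).2.trans (hT k hk).2.symm)

end Sept


namespace Sept
open Polynomial.Sept

abbrev SK := MvPolynomial (Fin 5) KK
abbrev AK := DualNumber KK

noncomputable def eA : AK := DualNumber.eps
noncomputable def iA : KK →+* AK := TrivSqZeroExt.inlHom KK KK
noncomputable def fA : AK →+* KK := (TrivSqZeroExt.fstHom KK KK KK).toRingHom

theorem eA_sq : eA * eA = 0 := DualNumber.eps_mul_eps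
theorem fA_iA (a : KK) : fA (iA a) = a := rfl
theorem fA_eA : fA eA = 0 := rfl
theorem A_dec (z : AK) : z = iA (fA z) + iA (TrivSqZeroExt.snd z) * eA := by
  apply TrivSqZeroExt.ext <;> simp [iA, fA, eA]
theorem snd_dec (a b : KK) : TrivSqZeroExt.snd (iA a + iA b * eA) = b := by simp [iA, eA]
theorem fst_dec (a b : KK) : fA (iA a + iA b * eA) = a := by simp [iA, eA, fA]

noncomputable def YA : AK := iA yK * (1 + 29 * eA)

theorem h89A : (89 : AK) = 0 := by
  have := congrArg iA h89K
  rwa [map_ofNat, map_zero] at this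

theorem fA_YA : fA YA = yK := by rw [YA, map_mul, map_add, map_mul, fA_eA]; simp [fA_iA]

theorem hyA : (iA yK) ^ 44 = 3 := by rw [← map_pow, yK_pow, map_ofNat]

noncomputable def aF (i : ℕ) : KK := vl yK 44 (fD.getD i 0)
noncomputable def zF (k i : ℕ) : AK := vl YA 44 (fD.getD i 0) + eA * vl YA 44 ((QD.getD k []).getD i 0)
noncomputable def Vm (k i : ℕ) : KK := TrivSqZeroExt.snd (zF k i)

theorem zF_dec (k i : ℕ) : zF k i = iA (aF i) + iA (Vm k i) * eA := by
  have : fA (zF k i) = aF i := by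
    rw [zF, map_add, map_mul, fA_eA, vl_hom, fA_YA, zero_mul, add_zero, aF]
  rw [← this]; exact A_dec _

theorem aK_eq : aK = (List.range 8).map aF := by
  simp only [aK, formA, zero_mul, add_zero]; rfl

noncomputable def Lam (i : ℕ) : SK := C (aF i) + ∑ k : Fin 5, C (Vm k i) * X k
noncomputable def LamL : List SK := (List.range 8).map Lam

noncomputable def piK (k : Fin 5) : SK →+* AK := eval₂Hom iA (fun i => if i = k then eA else 0)

theorem piK_X (k i : Fin 5) : piK k (X i) = if i = k then eA else 0 := by simp [piK]
theorem piK_C (k : Fin 5) (a : KK) : piK k (C a) = iA a := by simp [piK]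

theorem piK_lin (k : Fin 5) (a : KK) (b : Fin 5 → KK) :
    piK k (C a + ∑ i, C (b i) * X i) = iA a + iA (b k) * eA := by
  rw [map_add, map_sum, piK_C]
  simp only [map_mul, piK_C, piK_X, mul_ite, mul_zero]
  rw [Finset.sum_ite_eq' Finset.univ k]; simp

theorem LamL_pi (k : Fin 5) : LamL.map (piK k) = formA YA eA k := by
  rw [LamL, formA, List.map_map]
  apply List.map_congr_left
  intro i _
  simp only [Function.comp_apply]
  rw [Lam, piK_lin k (aF i) (fun k => Vm k i), ← zF_dec]; rfl

theorem LamL_const : LamL.map (constantCoeff (σ := Fin 5) (R := KK)) = aK := by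
  rw [LamL, aK_eq, List.map_map]
  apply List.map_congr_left
  intro i _
  simp [Lam]

local notation "II" => idealOfVars (Fin 5) KK

theorem piK_sq (k : Fin 5) {E : SK} (h : E ∈ II ^ 2) : piK k E = 0 := by
  have h1 : Ideal.map (piK k) II ≤ Ideal.span {eA} := by
    rw [Ideal.map_le_iff_le_comap, idealOfVars, Ideal.span_le]
    rintro _ ⟨i, rfl⟩
    rw [SetLike.mem_coe, Ideal.mem_comap, piK_X]
    split_ifs
    · exact Ideal.mem_span_singleton_self _
    · exact zero_mem _
  have h2 := Ideal.mem_map_of_mem (piK k) h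
  rw [Ideal.map_pow] at h2
  have h3 := Ideal.pow_right_mono h1 2 h2
  rw [Ideal.span_singleton_pow, pow_two, eA_sq] at h3
  simpa using h3

theorem lin_dec (P : SK) : P - (C (coeff 0 P) + ∑ i, C (coeff (Finsupp.single i 1) P) * X i) ∈ II ^ 2 := by
  rw [mem_pow_idealOfVars_iff']
  intro x hx
  have hX : ∀ (i : Fin 5) (b : KK), (C b * X i : SK) = monomial (Finsupp.single i 1) b := by
    intro i b; rw [C_mul_X_eq_monomial]
  simp only [coeff_sub, coeff_add, coeff_sum, hX, coeff_C, coeff_monomial]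
  by_cases h0 : x = 0
  · subst h0
    rw [if_pos rfl, Finset.sum_eq_zero]
    · simp
    · intro i _; rw [if_neg]; simp
  · obtain ⟨i, hi⟩ : ∃ i, x i ≠ 0 := by
      by_contra hh; push Not at hh; exact h0 (Finsupp.ext hh)
    have hxi : x = Finsupp.single i 1 := by
      have hd : x.degree = ∑ i, x i := by rw [Finsupp.degree_eq_sum]
      have h1 : ∀ j, j ≠ i → x j = 0 := by
        intro j hj
        have : x i + x j ≤ ∑ i, x i := by
          rw [← Finset.sum_pair hj.symm]
          exact Finset.sum_le_sum_of_subset (Finset.subset_univ _)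
        omega
      have h2 : x i ≤ ∑ i, x i := Finset.single_le_sum (f := fun i => x i) (fun _ _ => Nat.zero_le _) (Finset.mem_univ i)
      ext j
      by_cases hj : j = i
      · subst hj; rw [Finsupp.single_eq_same]; omega
      · rw [h1 j hj, Finsupp.single_eq_of_ne hj]
    subst hxi
    rw [if_neg (fun h => h0 h.symm), Finset.sum_eq_single i]
    · simp
    · intro j _ hj; rw [if_neg]; intro h; exact hj (Finsupp.single_left_injective one_ne_zero h)
    · simp

theorem dec_of_pi (P : SK) (a : KK) (b : Fin 5 → KK) (h : ∀ k, piK k P = iA a + iA (b k) * eA) :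
    P - (C a + ∑ i, C (b i) * X i) ∈ II ^ 2 := by
  have h1 := lin_dec P
  have h2 : ∀ k, iA a + iA (b k) * eA = iA (coeff 0 P) + iA (coeff (Finsupp.single k 1) P) * eA := by
    intro k
    have := piK_sq k h1
    rw [map_sub, sub_eq_zero, piK_lin k _ (fun i => coeff (Finsupp.single i 1) P)] at this
    rw [← h, this]
  have ha : a = coeff 0 P := by
    have := congrArg fA (h2 0); rwa [fst_dec, fst_dec] at this
  have hb : ∀ k, b k = coeff (Finsupp.single k 1) P := by
    intro k
    have := congrArg TrivSqZeroExt.snd (h2 k); rwa [snd_dec, snd_dec] at this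
  rw [ha]; simp only [hb]; exact h1

noncomputable def Zt (j : Fin 5) : SK := gen LamL (thL.getD j 0) - C ((cL.getD j 0 : ℕ) : KK)

theorem Zt_dec (j : Fin 5) : Zt j - X j ∈ II ^ 2 := by
  have h := dec_of_pi (gen LamL (thL.getD j 0)) ((cL.getD j 0 : ℕ) : KK) (fun k => if j = k then 1 else 0) (by
    intro k
    rw [gen_hom, LamL_pi]
    have := th_val h89A hyA eA_sq j k j.2 k.2
    rw [YA, this, map_natCast]
    simp only [Fin.val_inj]
    split_ifs <;> simp)
  have e : (∑ i, C (if j = i then (1 : KK) else 0) * X i : SK) = X j := by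
    rw [Finset.sum_eq_single j] <;> simp +contextual [eq_comm]
  rw [e] at h
  rw [Zt]
  convert h using 1
  ring

/-- leading term relation -/
def LT (d : ℕ) (u v : SK) : Prop := v ∈ II ^ d ∧ u - v ∈ II ^ (d + 1)

theorem LT.mul {d d' : ℕ} {u v u' v' : SK} (h : LT d u v) (h' : LT d' u' v') : LT (d + d') (u * u') (v * v') := by
  obtain ⟨h1, h2⟩ := h
  obtain ⟨h1', h2'⟩ := h'
  refine ⟨by rw [pow_add]; exact Ideal.mul_mem_mul h1 h1', ?_⟩
  have e : u * u' - v * v' = (u - v) * (u' - v') + (u - v) * v' + v * (u' - v') := by ring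
  rw [e]
  have a1 : (u - v) * (u' - v') ∈ II ^ (d + d' + 1) := by
    have := Ideal.mul_mem_mul h2 h2'
    rw [← pow_add] at this
    exact Ideal.pow_le_pow_right (by omega) this
  have a2 : (u - v) * v' ∈ II ^ (d + d' + 1) := by
    have := Ideal.mul_mem_mul h2 h1'
    rw [← pow_add] at this
    exact Ideal.pow_le_pow_right (by omega) this
  have a3 : v * (u' - v') ∈ II ^ (d + d' + 1) := by
    have := Ideal.mul_mem_mul h1 h2'
    rw [← pow_add] at this
    exact Ideal.pow_le_pow_right (by omega) this
  exact add_mem (add_mem a1 a2) a3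

theorem LT_one : LT 0 1 1 := ⟨by simp, by simp⟩

theorem LT.pow {d : ℕ} {u v : SK} (h : LT d u v) : ∀ n, LT (n * d) (u ^ n) (v ^ n)
  | 0 => by simpa using LT_one
  | n + 1 => by
    have := (LT.pow h n).mul h
    rwa [pow_succ, pow_succ, Nat.succ_mul]

theorem LT_prod (s : Finset (Fin 5)) (d : Fin 5 → ℕ) (u v : Fin 5 → SK) (h : ∀ i, LT (d i) (u i) (v i)) :
    LT (∑ i ∈ s, d i) (∏ i ∈ s, u i) (∏ i ∈ s, v i) := by
  classical
  induction s using Finset.induction_on with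
  | empty => simpa using LT_one
  | insert a s ha ih =>
    rw [Finset.sum_insert ha, Finset.prod_insert ha, Finset.prod_insert ha]
    exact (h a).mul ih

theorem LT_sec (j : ℕ) : LT 0 (sec LamL j) (C (sec aK j)) := by
  refine ⟨by simp, ?_⟩
  rw [zero_add, mem_pow_idealOfVars_iff']
  intro x hx
  obtain rfl : x = 0 := by
    rw [← Finsupp.degree_eq_zero_iff]; omega
  rw [coeff_sub, coeff_C, if_pos rfl, ← constantCoeff_eq, sec_hom, LamL_const, sub_self]

theorem coeff_lead (j : ℕ) (β γ : Fin 5 →₀ ℕ) (h : β.degree ≤ γ.degree) :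
    coeff β ((∏ i, Zt i ^ γ i) * sec LamL j) = if γ = β then sec aK j else 0 := by
  have h1 : LT γ.degree ((∏ i, Zt i ^ γ i) * sec LamL j) ((∏ i, X i ^ γ i) * C (sec aK j)) := by
    have hx : ∀ i : Fin 5, LT (γ i) (Zt i ^ γ i) (X i ^ γ i) := by
      intro i
      have : LT 1 (Zt i) (X i) := ⟨by rw [pow_one]; exact Ideal.subset_span ⟨i, rfl⟩, Zt_dec i⟩
      simpa using this.pow (γ i)
    have := (LT_prod Finset.univ _ _ _ hx).mul (LT_sec j)
    rwa [add_zero, ← Finsupp.degree_eq_sum] at this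
  have h2 := (mem_pow_idealOfVars_iff' _ _).1 h1.2 β (by omega)
  rw [coeff_sub, sub_eq_zero] at h2
  have e : (∏ i, X i ^ γ i : SK) = monomial γ 1 := by
    rw [← Finsupp.prod_fintype γ (fun i e => (X i : SK) ^ e) (by simp)]
    rw [monomial_eq]; simp
  rw [h2, e, mul_comm, C_mul_monomial, coeff_monomial, mul_one]

end Sept


namespace Sept
open Polynomial.Sept

noncomputable def kC : ZMod 89 →+* SK := (C : KK →+* SK).comp (algebraMap (ZMod 89) KK)

theorem freeZ (T : Finset ℕ) (r : ℕ) (hT : ∀ j ∈ T, j < 88 ∧ edeg j % 4 = r)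
    (Q : ℕ → MvPolynomial (Fin 5) (ZMod 89))
    (h : ∑ j ∈ T, eval₂ kC Zt (Q j) * sec LamL j = 0) : ∀ j ∈ T, Q j = 0 := by
  have key : ∀ m, ∀ β : Fin 5 →₀ ℕ, β.degree = m → ∀ j ∈ T, coeff β (Q j) = 0 := by
    intro m
    induction m using Nat.strong_induction_on with
    | _ m ih =>
      intro β hβ
      apply sec_indep T r hT (fun j => coeff β (Q j))
      have h2 := congrArg (coeff β) h
      rw [coeff_sum, coeff_zero] at h2
      rw [← h2]
      apply Finset.sum_congr rfl
      intro j hj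
      rw [eval₂_eq', Finset.sum_mul, coeff_sum]
      have e : ∀ γ ∈ (Q j).support, coeff β (kC (coeff γ (Q j)) * (∏ i, Zt i ^ γ i) * sec LamL j)
          = if γ = β then algebraMap (ZMod 89) KK (coeff γ (Q j)) * sec aK j else 0 := by
        intro γ hγ
        rw [mul_assoc, kC, RingHom.comp_apply, coeff_C_mul, coeff_lead, mul_ite, mul_zero]
        by_contra hlt
        push Not at hlt
        exact (mem_support_iff.mp hγ) (ih γ.degree (by omega) γ rfl j hj)
      rw [Finset.sum_congr rfl e, Finset.sum_ite_eq']
      split_ifs with hs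
      · rfl
      · rw [notMem_support_iff.mp hs, map_zero, zero_mul]
  intro j hj
  ext β
  rw [coeff_zero]
  exact key _ β rfl j hj

noncomputable def shP (s : Fin 5 → ZMod 89) : MvPolynomial (Fin 5) (ZMod 89) →ₐ[ZMod 89] MvPolynomial (Fin 5) (ZMod 89) :=
  aeval (fun i => X i + C (s i))

theorem shP_inv (s : Fin 5 → ZMod 89) (Q) : shP (fun i => - s i) (shP s Q) = Q := by
  have : (shP (fun i => - s i)).comp (shP s) = AlgHom.id _ _ := by
    apply MvPolynomial.algHom_ext
    intro i
    simp [shP, algHom_C, MvPolynomial.algebraMap_eq]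
  exact DFunLike.congr_fun this Q

noncomputable def cZ (i : Fin 5) : ZMod 89 := ((cL.getD i 0 : ℕ) : ZMod 89)

theorem ev_sh (Q : MvPolynomial (Fin 5) (ZMod 89)) :
    eval₂ kC Zt (shP cZ Q) = eval₂ kC (fun i : Fin 5 => gen LamL (thL.getD i 0)) Q := by
  have : (eval₂Hom kC Zt).comp (shP cZ).toRingHom = eval₂Hom kC (fun i : Fin 5 => gen LamL (thL.getD i 0)) := by
    apply MvPolynomial.ringHom_ext
    · intro a
      simp [shP, MvPolynomial.algebraMap_eq]
    · intro i
      change eval₂ kC Zt (shP cZ (X i)) = eval₂ kC _ (X i)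
      rw [shP, aeval_X, eval₂_add, eval₂_X, eval₂_X, eval₂_C]
      simp only [Zt, kC, cZ, RingHom.comp_apply, map_natCast, sub_add_cancel]
  exact DFunLike.congr_fun this Q

theorem freeTh (T : Finset ℕ) (r : ℕ) (hT : ∀ j ∈ T, j < 88 ∧ edeg j % 4 = r)
    (Q : ℕ → MvPolynomial (Fin 5) (ZMod 89))
    (h : ∑ j ∈ T, eval₂ kC (fun i : Fin 5 => gen LamL (thL.getD i 0)) (Q j) * sec LamL j = 0) : ∀ j ∈ T, Q j = 0 := by
  intro j hj
  have := freeZ T r hT (fun j => shP cZ (Q j)) (by simpa only [ev_sh] using h) j hj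
  rw [← shP_inv cZ (Q j), this, map_zero]

/-- the basic family -/
noncomputable def fam {R : Type*} [CommRing R] (f : List R) (τ : ℕ × (Fin 5 →₀ ℕ)) : R :=
  (∏ i : Fin 5, gen f (thL.getD i 0) ^ τ.2 i) * sec f τ.1

theorem fam_hom {R R' : Type*} [CommRing R] [CommRing R'] (φ : R →+* R') (f : List R) (τ) :
    φ (fam f τ) = fam (f.map φ) τ := by
  rw [fam, map_mul, map_prod, sec_hom, fam]
  simp only [map_pow, gen_hom]

theorem fam_free_Lam (T : Finset (ℕ × (Fin 5 →₀ ℕ))) (r : ℕ) (hT : ∀ τ ∈ T, τ.1 < 88 ∧ edeg τ.1 % 4 = r)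
    (b : ℕ × (Fin 5 →₀ ℕ) → ZMod 89) (h : ∑ τ ∈ T, kC (b τ) * fam LamL τ = 0) : ∀ τ ∈ T, b τ = 0 := by
  classical
  let Q : ℕ → MvPolynomial (Fin 5) (ZMod 89) := fun j => ∑ τ ∈ T with τ.1 = j, monomial τ.2 (b τ)
  have h1 : ∑ j ∈ T.image Prod.fst, eval₂ kC (fun i : Fin 5 => gen LamL (thL.getD i 0)) (Q j) * sec LamL j = 0 := by
    rw [← h, ← Finset.sum_fiberwise_of_maps_to (g := Prod.fst) (t := T.image Prod.fst)
      (fun τ hτ => Finset.mem_image_of_mem _ hτ)]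
    apply Finset.sum_congr rfl
    intro j _
    simp only [Q]
    rw [eval₂_sum, Finset.sum_mul]
    apply Finset.sum_congr rfl
    intro τ hτ
    rw [eval₂_monomial, fam, Finsupp.prod_fintype _ _ (by simp), (Finset.mem_filter.mp hτ).2, mul_assoc]
  have h2 := freeTh _ r (by
    intro j hj
    obtain ⟨τ, hτ, rfl⟩ := Finset.mem_image.mp hj
    exact hT τ hτ) Q h1
  intro τ hτ
  have h3 := congrArg (coeff τ.2) (h2 τ.1 (Finset.mem_image_of_mem _ hτ))
  simp only [Q] at h3
  rw [coeff_sum, coeff_zero, Finset.sum_eq_single τ] at h3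
  · simpa using h3
  · intro σ hσ hne
    rw [coeff_monomial, if_neg]
    intro he
    exact hne (Prod.ext (Finset.mem_filter.mp hσ).2 he)
  · intro hn
    exact absurd (Finset.mem_filter.mpr (⟨hτ, rfl⟩ : τ ∈ T ∧ τ.1 = τ.1)) hn

def nuL : Fin 8 → ℕ := ![1, 51, 17, 28, 28, 17, 51, 1]

noncomputable def PhiL : MvPolynomial (Fin 8) (ZMod 89) →+* SK :=
  eval₂Hom kC (fun i => (nuL i : SK) * Lam i)

theorem h89S : (89 : SK) = 0 := by
  have := congrArg (C : KK → SK) h89K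
  rwa [map_ofNat, map_zero] at this

theorem PhiL_fX : (fX (ZMod 89)).map PhiL = LamL := by
  have hX : ∀ i : Fin 8, PhiL (X i) = (nuL i : SK) * Lam i := by intro i; simp [PhiL]
  have h : LamL = [Lam 0, Lam 1, Lam 2, Lam 3, Lam 4, Lam 5, Lam 6, Lam 7] := by
    rw [LamL]; rfl
  rw [h, fX]
  simp only [List.map_cons, List.map_nil, map_mul, map_ofNat, hX]
  have e := h89S
  have n0 : ((nuL 0 : ℕ) : SK) = 1 := by simp [nuL]
  have n1 : ((nuL 1 : ℕ) : SK) = 51 := by simp [nuL]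
  have n2 : ((nuL 2 : ℕ) : SK) = 17 := by simp [nuL]
  have n3 : ((nuL 3 : ℕ) : SK) = 28 := by simp [nuL]
  have n4 : ((nuL 4 : ℕ) : SK) = 28 := by simp [nuL]
  have n5 : ((nuL 5 : ℕ) : SK) = 17 := by simp [nuL]
  have n6 : ((nuL 6 : ℕ) : SK) = 51 := by simp [nuL]
  have n7 : ((nuL 7 : ℕ) : SK) = 1 := by simp [nuL]
  rw [n0, n1, n2, n3, n4, n5, n6, n7]
  have a1 : ∀ L : SK, 7 * (51 * L) = L := fun L => by linear_combination 4 * L * e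
  have a2 : ∀ L : SK, 21 * (17 * L) = L := fun L => by linear_combination 4 * L * e
  have a3 : ∀ L : SK, 35 * (28 * L) = L := fun L => by linear_combination 11 * L * e
  simp only [a1, a2, a3, one_mul]
  rfl

theorem fX_map {R R' : Type*} [CommRing R] [CommRing R'] (φ : R →+* R') :
    (fX R).map (MvPolynomial.map φ) = fX R' := by
  simp [fX]

theorem fam_free_F (T : Finset (ℕ × (Fin 5 →₀ ℕ))) (r : ℕ) (hT : ∀ τ ∈ T, τ.1 < 88 ∧ edeg τ.1 % 4 = r)
    (b : ℕ × (Fin 5 →₀ ℕ) → ZMod 89) (h : ∑ τ ∈ T, C (b τ) * fam (fX (ZMod 89)) τ = 0) : ∀ τ ∈ T, b τ = 0 := by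
  apply fam_free_Lam T r hT b
  have := congrArg PhiL h
  rw [map_sum, map_zero] at this
  rw [← this]
  apply Finset.sum_congr rfl
  intro τ _
  rw [map_mul, fam_hom, PhiL_fX]
  simp [PhiL]

theorem fam_free_Z (T : Finset (ℕ × (Fin 5 →₀ ℕ))) (r : ℕ) (hT : ∀ τ ∈ T, τ.1 < 88 ∧ edeg τ.1 % 4 = r)
    (b : ℕ × (Fin 5 →₀ ℕ) → ℤ) (h : ∑ τ ∈ T, C (b τ) * fam (fX ℤ) τ = 0) : ∀ τ ∈ T, b τ = 0 := by
  have dv : ∀ b : ℕ × (Fin 5 →₀ ℕ) → ℤ, ∑ τ ∈ T, C (b τ) * fam (fX ℤ) τ = 0 → ∀ τ ∈ T, (89 : ℤ) ∣ b τ := by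
    intro b h τ hτ
    have h2 := congrArg (MvPolynomial.map (Int.castRingHom (ZMod 89))) h
    rw [map_sum, map_zero] at h2
    have := fam_free_F T r hT (fun τ => (b τ : ZMod 89)) (by
      rw [← h2]
      apply Finset.sum_congr rfl
      intro τ _
      rw [map_mul, fam_hom, fX_map, map_C]; rfl) τ hτ
    exact (ZMod.intCast_zmod_eq_zero_iff_dvd (b τ) 89).mp this
  have key : ∀ n : ℕ, ∀ b : ℕ × (Fin 5 →₀ ℕ) → ℤ, ∑ τ ∈ T, C (b τ) * fam (fX ℤ) τ = 0 →
      ∀ τ ∈ T, (89 : ℤ) ^ n ∣ b τ := by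
    intro n
    induction n with
    | zero => intro b _ τ _; simp
    | succ n ih =>
      intro b h τ hτ
      have h1 := dv b h
      have h2 := ih (fun τ => b τ / 89) (by
        have h3 : (C (89 : ℤ) : MvPolynomial (Fin 8) ℤ) * ∑ τ ∈ T, C (b τ / 89) * fam (fX ℤ) τ = 0 := by
          rw [← h, Finset.mul_sum]
          apply Finset.sum_congr rfl
          intro σ hσ
          rw [← mul_assoc, ← C_mul, Int.mul_ediv_cancel' (h1 σ hσ)]
        rcases mul_eq_zero.mp h3 with h4 | h4
        · rw [C_eq_zero] at h4; norm_num at h4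
        · exact h4) τ hτ
      rw [← Int.mul_ediv_cancel' (h1 τ hτ), pow_succ, mul_comm]
      exact mul_dvd_mul_left _ h2
  intro τ hτ
  by_contra hne
  have h1 := Int.le_of_dvd (abs_pos.mpr hne) ((dvd_abs _ _).mpr (key (b τ).natAbs b h τ hτ))
  have h2 : (b τ).natAbs < 89 ^ (b τ).natAbs := Nat.lt_pow_self (by norm_num)
  have h3 : ((b τ).natAbs : ℤ) < 89 ^ (b τ).natAbs := by exact_mod_cast h2
  rw [Int.natCast_natAbs] at h3
  omega

theorem lift_indep {ι : Type*} (T : Finset ι) (u : ι → MvPolynomial (Fin 8) ℤ)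
    (hu : ∀ b : ι → ℤ, ∑ τ ∈ T, C (b τ) * u τ = 0 → ∀ τ ∈ T, b τ = 0)
    (c : ι → ℂ) (h : ∑ τ ∈ T, c τ • MvPolynomial.map (Int.castRingHom ℂ) (u τ) = 0) : ∀ τ ∈ T, c τ = 0 := by
  have h1 : ∀ m, ∑ τ ∈ T, c τ * ((coeff m (u τ) : ℤ) : ℂ) = 0 := by
    intro m
    have := congrArg (coeff m) h
    rw [coeff_sum, coeff_zero] at this
    simpa [coeff_smul, coeff_map] using this
  let B := Module.Basis.ofVectorSpace ℚ ℂ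
  have h2 : ∀ k, ∀ τ ∈ T, B.repr (c τ) k = 0 := by
    intro k
    let φ : ℂ →ₗ[ℚ] ℚ := B.coord k
    have h3 : ∀ m, ∑ τ ∈ T, φ (c τ) * ((coeff m (u τ) : ℤ) : ℚ) = 0 := by
      intro m
      have := congrArg φ (h1 m)
      rw [map_sum, map_zero] at this
      rw [← this]
      apply Finset.sum_congr rfl
      intro τ _
      have : c τ * ((coeff m (u τ) : ℤ) : ℂ) = ((coeff m (u τ) : ℤ) : ℚ) • c τ := by
        rw [Algebra.smul_def, mul_comm]; simp
      rw [this, map_smul, smul_eq_mul, mul_comm]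
    obtain ⟨d, hd⟩ := IsLocalization.exist_integer_multiples_of_finset (nonZeroDivisors ℤ) (T.image fun τ => φ (c τ))
    have hd' : ∀ τ ∈ T, ∃ n : ℤ, (n : ℚ) = ((d : ℤ) : ℚ) * φ (c τ) := by
      intro τ hτ
      obtain ⟨n, hn⟩ := hd (φ (c τ)) (Finset.mem_image_of_mem _ hτ)
      refine ⟨n, ?_⟩
      rw [← eq_intCast (algebraMap ℤ ℚ), hn, Algebra.smul_def]; simp
    have hd0 : ((d : ℤ) : ℚ) ≠ 0 := by
      exact_mod_cast nonZeroDivisors.coe_ne_zero d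
    choose! n hn using hd'
    have h4 := hu n (by
      ext m
      rw [coeff_sum, coeff_zero]
      simp only [coeff_C_mul]
      have : ((∑ τ ∈ T, n τ * coeff m (u τ) : ℤ) : ℚ) = 0 := by
        push_cast
        have e : ∀ τ ∈ T, (n τ : ℚ) * (coeff m (u τ) : ℤ) = (d : ℤ) * (φ (c τ) * (coeff m (u τ) : ℤ)) := by
          intro τ hτ; rw [hn τ hτ, mul_assoc]
        rw [Finset.sum_congr rfl e, ← Finset.mul_sum, h3, mul_zero]
      exact_mod_cast this)
    intro τ hτ
    have h5 := hn τ hτ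
    rw [h4 τ hτ, Int.cast_zero] at h5
    rcases mul_eq_zero.mp h5.symm with h6 | h6
    · exact absurd h6 hd0
    · exact h6
  intro τ hτ
  apply B.repr.injective
  ext k
  rw [h2 k τ hτ]; simp

theorem fam_free (T : Finset (ℕ × (Fin 5 →₀ ℕ))) (r : ℕ) (hT : ∀ τ ∈ T, τ.1 < 88 ∧ edeg τ.1 % 4 = r)
    (c : ℕ × (Fin 5 →₀ ℕ) → ℂ) (h : ∑ τ ∈ T, c τ • fam (fX ℂ) τ = 0) : ∀ τ ∈ T, c τ = 0 := by
  apply lift_indep T (fam (fX ℤ)) (fam_free_Z T r hT) c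
  rw [← h]
  apply Finset.sum_congr rfl
  intro τ _
  rw [fam_hom, fX_map]

end Sept


namespace Sept
open Polynomial.Sept

theorem w1 (m : Fin 8 →₀ ℕ) : Finsupp.weight (1 : Fin 8 → ℕ) m = ∑ i, m i := by
  rw [← Finsupp.degree_eq_sum]
  exact (DFunLike.congr_fun (Finsupp.degree_eq_weight_one (σ := Fin 8) (R := ℕ)) m).symm

theorem hom_of_NN {d : ℕ} {u : R8} (h : NN u = (d : ℂ) • u) : u.IsHomogeneous d := by
  intro m hm
  have h1 := congrArg (coeff m) h
  rw [NN, coeff_Dg, coeff_smul, smul_eq_mul] at h1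
  have h2 := mul_right_cancel₀ hm h1
  rw [w1]
  simp only [mul_one] at h2
  exact_mod_cast h2

theorem NN_of_hom {d : ℕ} {u : R8} (h : u.IsHomogeneous d) : NN u = (d : ℂ) • u := by
  ext m
  rw [NN, coeff_Dg, coeff_smul, smul_eq_mul]
  by_cases hm : coeff m u = 0
  · rw [hm]; simp
  · have := h hm
    rw [w1] at this
    rw [← this]; simp

theorem hc_D (D : Derivation ℂ R8 R8) (hD : ∀ u, NN (D u) = D (NN u)) (d : ℕ) (u : R8) :
    homogeneousComponent d (D u) = D (homogeneousComponent d u) := by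
  conv_lhs => rw [← sum_homogeneousComponent u, map_sum, map_sum]
  have h : ∀ k, (D (homogeneousComponent k u)).IsHomogeneous k := by
    intro k
    apply hom_of_NN
    rw [hD, NN_of_hom (homogeneousComponent_isHomogeneous k u), Dsmul]
  have e : ∀ k ∈ range (u.totalDegree + 1), homogeneousComponent d (D (homogeneousComponent k u)) =
      if k = d then D (homogeneousComponent d u) else 0 := by
    intro k _
    rw [homogeneousComponent_of_mem ((mem_homogeneousSubmodule _ _).mpr (h k))]
    by_cases hk : k = d
    · subst hk; simp
    · rw [if_neg hk, if_neg (fun h => hk h.symm)]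
  rw [Finset.sum_congr rfl e, Finset.sum_ite_eq']
  split_ifs with hd
  · rfl
  · rw [homogeneousComponent_eq_zero, map_zero]
    simpa using hd

def Iset : Set R8 := {f | D1 f = 0 ∧ D2 f = 0}

theorem hc_mem {u : R8} (h : u ∈ Iset) (d : ℕ) : homogeneousComponent d u ∈ Inv d :=
  ⟨⟨by rw [← hc_D D1 comm_NE, h.1, map_zero], by rw [← hc_D D2 comm_NF, h.2, map_zero]⟩,
    homogeneousComponent_isHomogeneous d u⟩

theorem Inv_mul {a b : ℕ} {u v : R8} (hu : u ∈ Inv a) (hv : v ∈ Inv b) : u * v ∈ Inv (a + b) := by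
  refine ⟨⟨?_, ?_⟩, hu.2.mul hv.2⟩
  · rw [Derivation.leibniz, hu.1.1, hv.1.1]; simp
  · rw [Derivation.leibniz, hu.1.2, hv.1.2]; simp

theorem Inv_one : (1 : R8) ∈ Inv 0 := ⟨⟨by simp, by simp⟩, isHomogeneous_one _ _⟩

theorem Inv_pow {a : ℕ} {u : R8} (hu : u ∈ Inv a) : ∀ n, u ^ n ∈ Inv (a * n)
  | 0 => by simpa using Inv_one
  | n + 1 => by rw [pow_succ, Nat.mul_succ]; exact Inv_mul (Inv_pow hu n) hu

theorem Inv_prod (s : Finset (Fin 5)) (d : Fin 5 → ℕ) (u : Fin 5 → R8) (h : ∀ i, u i ∈ Inv (d i)) :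
    ∏ i ∈ s, u i ∈ Inv (∑ i ∈ s, d i) := by
  classical
  induction s using Finset.induction_on with
  | empty => simpa using Inv_one
  | insert a s ha ih =>
    rw [Finset.sum_insert ha, Finset.prod_insert ha]
    exact Inv_mul (h a) ih

theorem Inv_list : ∀ l : List ℕ, (∀ i ∈ l, i < 30) →
    (l.map (gen (fX ℂ))).prod ∈ Inv (l.map (fun i => degL.getD i 0)).sum
  | [], _ => by simpa using Inv_one
  | a :: l, h => by
    rw [List.map_cons, List.map_cons, List.prod_cons, List.sum_cons]
    exact Inv_mul (gen_mem a (h a (by simp))) (Inv_list l (fun i hi => h i (by simp [hi])))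

theorem secL_lt' (j i : ℕ) (hi : i ∈ secL.getD j []) : i < 30 := by
  by_cases hj : j < secL.length
  · rw [List.getD_eq_getElem _ _ hj] at hi
    exact secL_lt _ (List.getElem_mem hj) i hi
  · rw [List.getD_eq_default _ _ (by omega)] at hi
    simp at hi

theorem sec_mem (j : ℕ) : sec (fX ℂ) j ∈ Inv (edeg j) := Inv_list _ (secL_lt' j)

def tdeg (τ : ℕ × (Fin 5 →₀ ℕ)) : ℕ := edeg τ.1 + ∑ i, del i * τ.2 i

theorem th_lt (i : Fin 5) : thL.getD i 0 < 30 := by revert i; decide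
theorem th_deg (i : Fin 5) : degL.getD (thL.getD i 0) 0 = del i := by revert i; decide

theorem fam_mem (τ) : fam (fX ℂ) τ ∈ Inv (tdeg τ) := by
  rw [fam, tdeg, add_comm]
  refine Inv_mul (Inv_prod _ (fun i => del i * τ.2 i) _ (fun i => ?_)) (sec_mem _)
  rw [← th_deg i]
  exact Inv_pow (gen_mem _ (th_lt i)) _

noncomputable def toE (x : Σ _ : ℕ, (Fin 5 →₀ ℕ)) : ℕ × (Fin 5 →₀ ℕ) :=
  (x.1, Finsupp.equivFunOnFinite.symm (fun i => x.2 i / del i))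

noncomputable def Te (d : ℕ) : Finset (ℕ × (Fin 5 →₀ ℕ)) := by
  classical exact (Td d).image toE

theorem mem_Td {d : ℕ} {x : Σ _ : ℕ, (Fin 5 →₀ ℕ)} : x ∈ Td d ↔
    x.1 < 88 ∧ edeg x.1 ≤ d ∧ ∑ i, x.2 i = d - edeg x.1 ∧ ∀ i, del i ∣ x.2 i := by
  rw [Td, Finset.mem_sigma, Finset.mem_range, Tl1]
  split_ifs with h
  · simp [Finset.mem_finsuppAntidiag, h]
  · simp [h]

theorem mem_Te {d : ℕ} {τ : ℕ × (Fin 5 →₀ ℕ)} : τ ∈ Te d ↔ τ.1 < 88 ∧ tdeg τ = d := by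
  classical
  rw [Te, Finset.mem_image]
  constructor
  · rintro ⟨x, hx, rfl⟩
    rw [mem_Td] at hx
    refine ⟨hx.1, ?_⟩
    have e : ∑ i, del i * (toE x).2 i = ∑ i, x.2 i := by
      apply Finset.sum_congr rfl
      intro i _
      exact Nat.mul_div_cancel' (hx.2.2.2 i)
    rw [tdeg, e, hx.2.2.1, toE]
    have := hx.2.1
    simp only
    omega
  · rintro ⟨h1, h2⟩
    refine ⟨⟨τ.1, Finsupp.equivFunOnFinite.symm (fun i => del i * τ.2 i)⟩, ?_, ?_⟩
    · rw [mem_Td]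
      rw [tdeg] at h2
      refine ⟨h1, by simp only; omega, ?_, fun i => Dvd.intro _ rfl⟩
      simp only [Finsupp.coe_equivFunOnFinite_symm]
      omega
    · rw [toE]
      ext i
      · rfl
      · simp [Nat.mul_div_cancel_left _ (del_pos i)]

theorem card_Te (d : ℕ) : (Te d).card = (Td d).card := by
  classical
  rw [Te, Finset.card_image_of_injOn]
  intro x hx y hy hxy
  have hx := (mem_Td.mp hx).2.2.2
  have hy := (mem_Td.mp hy).2.2.2
  obtain ⟨a, l⟩ := x
  obtain ⟨b, m⟩ := y
  simp only [toE, Prod.mk.injEq] at hxy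
  obtain ⟨rfl, h2⟩ := hxy
  congr 1
  ext i
  have h3 := congrFun (Finsupp.equivFunOnFinite.symm.injective h2) i
  rw [← Nat.mul_div_cancel' (hx i), ← Nat.mul_div_cancel' (hy i)]
  exact congrArg (del i * ·) h3

theorem del4 (i : Fin 5) : 4 ∣ del i := by revert i; decide

theorem tdeg_mod (τ) : edeg τ.1 % 4 = tdeg τ % 4 := by
  have : 4 ∣ ∑ i, del i * τ.2 i := Finset.dvd_sum (fun i _ => Dvd.dvd.mul_right (del4 i) _)
  rw [tdeg]; omega

theorem fam_indep (d : ℕ) : LinearIndepOn ℂ (fam (fX ℂ)) (Te d : Set (ℕ × (Fin 5 →₀ ℕ))) := by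
  rw [linearIndepOn_finset_iff]
  intro c h
  refine fam_free (Te d) (d % 4) (fun τ hτ => ?_) c h
  rw [mem_Te] at hτ
  exact ⟨hτ.1, by rw [tdeg_mod, hτ.2]⟩

instance finInv (d : ℕ) : Module.Finite ℂ (Inv d) := Submodule.finiteDimensional_of_le (Inv_le d)

theorem span_fam (d : ℕ) : Submodule.span ℂ (fam (fX ℂ) '' (Te d : Set (ℕ × (Fin 5 →₀ ℕ)))) = Inv d := by
  apply Submodule.eq_of_le_of_finrank_le
  · rw [Submodule.span_le]
    rintro _ ⟨τ, hτ, rfl⟩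
    have := fam_mem τ
    rwa [(mem_Te.mp hτ).2] at this
  · have h := finrank_span_eq_card (fam_indep d)
    rw [← Set.image_eq_range] at h
    rw [h]
    refine (finrank_Inv_le d).trans ?_
    rw [← card_Te]; simp

def gens : Set R8 := (fun i => gen (fX ℂ) i) '' (Set.Iio 30)

theorem fam_adjoin (τ) : fam (fX ℂ) τ ∈ Algebra.adjoin ℂ gens := by
  have hg : ∀ i < 30, gen (fX ℂ) i ∈ Algebra.adjoin ℂ gens := fun i hi =>
    Algebra.subset_adjoin ⟨i, hi, rfl⟩
  rw [fam]
  refine mul_mem (prod_mem (fun i _ => pow_mem (hg _ (th_lt i)) _)) (list_prod_mem ?_)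
  intro x hx
  obtain ⟨i, hi, rfl⟩ := List.mem_map.mp hx
  exact hg i (secL_lt' _ i hi)

theorem Inv_adjoin {d : ℕ} {u : R8} (hu : u ∈ Inv d) : u ∈ Algebra.adjoin ℂ gens := by
  rw [← span_fam] at hu
  have : Submodule.span ℂ (fam (fX ℂ) '' (Te d : Set (ℕ × (Fin 5 →₀ ℕ)))) ≤
      Subalgebra.toSubmodule (Algebra.adjoin ℂ gens) := by
    rw [Submodule.span_le]
    rintro _ ⟨τ, _, rfl⟩
    exact fam_adjoin τ
  exact this hu

theorem adjoin_gens : Algebra.adjoin ℂ gens = Algebra.adjoin ℂ Iset := by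
  apply le_antisymm
  · apply Algebra.adjoin_mono
    rintro _ ⟨i, hi, rfl⟩
    exact (gen_mem i hi).1
  · rw [Algebra.adjoin_le_iff]
    intro u hu
    rw [← sum_homogeneousComponent u]
    exact sum_mem (fun d _ => Inv_adjoin (hc_mem hu d))

end Sept


namespace Sept
open Polynomial.Sept

def dotM : List (ℤ × ℕ × ℕ) → ℕ
  | [] => 0
  | x :: l => Nat.mod (Nat.add (Nat.mul (Int.toNat (x.1 % 1030301)) (Nat.mul x.2.1 x.2.2)) (dotM l)) 1030301

theorem dotM_rel : ∀ (l : List (ℤ × ℕ × ℕ)) (l' : List (ℤ × ZMod 1030301 × ZMod 1030301)),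
    List.Forall₂ (TRel (fun a b => ((a : ℕ) : ZMod 1030301) = b)) l l' → ((dotM l : ℕ) : ZMod 1030301) = dotR l'
  | _, _, .nil => by simp [dotR, dotM]
  | _, _, .cons (a := a) (b := b) (l₁ := l) (l₂ := l') h t => by
    have ih := dotM_rel l l' t
    have e : ∀ n : ℕ, ((Nat.mod n 1030301 : ℕ) : ZMod 1030301) = n := fun n => ZMod.natCast_mod n 1030301
    have e2 : ((Int.toNat (a.1 % 1030301) : ℕ) : ZMod 1030301) = (a.1 : ZMod 1030301) := by
      have h1 : ((Int.toNat (a.1 % 1030301) : ℕ) : ℤ) = a.1 % 1030301 :=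
        Int.toNat_of_nonneg (Int.emod_nonneg _ (by norm_num))
      have h2 : (((Int.toNat (a.1 % 1030301) : ℕ) : ℤ) : ZMod 1030301) = ((a.1 % 1030301 : ℤ) : ZMod 1030301) := by rw [h1]
      rw [Int.cast_natCast] at h2
      rw [h2]
      exact ZMod.intCast_mod a.1 1030301
    rw [dotM, e]
    change ((Int.toNat (a.1 % 1030301) * (a.2.1 * a.2.2) + dotM l : ℕ) : ZMod 1030301) = _
    simp only [dotR, List.map_cons, List.sum_cons] at *
    push_cast
    rw [ih, e2, h.2.1, h.2.2, h.1, mul_assoc]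

theorem genM (f : List ℕ) (k v : ℕ)
    (h : (frcN f fun f => runF dotM 0 frcN ops [f] (fun env => Nat.beq ((env.getD (29 - k) []).getD 0 0) v)) = true) :
    gen (f.map (fun n => ((n : ℕ) : ZMod 1030301))) k = ((v : ℕ) : ZMod 1030301) := by
  rw [frcN_eq, runF_eq _ _ _ frcN_eq] at h
  have h1 : genS dotM 0 f k = v := Nat.eq_of_beq_eq_true h
  have := gen_rel (Rel := fun (a : ℕ) (b : ZMod 1030301) => ((a : ℕ) : ZMod 1030301) = b) (z := 0) (z' := 0) (by simp)
    (dot := dotM) (dot' := dotR) (fun l l' _ h => dotM_rel l l' h) (f := f) (f' := f.map (fun n => ((n : ℕ) : ZMod 1030301)))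
    (by rw [List.forall₂_map_right_iff]; exact List.forall₂_same.2 (fun _ _ => rfl)) k
  rw [h1] at this
  exact this.symm

end Sept


namespace Sept
open Polynomial.Sept

abbrev ZN := ZMod 1030301

theorem support_int {k : ℕ} (hk : k < 30) {m : Fin 8 →₀ ℕ} (h : coeff m (gen (fX ℤ) k) ≠ 0) :
    (∑ i, m i = degL.getD k 0) ∧ wt m = 0 := by
  have h1 := Inv_le _ (gen_mem k hk)
  rw [V, mem_restrictSupport_iff] at h1
  have h2 : m ∈ (gen (fX ℂ) k).support := by
    rw [mem_support_iff, ← fX_map (Int.castRingHom ℂ), ← gen_hom, coeff_map]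
    simpa using h
  exact mem_mons.mp (h1 h2)

theorem evc {k : ℕ} (hk : k < 30) (p : Fin 8 → ZN) (M : Fin 8 →₀ ℕ)
    (h : ∀ m : Fin 8 →₀ ℕ, ∑ i, m i = degL.getD k 0 → wt m = 0 → ∏ i, p i ^ m i ≠ 0 → m = M) :
    gen [p 0, 7 * p 1, 21 * p 2, 35 * p 3, 35 * p 4, 21 * p 5, 7 * p 6, p 7] k =
      ((coeff M (gen (fX ℤ) k) : ℤ) : ZN) * ∏ i, p i ^ M i := by
  have e := gen_hom (eval₂Hom (Int.castRingHom ZN) p) (fX ℤ) k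
  have e2 : (fX ℤ).map (eval₂Hom (Int.castRingHom ZN) p) =
    [p 0, 7 * p 1, 21 * p 2, 35 * p 3, 35 * p 4, 21 * p 5, 7 * p 6, p 7] := by
    simp [fX]
  rw [e2] at e
  rw [← e, coe_eval₂Hom, eval₂_eq', Finset.sum_eq_single M]
  · rfl
  · intro m hm hne
    by_contra hc
    have := support_int hk (mem_support_iff.mp hm)
    exact hne (h m this.1 this.2 (right_ne_zero_of_mul hc))
  · intro hM
    rw [notMem_support_iff.mp hM]; simp

noncomputable def mk8 (l : Fin 8 → ℕ) : Fin 8 →₀ ℕ := Finsupp.equivFunOnFinite.symm l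
theorem mk8_apply (l : Fin 8 → ℕ) (i) : mk8 l i = l i := rfl

theorem eq_mk8 (m : Fin 8 →₀ ℕ) {a b c d e f g h : ℕ} (h0 : m 0 = a) (h1 : m 1 = b) (h2 : m 2 = c) (h3 : m 3 = d)
    (h4 : m 4 = e) (h5 : m 5 = f) (h6 : m 6 = g) (h7 : m 7 = h) : m = mk8 ![a, b, c, d, e, f, g, h] := by
  ext i
  rw [mk8_apply]
  fin_cases i <;> simp <;> assumption

theorem wt8 (m : Fin 8 →₀ ℕ) : wt m = 7 * m 0 + 5 * m 1 + 3 * m 2 + m 3 - m 4 - 3 * m 5 - 5 * m 6 - 7 * m 7 := by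
  rw [wt, Fin.sum_univ_eight]; simp; ring

theorem pow101 {n : ℕ} (h : (101 : ZN) ^ n ≠ 0) : n < 3 := by
  by_contra hn
  push Not at hn
  exact h (pow_eq_zero_of_le hn (by decide))

theorem pow00 {n : ℕ} (h : (0 : ZN) ^ n ≠ 0) : n = 0 := by
  by_contra hn
  exact h (zero_pow hn)

def pB : Fin 8 → ZN := ![1, 101, 0, 0, 0, 1, 0, 0]
def pC : Fin 8 → ZN := ![1, 0, 101, 0, 0, 1, 0, 0]

theorem pB_prod (m : Fin 8 →₀ ℕ) : ∏ i, pB i ^ m i = 101 ^ m 1 * 0 ^ m 2 * 0 ^ m 3 * 0 ^ m 4 * 0 ^ m 6 * 0 ^ m 7 := by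
  rw [Fin.prod_univ_eight]; simp [pB]
theorem pC_prod (m : Fin 8 →₀ ℕ) : ∏ i, pC i ^ m i = 0 ^ m 1 * 101 ^ m 2 * 0 ^ m 3 * 0 ^ m 4 * 0 ^ m 6 * 0 ^ m 7 := by
  rw [Fin.prod_univ_eight]; simp [pC]

theorem pB_ne {m : Fin 8 →₀ ℕ} (h : ∏ i, pB i ^ m i ≠ 0) :
    m 1 < 3 ∧ m 2 = 0 ∧ m 3 = 0 ∧ m 4 = 0 ∧ m 6 = 0 ∧ m 7 = 0 := by
  rw [pB_prod] at h
  have a7 := right_ne_zero_of_mul h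
  have h := left_ne_zero_of_mul h
  have a6 := right_ne_zero_of_mul h
  have h := left_ne_zero_of_mul h
  have a4 := right_ne_zero_of_mul h
  have h := left_ne_zero_of_mul h
  have a3 := right_ne_zero_of_mul h
  have h := left_ne_zero_of_mul h
  have a2 := right_ne_zero_of_mul h
  have h := left_ne_zero_of_mul h
  exact ⟨pow101 h, pow00 a2, pow00 a3, pow00 a4, pow00 a6, pow00 a7⟩

theorem pC_ne {m : Fin 8 →₀ ℕ} (h : ∏ i, pC i ^ m i ≠ 0) :
    m 1 = 0 ∧ m 2 < 3 ∧ m 3 = 0 ∧ m 4 = 0 ∧ m 6 = 0 ∧ m 7 = 0 := by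
  rw [pC_prod] at h
  have a7 := right_ne_zero_of_mul h
  have h := left_ne_zero_of_mul h
  have a6 := right_ne_zero_of_mul h
  have h := left_ne_zero_of_mul h
  have a4 := right_ne_zero_of_mul h
  have h := left_ne_zero_of_mul h
  have a3 := right_ne_zero_of_mul h
  have h := left_ne_zero_of_mul h
  have a2 := right_ne_zero_of_mul h
  have h := left_ne_zero_of_mul h
  exact ⟨pow00 h, pow101 a2, pow00 a3, pow00 a4, pow00 a6, pow00 a7⟩

theorem pB_gen (k v : ℕ)
    (h : (frcN [1, 707, 0, 0, 0, 21, 0, 0] fun f => runF dotM 0 frcN ops [f] (fun env => Nat.beq ((env.getD (29 - k) []).getD 0 0) v)) = true) :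
    gen [pB 0, 7 * pB 1, 21 * pB 2, 35 * pB 3, 35 * pB 4, 21 * pB 5, 7 * pB 6, pB 7] k = (v : ZN) := by
  rw [← genM _ k v h]
  congr 1
theorem pC_gen (k v : ℕ)
    (h : (frcN [1, 0, 2121, 0, 0, 21, 0, 0] fun f => runF dotM 0 frcN ops [f] (fun env => Nat.beq ((env.getD (29 - k) []).getD 0 0) v)) = true) :
    gen [pC 0, 7 * pC 1, 21 * pC 2, 35 * pC 3, 35 * pC 4, 21 * pC 5, 7 * pC 6, pC 7] k = (v : ZN) := by
  rw [← genM _ k v h]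
  congr 1

noncomputable def M20 : Fin 8 →₀ ℕ := mk8 ![6, 0, 0, 0, 0, 14, 0, 0]
noncomputable def M30 : Fin 8 →₀ ℕ := mk8 ![9, 0, 0, 0, 0, 21, 0, 0]
noncomputable def M26 : Fin 8 →₀ ℕ := mk8 ![7, 1, 0, 0, 0, 18, 0, 0]
noncomputable def Ma : Fin 8 →₀ ℕ := mk8 ![5, 2, 0, 0, 0, 15, 0, 0]
noncomputable def Mb : Fin 8 →₀ ℕ := mk8 ![6, 0, 1, 0, 0, 15, 0, 0]

theorem zn_eq {a b : ℤ} (h : (a : ZN) = (b : ZN)) : (1030301 : ℤ) ∣ b - a := by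
  have := (ZMod.intCast_eq_intCast_iff_dvd_sub a b 1030301).mp h
  exact_mod_cast this

theorem evB {k d : ℕ} (hk : k < 30) (hd : degL.getD k 0 = d) (v : ℕ)
    (h : (frcN [1, 707, 0, 0, 0, 21, 0, 0] fun f => runF dotM 0 frcN ops [f] (fun env => Nat.beq ((env.getD (29 - k) []).getD 0 0) v)) = true)
    (a b c : ℕ) (hab : ∀ x y z : ℕ, x + y + z = d → 7 * x + 5 * y = 3 * z → y < 3 → x = a ∧ y = b ∧ z = c) :
    (1030301 : ℤ) ∣ v - coeff (mk8 ![a, b, 0, 0, 0, c, 0, 0]) (gen (fX ℤ) k) * 101 ^ b := by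
  apply zn_eq
  have e := evc hk pB (mk8 ![a, b, 0, 0, 0, c, 0, 0]) (by
    intro m h1 h2 h3
    obtain ⟨h4, h5, h6, h7, h8, h9⟩ := pB_ne h3
    rw [wt8] at h2
    rw [hd, Fin.sum_univ_eight] at h1
    have := hab (m 0) (m 1) (m 5) (by omega) (by omega) h4
    exact eq_mk8 m this.1 this.2.1 h5 h6 h7 this.2.2 h8 h9)
  rw [pB_gen k v h, pB_prod] at e
  simp only [mk8_apply] at e
  push_cast
  rw [e]
  simp

theorem evC {k d : ℕ} (hk : k < 30) (hd : degL.getD k 0 = d) (v : ℕ)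
    (h : (frcN [1, 0, 2121, 0, 0, 21, 0, 0] fun f => runF dotM 0 frcN ops [f] (fun env => Nat.beq ((env.getD (29 - k) []).getD 0 0) v)) = true)
    (a b c : ℕ) (hab : ∀ x y z : ℕ, x + y + z = d → 7 * x + 3 * y = 3 * z → y < 3 → x = a ∧ y = b ∧ z = c) :
    (1030301 : ℤ) ∣ v - coeff (mk8 ![a, 0, b, 0, 0, c, 0, 0]) (gen (fX ℤ) k) * 101 ^ b := by
  apply zn_eq
  have e := evc hk pC (mk8 ![a, 0, b, 0, 0, c, 0, 0]) (by
    intro m h1 h2 h3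
    obtain ⟨h4, h5, h6, h7, h8, h9⟩ := pC_ne h3
    rw [wt8] at h2
    rw [hd, Fin.sum_univ_eight] at h1
    have := hab (m 0) (m 2) (m 5) (by omega) (by omega) h5
    exact eq_mk8 m this.1 h4 this.2.1 h6 h7 this.2.2 h8 h9)
  rw [pC_gen k v h, pC_prod] at e
  simp only [mk8_apply] at e
  push_cast
  rw [e]
  simp

theorem c25 : coeff M20 (gen (fX ℤ) 25) ≠ 0 := by
  have h := evB (k := 25) (d := 20) (by norm_num) (by decide) 881883 (by decide +kernel) 6 0 14 (by omega)
  rw [← M20] at h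
  omega
theorem c29 : coeff M30 (gen (fX ℤ) 29) ≠ 0 := by
  have h := evB (k := 29) (d := 30) (by norm_num) (by decide) 798147 (by decide +kernel) 9 0 21 (by omega)
  rw [← M30] at h
  omega
theorem c28 : coeff M26 (gen (fX ℤ) 28) ≠ 0 := by
  have h := evB (k := 28) (d := 26) (by norm_num) (by decide) 276033 (by decide +kernel) 7 1 18 (by omega)
  rw [← M26] at h
  omega
theorem c2627 : coeff Ma (gen (fX ℤ) 26) * coeff Mb (gen (fX ℤ) 27) -
    coeff Ma (gen (fX ℤ) 27) * coeff Mb (gen (fX ℤ) 26) ≠ 0 := by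
  have h1 := evB (k := 26) (d := 22) (by norm_num) (by decide) 805879 (by decide +kernel) 5 2 15 (by omega)
  have h2 := evC (k := 26) (d := 22) (by norm_num) (by decide) 0 (by decide +kernel) 6 1 15 (by omega)
  have h3 := evC (k := 27) (d := 22) (by norm_num) (by decide) 680235 (by decide +kernel) 6 1 15 (by omega)
  rw [← Ma] at h1
  rw [← Mb] at h2 h3
  generalize coeff Ma (gen (fX ℤ) 26) = A at *
  generalize coeff Mb (gen (fX ℤ) 26) = B at *
  generalize coeff Mb (gen (fX ℤ) 27) = D at *
  generalize coeff Ma (gen (fX ℤ) 27) = E at *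
  obtain ⟨x, hx⟩ : (101 : ℤ) ∣ A - 79 := by omega
  obtain ⟨y, hy⟩ : (101 : ℤ) ∣ B := by omega
  obtain ⟨z, hz⟩ : (101 : ℤ) ∣ D - 69 := by omega
  have hA : A = 79 + 101 * x := by omega
  have hD : D = 69 + 101 * z := by omega
  intro h0
  rw [hA, hD, hy] at h0
  have : 79 * 69 + 101 * (79 * z + 69 * x + 101 * x * z - E * y) = 0 := by linear_combination h0
  omega

end Sept


namespace Sept
open Polynomial.Sept

theorem edeg_small : ∀ j < 88, edeg j % 4 = 2 → 14 ≤ edeg j := by decide +kernel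

theorem Inv_zero {d : ℕ} (hd : d = 2 ∨ d = 6 ∨ d = 10) {u : R8} (hu : u ∈ Inv d) : u = 0 := by
  have h : Te d = ∅ := by
    rw [Finset.eq_empty_iff_forall_notMem]
    intro τ hτ
    rw [mem_Te] at hτ
    have h1 := tdeg_mod τ
    have h2 := edeg_small τ.1 hτ.1
    have h3 : edeg τ.1 ≤ tdeg τ := by rw [tdeg]; omega
    omega
  rw [← span_fam, h] at hu
  simpa using hu

/-- functional killing the products of positive degree invariants -/
def Kills (d : ℕ) (ℓ : R8 →ₗ[ℂ] ℂ) : Prop :=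
  ∀ a b : ℕ, 0 < a → 0 < b → a + b = d → ∀ u ∈ Inv a, ∀ v ∈ Inv b, ℓ (u * v) = 0

theorem kills_coeff {d : ℕ} (p q r s : ℕ)
    (h : ∀ x y z w a b : ℕ, 0 < a → 0 < b → a + b = d → x ≤ p → y ≤ q → z ≤ r → w ≤ s → x + y + z + w = a →
      7 * x + 5 * y + 3 * z = 3 * w → (a = 2 ∨ a = 6 ∨ a = 10) ∨ (b = 2 ∨ b = 6 ∨ b = 10)) :
    Kills d (lcoeff ℂ (mk8 ![p, q, r, 0, 0, s, 0, 0])) := by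
  classical
  intro a b ha hb hab u hu v hv
  rw [lcoeff_apply, coeff_mul]
  apply Finset.sum_eq_zero
  intro x hx
  rw [Finset.HasAntidiagonal.mem_antidiagonal] at hx
  by_contra hne
  have h1 := Inv_le _ hu
  rw [V, mem_restrictSupport_iff] at h1
  have h2 := mem_mons.mp (h1 (mem_support_iff.mpr (left_ne_zero_of_mul hne)))
  rw [wt8, Fin.sum_univ_eight] at h2
  have hh : ∀ i, x.1 i + x.2 i = ![p, q, r, 0, 0, s, 0, 0] i := fun i => by
    exact (DFunLike.congr_fun hx i :)
  have e0 := hh 0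
  have e1 := hh 1
  have e2 := hh 2
  have e3 := hh 3
  have e4 := hh 4
  have e5 := hh 5
  have e6 := hh 6
  have e7 := hh 7
  simp at e0 e1 e2 e3 e4 e5 e6 e7
  obtain ⟨g1, g2⟩ := h2
  rw [e3.1, e4.1, e6.1, e7.1] at g1 g2
  have h3 := h (x.1 0) (x.1 1) (x.1 2) (x.1 5) a b ha hb hab (by omega) (by omega) (by omega) (by omega) (by omega) (by omega)
  rcases h3 with h3 | h3
  · rw [Inv_zero h3 hu] at hne; simp at hne
  · rw [Inv_zero h3 hv] at hne; simp at hne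

theorem K20 : Kills 20 (lcoeff ℂ M20) := kills_coeff 6 0 0 14 (by omega)
theorem K30 : Kills 30 (lcoeff ℂ M30) := kills_coeff 9 0 0 21 (by omega)
theorem K26 : Kills 26 (lcoeff ℂ M26) := kills_coeff 7 1 0 18 (by
  intro x y z w a b h1 h2 h3 h4 h5 h6 h7 h8 h9
  interval_cases y <;> interval_cases x <;> omega)
theorem Ka : Kills 22 (lcoeff ℂ Ma) := kills_coeff 5 2 0 15 (by omega)
theorem Kb : Kills 22 (lcoeff ℂ Mb) := kills_coeff 6 0 1 15 (by omega)

theorem Kills.smul {d : ℕ} {l : R8 →ₗ[ℂ] ℂ} (h : Kills d l) (c : ℂ) : Kills d (c • l) := by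
  intro a b ha hb hab u hu v hv
  rw [LinearMap.smul_apply, h a b ha hb hab u hu v hv, smul_zero]
theorem Kills.sub {d : ℕ} {l l' : R8 →ₗ[ℂ] ℂ} (h : Kills d l) (h' : Kills d l') : Kills d (l - l') := by
  intro a b ha hb hab u hu v hv
  rw [LinearMap.sub_apply, h a b ha hb hab u hu v hv, h' a b ha hb hab u hu v hv, sub_zero]

theorem lc_int (M : Fin 8 →₀ ℕ) (k : ℕ) : lcoeff ℂ M (gen (fX ℂ) k) = ((coeff M (gen (fX ℤ) k) : ℤ) : ℂ) := by
  rw [lcoeff_apply, ← fX_map (Int.castRingHom ℂ), ← gen_hom, coeff_map]; rfl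

def Good1 (i : ℕ) : Prop := ∃ ℓ : R8 →ₗ[ℂ] ℂ, Kills (degL.getD i 0) ℓ ∧ ℓ (gen (fX ℂ) i) = 1 ∧
  ∀ k < 30, k ≠ i → degL.getD k 0 = degL.getD i 0 → ℓ (gen (fX ℂ) k) = 0

theorem good1_of {i d : ℕ} (M : Fin 8 →₀ ℕ) (hd : degL.getD i 0 = d) (hK : Kills d (lcoeff ℂ M))
    (hc : coeff M (gen (fX ℤ) i) ≠ 0) (hu : ∀ k < 30, degL.getD k 0 = d → k = i) : Good1 i := by
  have hc' : ((coeff M (gen (fX ℤ) i) : ℤ) : ℂ) ≠ 0 := by exact_mod_cast hc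
  refine ⟨((coeff M (gen (fX ℤ) i) : ℤ) : ℂ)⁻¹ • lcoeff ℂ M, by rw [hd]; exact hK.smul _, ?_, ?_⟩
  · rw [LinearMap.smul_apply, lc_int, smul_eq_mul, inv_mul_cancel₀ hc']
  · intro k hk hne hkd
    exact absurd (hu k hk (hkd.trans hd)) hne

theorem g25 : Good1 25 := good1_of M20 (by decide) K20 c25 (by decide)
theorem g28 : Good1 28 := good1_of M26 (by decide) K26 c28 (by decide)
theorem g29 : Good1 29 := good1_of M30 (by decide) K30 c29 (by decide)

theorem only22 : ∀ k < 30, degL.getD k 0 = 22 → k = 26 ∨ k = 27 := by decide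

theorem g2627 : Good1 26 ∧ Good1 27 := by
  have hc := c2627
  have l1 := lc_int Ma 26
  have l2 := lc_int Ma 27
  have l3 := lc_int Mb 26
  have l4 := lc_int Mb 27
  generalize coeff Ma (gen (fX ℤ) 26) = A at *
  generalize coeff Mb (gen (fX ℤ) 26) = B at *
  generalize coeff Mb (gen (fX ℤ) 27) = D at *
  generalize coeff Ma (gen (fX ℤ) 27) = E at *
  have hc' : ((A : ℂ) * D - E * B) ≠ 0 := by exact_mod_cast hc
  constructor
  · refine ⟨((A : ℂ) * D - E * B)⁻¹ • ((D : ℂ) • lcoeff ℂ Ma - (E : ℂ) • lcoeff ℂ Mb), ((Ka.smul _).sub (Kb.smul _)).smul _, ?_, ?_⟩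
    · simp only [LinearMap.smul_apply, LinearMap.sub_apply, l1, l3, smul_eq_mul]
      rw [mul_comm (D : ℂ), inv_mul_cancel₀ hc']
    · intro k hk hne hkd
      obtain rfl : k = 27 := (only22 k hk hkd).resolve_left hne
      simp only [LinearMap.smul_apply, LinearMap.sub_apply, l2, l4, smul_eq_mul]
      ring
  · refine ⟨((A : ℂ) * D - E * B)⁻¹ • ((A : ℂ) • lcoeff ℂ Mb - (B : ℂ) • lcoeff ℂ Ma), ((Kb.smul _).sub (Ka.smul _)).smul _, ?_, ?_⟩
    · simp only [LinearMap.smul_apply, LinearMap.sub_apply, l2, l4, smul_eq_mul]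
      rw [mul_comm (B : ℂ), inv_mul_cancel₀ hc']
    · intro k hk hne hkd
      obtain rfl : k = 26 := (only22 k hk hkd).resolve_right hne
      simp only [LinearMap.smul_apply, LinearMap.sub_apply, l1, l3, smul_eq_mul]
      ring

/-- size of an index -/
def tsz (τ : ℕ × (Fin 5 →₀ ℕ)) : ℕ := (secL.getD τ.1 []).length + ∑ i, τ.2 i

theorem perm_tab : ∀ j < 88, ∀ k < 88, edeg j + edeg k ≤ 18 →
    ∃ l < 88, (secL.getD j [] ++ secL.getD k []).Perm (secL.getD l []) := by
  decide +kernel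

theorem dual_exists (d : ℕ) (τ : ℕ × (Fin 5 →₀ ℕ)) (hτ : τ ∈ Te d) :
    ∃ ℓ : R8 →ₗ[ℂ] ℂ, ℓ (fam (fX ℂ) τ) = 1 ∧ ∀ σ ∈ Te d, σ ≠ τ → ℓ (fam (fX ℂ) σ) = 0 := by
  have hli := fam_indep d
  let B := Module.Basis.span (v := fun x : (Te d : Set (ℕ × (Fin 5 →₀ ℕ))) => fam (fX ℂ) x) hli
  obtain ⟨ℓ, hℓ⟩ := LinearMap.exists_extend (B.coord ⟨τ, hτ⟩)
  have key : ∀ σ (hσ : σ ∈ Te d), ℓ (fam (fX ℂ) σ) = B.coord ⟨τ, hτ⟩ (B ⟨σ, hσ⟩) := by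
    intro σ hσ
    rw [← hℓ, LinearMap.comp_apply]
    exact congrArg ℓ (congrArg Subtype.val (Module.Basis.span_apply hli ⟨σ, hσ⟩)).symm
  refine ⟨ℓ, ?_, ?_⟩
  · rw [key τ hτ]; simp
  · intro σ hσ hne
    rw [key σ hσ, Module.Basis.coord_apply, Module.Basis.repr_self, Finsupp.single_eq_of_ne]
    intro h; exact hne (congrArg Subtype.val h).symm

theorem list_map_prod_perm {l l' : List ℕ} (h : l.Perm l') (f : ℕ → R8) : (l.map f).prod = (l'.map f).prod :=
  (h.map f).prod_eq

theorem edeg0 : ∀ j < 88, (secL.getD j []).length = 0 → edeg j = 0 := by decide +kernel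

theorem tsz_pos {τ} (h1 : τ.1 < 88) (h : 0 < tdeg τ) : 0 < tsz τ := by
  by_contra h0
  have h0 : tsz τ = 0 := by omega
  rw [tsz, Nat.add_eq_zero_iff, Finset.sum_eq_zero_iff] at h0
  rw [tdeg, edeg0 _ h1 h0.1, Finset.sum_eq_zero] at h
  · omega
  · intro i hi; rw [h0.2 i hi, mul_zero]

theorem fam_mul {σ τ : ℕ × (Fin 5 →₀ ℕ)} (hσ : σ.1 < 88) (hτ : τ.1 < 88) (h : tdeg σ + tdeg τ ≤ 18) :
    ∃ ρ : ℕ × (Fin 5 →₀ ℕ), ρ.1 < 88 ∧ tdeg ρ = tdeg σ + tdeg τ ∧ tsz ρ = tsz σ + tsz τ ∧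
      fam (fX ℂ) σ * fam (fX ℂ) τ = fam (fX ℂ) ρ := by
  obtain ⟨l, hl, hp⟩ := perm_tab σ.1 hσ τ.1 hτ (by rw [tdeg, tdeg] at h; omega)
  refine ⟨(l, σ.2 + τ.2), hl, ?_, ?_, ?_⟩
  · have e : edeg l = edeg σ.1 + edeg τ.1 := by
      have := (hp.map (fun i => degL.getD i 0)).sum_eq
      rw [List.map_append, List.sum_append] at this
      exact this.symm
    simp only [tdeg, e, Finsupp.add_apply, mul_add, Finset.sum_add_distrib]
    omega
  · have e := hp.length_eq
    rw [List.length_append] at e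
    simp only [tsz, ← e, Finsupp.add_apply, Finset.sum_add_distrib]
    omega
  · have e : sec (fX ℂ) l = sec (fX ℂ) σ.1 * sec (fX ℂ) τ.1 := by
      have := list_map_prod_perm hp (gen (fX ℂ))
      rw [List.map_append, List.prod_append] at this
      exact this.symm
    simp only [fam, e, Finsupp.add_apply, pow_add, Finset.prod_mul_distrib]
    ring

open scoped Pointwise in
theorem kills_dual {d : ℕ} (hd : d ≤ 18) {ℓ : R8 →ₗ[ℂ] ℂ} (h : ∀ σ ∈ Te d, 2 ≤ tsz σ → ℓ (fam (fX ℂ) σ) = 0) :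
    Kills d ℓ := by
  intro a b ha hb hab u hu v hv
  rw [← span_fam] at hu hv
  have h1 : u * v ∈ Submodule.span ℂ (fam (fX ℂ) '' (Te a : Set (ℕ × (Fin 5 →₀ ℕ)))) *
    Submodule.span ℂ (fam (fX ℂ) '' (Te b : Set (ℕ × (Fin 5 →₀ ℕ)))) := Submodule.mul_mem_mul hu hv
  rw [Submodule.span_mul_span] at h1
  have h2 : Submodule.span ℂ ((fam (fX ℂ) '' (Te a : Set (ℕ × (Fin 5 →₀ ℕ)))) *
    (fam (fX ℂ) '' (Te b : Set (ℕ × (Fin 5 →₀ ℕ))))) ≤ LinearMap.ker ℓ := by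
    rw [Submodule.span_le]
    rintro _ ⟨_, ⟨σ, hσ, rfl⟩, _, ⟨τ, hτ, rfl⟩, rfl⟩
    have hσ := mem_Te.mp hσ
    have hτ := mem_Te.mp hτ
    obtain ⟨ρ, r1, r2, r3, r4⟩ := fam_mul hσ.1 hτ.1 (by omega)
    have p1 := tsz_pos hσ.1 (by omega)
    have p2 := tsz_pos hτ.1 (by omega)
    rw [SetLike.mem_coe, LinearMap.mem_ker]
    change ℓ (fam (fX ℂ) σ * fam (fX ℂ) τ) = 0
    rw [r4]
    exact h ρ (mem_Te.mpr ⟨r1, by omega⟩) (by omega)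
  exact h2 h1

def tauD (i : ℕ) : ℕ × List ℕ :=
  if i ∈ thL then (0, (List.range 5).map (fun k => if thL.getD k 0 = i then 1 else 0))
  else (secL.idxOf [i], [0, 0, 0, 0, 0])
noncomputable def tau (i : ℕ) : ℕ × (Fin 5 →₀ ℕ) :=
  ((tauD i).1, Finsupp.equivFunOnFinite.symm (fun k => (tauD i).2.getD k 0))

theorem tau_props : ∀ i < 25, (tauD i).1 < 88 ∧
    edeg (tauD i).1 + ∑ k : Fin 5, del k * (tauD i).2.getD k 0 = degL.getD i 0 ∧
    (secL.getD (tauD i).1 []).length + ∑ k : Fin 5, (tauD i).2.getD k 0 = 1 := by decide +kernel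

theorem tau_inj : ∀ i < 25, ∀ j < 25, (tauD i).1 = (tauD j).1 → (∀ k : Fin 5, (tauD i).2.getD k 0 = (tauD j).2.getD k 0) → i = j := by
  decide +kernel

theorem tauD_fam : ∀ i < 25, (secL.getD (tauD i).1 [] = [i] ∧ ∀ k : Fin 5, (tauD i).2.getD k 0 = 0) ∨
    (secL.getD (tauD i).1 [] = [] ∧ ∃ k : Fin 5, thL.getD k 0 = i ∧ ∀ k' : Fin 5, (tauD i).2.getD k' 0 = if k' = k then 1 else 0) := by
  decide +kernel

theorem fam_tau (i : ℕ) (hi : i < 25) : fam (fX ℂ) (tau i) = gen (fX ℂ) i := by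
  have e : ∀ k : Fin 5, (tau i).2 k = (tauD i).2.getD k 0 := fun k => rfl
  rw [fam, sec]
  simp only [e]
  change _ * ((secL.getD (tauD i).1 []).map _).prod = _
  rcases tauD_fam i hi with ⟨h1, h2⟩ | ⟨h1, k, h2, h3⟩
  · rw [h1]; simp only [h2]; simp
  · rw [h1]; simp only [h3, pow_ite, pow_one, pow_zero, Finset.prod_ite_eq', Finset.mem_univ, if_true, List.map_nil, List.prod_nil, mul_one]
    rw [h2]

theorem small25 : ∀ i < 25, degL.getD i 0 ≤ 18 := by decide
theorem small25' : ∀ i < 25, ∀ k < 30, degL.getD k 0 = degL.getD i 0 → k < 25 := by decide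

theorem g_small (i : ℕ) (hi : i < 25) : Good1 i := by
  have hp := tau_props i hi
  obtain ⟨ℓ, h1, h2⟩ := dual_exists (degL.getD i 0) (tau i) (mem_Te.mpr ⟨hp.1, hp.2.1⟩)
  rw [fam_tau i hi] at h1
  refine ⟨ℓ, kills_dual (small25 i hi) ?_, h1, ?_⟩
  · intro σ hσ hs
    apply h2 σ hσ
    rintro rfl
    have : tsz (tau i) = 1 := hp.2.2
    omega
  · intro k hk hne hkd
    have hk' := small25' i hi k hk hkd
    have hq := tau_props k hk'
    rw [← fam_tau k hk']
    have hm : (tau k).1 < 88 ∧ tdeg (tau k) = degL.getD i 0 := ⟨hq.1, hq.2.1.trans hkd⟩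
    apply h2 (tau k) (mem_Te.mpr hm)
    intro he
    apply hne
    have e1 : (tau k).1 = (tau i).1 := congrArg Prod.fst he
    have e2 : (tau k).2 = (tau i).2 := congrArg Prod.snd he
    exact tau_inj k hk' i hi e1 (fun x => DFunLike.congr_fun e2 x)

theorem good1 (i : ℕ) (hi : i < 30) : Good1 i := by
  by_cases h : i < 25
  · exact g_small i h
  · have := g2627
    have : i = 25 ∨ i = 26 ∨ i = 27 ∨ i = 28 ∨ i = 29 := by omega
    rcases this with rfl | rfl | rfl | rfl | rfl
    exacts [g25, g2627.1, g2627.2, g28, g29]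

theorem degL_pos : ∀ i < 30, 0 < degL.getD i 0 := by decide

theorem exists_L : ∃ L : R8 →ₗ[ℂ] (Fin 30 → ℂ), L 1 = 0 ∧
    (∀ u ∈ Iset, ∀ v ∈ Iset, constantCoeff u = 0 → constantCoeff v = 0 → L (u * v) = 0) ∧
    ∀ k : Fin 30, L (gen (fX ℂ) k) = Pi.single k 1 := by
  have h := fun i : Fin 30 => good1 i i.2
  choose ℓ h1 h2 h3 using h
  refine ⟨LinearMap.pi (fun i : Fin 30 => (ℓ i).comp (homogeneousComponent (degL.getD i 0))), ?_, ?_, ?_⟩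
  · ext i
    rw [LinearMap.pi_apply, LinearMap.comp_apply,
      homogeneousComponent_of_mem ((mem_homogeneousSubmodule _ _).mpr (isHomogeneous_one (Fin 8) ℂ)), if_neg]
    · simp
    · have := degL_pos i i.2; omega
  · intro u hu v hv hu0 hv0
    ext i
    rw [LinearMap.pi_apply, LinearMap.comp_apply]
    conv_lhs => rw [← sum_homogeneousComponent u, ← sum_homogeneousComponent v, Finset.sum_mul_sum]
    rw [map_sum, map_sum]
    apply Finset.sum_eq_zero
    intro a _
    rw [map_sum, map_sum]
    apply Finset.sum_eq_zero
    intro b _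
    have ha := hc_mem hu a
    have hb := hc_mem hv b
    rw [homogeneousComponent_of_mem ((mem_homogeneousSubmodule _ _).mpr (ha.2.mul hb.2))]
    split_ifs with hab
    · have z : ∀ w : R8, constantCoeff w = 0 → homogeneousComponent 0 w = 0 := by
        intro w hw
        rw [homogeneousComponent_zero, ← constantCoeff_eq, hw, C_0]
      rcases Nat.eq_zero_or_pos a with rfl | pa
      · rw [z u hu0, zero_mul, map_zero]
      rcases Nat.eq_zero_or_pos b with rfl | pb
      · rw [z v hv0, mul_zero, map_zero]
      exact h1 i a b pa pb hab.symm _ ha _ hb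
    · rw [map_zero]
  · intro k
    ext i
    rw [LinearMap.pi_apply, LinearMap.comp_apply,
      homogeneousComponent_of_mem ((mem_homogeneousSubmodule _ _).mpr (gen_mem k k.2).2)]
    by_cases hki : k = i
    · subst hki
      rw [if_pos rfl, h2, Pi.single_eq_same]
    · rw [Pi.single_eq_of_ne (fun h => hki h.symm)]
      split_ifs with hd
      · exact h3 i k k.2 (fun h => hki (Fin.ext h)) hd.symm
      · rw [map_zero]

theorem adjoin_Iset {x : R8} (h : x ∈ Algebra.adjoin ℂ Iset) : x ∈ Iset := by
  let S : Subalgebra ℂ R8 :=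
    { carrier := Iset
      mul_mem' := by
        rintro a b ⟨h1, h2⟩ ⟨h3, h4⟩
        exact ⟨by rw [Derivation.leibniz, h1, h3]; simp, by rw [Derivation.leibniz, h2, h4]; simp⟩
      add_mem' := by
        rintro a b ⟨h1, h2⟩ ⟨h3, h4⟩
        exact ⟨by rw [map_add, h1, h3, add_zero], by rw [map_add, h2, h4, add_zero]⟩
      algebraMap_mem' := fun r => ⟨by simp, by simp⟩ }
  have : Algebra.adjoin ℂ Iset ≤ S := Algebra.adjoin_le (fun _ h => h)
  exact this h

theorem C_Iset (c : ℂ) : (C c : R8) ∈ Iset := ⟨by rw [← algebraMap_eq]; simp, by rw [← algebraMap_eq]; simp⟩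

theorem final : (∃ s : Finset R8, s.card = 30 ∧
        Algebra.adjoin ℂ (s : Set R8) = Algebra.adjoin ℂ Iset) ∧
      (∀ s : Finset R8, Algebra.adjoin ℂ (s : Set R8) = Algebra.adjoin ℂ Iset → 30 ≤ s.card) := by
  classical
  obtain ⟨L, L1, L2, L3⟩ := exists_L
  constructor
  · refine ⟨Finset.univ.image (fun k : Fin 30 => gen (fX ℂ) k), ?_, ?_⟩
    · rw [Finset.card_image_of_injective]
      · simp
      · intro a b hab
        have h := congrArg L hab
        simp only [L3] at h
        by_contra hne
        have := congrFun h a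
        rw [Pi.single_eq_same, Pi.single_eq_of_ne hne] at this
        exact one_ne_zero this
    · rw [← adjoin_gens]
      congr 1
      ext x
      simp only [Finset.coe_image, Finset.coe_univ, Set.image_univ, Set.mem_range, gens, Set.mem_image, Set.mem_Iio]
      constructor
      · rintro ⟨k, rfl⟩; exact ⟨k, k.2, rfl⟩
      · rintro ⟨k, hk, rfl⟩; exact ⟨⟨k, hk⟩, rfl⟩
  · intro s hs
    have hI : ∀ x ∈ Algebra.adjoin ℂ (s : Set R8), x ∈ Iset := fun x hx => adjoin_Iset (hs ▸ hx)
    have key : ∀ x ∈ Algebra.adjoin ℂ (s : Set R8), L x ∈ Submodule.span ℂ (s.image L : Set (Fin 30 → ℂ)) := by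
      intro x hx
      induction hx using Algebra.adjoin_induction with
      | mem x hx => exact Submodule.subset_span (by simpa using ⟨x, hx, rfl⟩)
      | algebraMap r =>
        rw [Algebra.algebraMap_eq_smul_one, map_smul, L1, smul_zero]; exact zero_mem _
      | add x y _ _ h1 h2 => rw [map_add]; exact add_mem h1 h2
      | mul x y hx hy h1 h2 =>
        have hx := hI x hx
        have hy := hI y hy
        have sI : ∀ z ∈ Iset, z - C (constantCoeff z) ∈ Iset := by
          intro z hz
          have := C_Iset (constantCoeff z)
          exact ⟨by rw [map_sub, hz.1, this.1, sub_zero], by rw [map_sub, hz.2, this.2, sub_zero]⟩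
        have e := L2 _ (sI x hx) _ (sI y hy) (by simp) (by simp)
        have e2 : x * y = (x - C (constantCoeff x)) * (y - C (constantCoeff y)) +
            (constantCoeff x • y + constantCoeff y • x) - (constantCoeff x * constantCoeff y) • (1 : R8) := by
          simp only [smul_eq_C_mul, C_mul]; ring
        rw [e2, map_sub, map_add, e, map_smul, L1, smul_zero, sub_zero, zero_add, map_add, map_smul, map_smul]
        exact add_mem (Submodule.smul_mem _ _ h2) (Submodule.smul_mem _ _ h1)
    have htop : Submodule.span ℂ (s.image L : Set (Fin 30 → ℂ)) = ⊤ := by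
      rw [eq_top_iff, ← (Pi.basisFun ℂ (Fin 30)).span_eq, Submodule.span_le]
      rintro _ ⟨k, rfl⟩
      rw [Pi.basisFun_apply, ← L3 k]
      apply key
      rw [hs]
      exact Algebra.subset_adjoin (gen_mem k k.2).1
    have h1 := finrank_span_finset_le_card (R := ℂ) (s.image L)
    rw [Set.finrank, htop, finrank_top, Module.finrank_fin_fun] at h1
    exact h1.trans Finset.card_image_le

end Sept

theorem minimal_number_of_generators_eq_thirty :
    (∃ s : Finset (MvPolynomial (Fin 8) ℂ), s.card = 30 ∧
        Algebra.adjoin ℂ (s : Set (MvPolynomial (Fin 8) ℂ)) =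
          Algebra.adjoin ℂ {f : MvPolynomial (Fin 8) ℂ | D1 f = 0 ∧ D2 f = 0}) ∧
      (∀ s : Finset (MvPolynomial (Fin 8) ℂ),
        Algebra.adjoin ℂ (s : Set (MvPolynomial (Fin 8) ℂ)) =
          Algebra.adjoin ℂ {f : MvPolynomial (Fin 8) ℂ | D1 f = 0 ∧ D2 f = 0} →
        30 ≤ s.card) := by
  exact Sept.final
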